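/- For every ε > 0 and every positive integer k there exists n₀ such that for all n ≥ n₀ the following holds: every locally k-bounded edge-coloring of the complete graph K_n contains a rainbow copy of every tree with at most (1 − ε)·n/k vertices. -/

import Mathlib

namespace RainbowTrees

open Finset

section

variable {U : Type*} [DecidableEq U]

/-- The alive edges through `u`: those inside `A`. -/
def aliveAt (H : Finset (Finset U)) (A : Finset U) (u : U) : Finset (Finset U) :=
  H.filter (fun f => f ⊆ A ∧ u ∈ f)

/-- The number of members of `F` that meet `X`. -/
def hits (F : Finset (Finset U)) (X : Finset U) : ℝ :=
  #(F.filter (fun f => ¬ Disjoint f X))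

lemma card_aliveAt_sdiff (H : Finset (Finset U)) (A X : Finset U) (u : U) :
    (#(aliveAt H (A \ X) u) : ℝ) = #(aliveAt H A u) - hits (aliveAt H A u) X := by
  have h : #(aliveAt H (A \ X) u) + #((aliveAt H A u).filter (fun f => ¬ Disjoint f X))
      = #(aliveAt H A u) := by
    rw [← Finset.card_filter_add_card_filter_not (s := aliveAt H A u) (fun f => Disjoint f X)]
    congr 2
    ext f
    simp only [aliveAt, mem_filter, Finset.subset_sdiff]
    tauto
  unfold hits
  rw [← h]; push_cast; ring

lemma hits_nonneg (F : Finset (Finset U)) (X : Finset U) : 0 ≤ hits F X := by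
  unfold hits; positivity

lemma hits_le (H : Finset (Finset U)) (A X : Finset U) (u : U) (hu : u ∉ X) (κ : ℕ)
    (hκ : ∀ a b, a ≠ b → #(H.filter (fun f => a ∈ f ∧ b ∈ f)) ≤ κ) (hX : #X ≤ 3) :
    hits (aliveAt H A u) X ≤ 3 * κ := by
  have h : #((aliveAt H A u).filter (fun f => ¬ Disjoint f X)) ≤ 3 * κ := by
    calc _ ≤ #(X.biUnion (fun v => H.filter (fun f => u ∈ f ∧ v ∈ f))) := by
          apply Finset.card_le_card
          intro f hf
          simp only [aliveAt, mem_filter, Finset.not_disjoint_iff] at hf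
          obtain ⟨⟨h1, h2, h3⟩, v, hv, hvX⟩ := hf
          simp only [mem_biUnion, mem_filter]
          exact ⟨v, hvX, h1, h3, hv⟩
      _ ≤ #X * κ := Finset.card_biUnion_le_card_mul _ _ _ (fun v hv =>
          hκ u v (by rintro rfl; exact hu hv))
      _ ≤ 3 * κ := Nat.mul_le_mul_right _ hX
  unfold hits
  exact_mod_cast h

/-- A three element set meeting `X`: comparison of the indicator with the incidence count. -/
lemma hit_bounds (f X : Finset U) (u : U) (huf : u ∈ f) :
    (if u ∉ X ∧ ¬ Disjoint f X then 1 else 0 : ℕ) ≤ #((f.erase u).filter (· ∈ X)) ∧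
    #((f.erase u).filter (· ∈ X)) ≤ (if u ∉ X ∧ ¬ Disjoint f X then 1 else 0 : ℕ)
      + #(f.offDiag.filter (fun q => q.1 ∈ X ∧ q.2 ∈ X)) := by
  constructor
  · split_ifs with h
    · obtain ⟨v, hv, hvX⟩ := Finset.not_disjoint_iff.1 h.2
      apply Finset.card_pos.2
      exact ⟨v, by simp only [mem_filter, mem_erase]; exact ⟨⟨by rintro rfl; exact h.1 hvX, hv⟩, hvX⟩⟩
    · exact Nat.zero_le _
  · set s := (f.erase u).filter (· ∈ X) with hs
    by_cases hu : u ∈ X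
    · rw [if_neg (by tauto), zero_add]
      apply Finset.card_le_card_of_injOn (fun v => (u, v))
      · intro v hv
        simp only [hs, coe_filter, mem_erase, Set.mem_ofPred_eq, mem_offDiag] at hv ⊢
        exact ⟨⟨huf, hv.1.2, fun h => hv.1.1 h.symm⟩, hu, hv.2⟩
      · intro a _ b _ h; simpa using h
    · rcases s.eq_empty_or_nonempty with h0 | ⟨w, hw⟩
      · simp [h0]
      · have hw' := hw
        simp only [hs, mem_filter, mem_erase] at hw'
        rw [if_pos ⟨hu, Finset.not_disjoint_iff.2 ⟨w, hw'.1.2, hw'.2⟩⟩]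
        have : #(s.erase w) ≤ #(f.offDiag.filter (fun q => q.1 ∈ X ∧ q.2 ∈ X)) := by
          apply Finset.card_le_card_of_injOn (fun v => (w, v))
          · intro v hv
            simp only [hs, coe_erase, coe_filter, mem_erase, Set.mem_sdiff, Set.mem_ofPred_eq,
              Set.mem_singleton_iff, mem_offDiag] at hv ⊢
            exact ⟨⟨hw'.1.2, hv.1.1.2, fun h => hv.2 h.symm⟩, hw'.2, hv.1.2⟩
          · intro a _ b _ h; simpa using h
        have h2 := Finset.card_erase_add_one hw
        omega

variable [Fintype U]

/-- Expected number of edges of `F` hit, where hits to `u` do not count. -/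
noncomputable def hitMean (p : Finset U → ℝ) (F : Finset (Finset U)) (u : U) : ℝ :=
  ∑ X, p X * (if u ∉ X then hits F X else 0)

/-- The first-order approximation of `hitMean`. -/
noncomputable def hitMain (P : U → ℝ) (F : Finset (Finset U)) (u : U) : ℝ :=
  ∑ f ∈ F, ∑ v ∈ f.erase u, P v

lemma hitMean_bounds (p : Finset U → ℝ) (hp : ∀ X, 0 ≤ p X) (P : U → ℝ) (A : Finset U)
    (hP : ∀ v ∈ A, ∑ X, p X * (if v ∈ X then 1 else 0) = P v) (c : ℝ)
    (hpair : ∀ a b, a ≠ b → ∑ X, p X * (if a ∈ X ∧ b ∈ X then 1 else 0) ≤ c)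
    (F : Finset (Finset U)) (u : U) (hF : ∀ f ∈ F, #f = 3 ∧ u ∈ f ∧ f ⊆ A) :
    hitMean p F u ≤ hitMain P F u ∧ hitMain P F u - hitMean p F u ≤ 6 * c * #F := by
  have e1 : hitMean p F u = ∑ f ∈ F, ∑ X, p X *
      ((if u ∉ X ∧ ¬ Disjoint f X then 1 else 0 : ℕ) : ℝ) := by
    unfold hitMean
    rw [Finset.sum_comm]
    refine Finset.sum_congr rfl fun X _ => ?_
    rw [← Finset.mul_sum]
    congr 1
    unfold hits
    rw [Finset.card_filter]
    by_cases hu : u ∈ X <;> simp [hu]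
  have e2 : hitMain P F u = ∑ f ∈ F, ∑ X, p X * ((#((f.erase u).filter (· ∈ X)) : ℕ) : ℝ) := by
    unfold hitMain
    refine Finset.sum_congr rfl fun f hf => ?_
    rw [Finset.sum_congr rfl (fun v hv => (hP v ((hF f hf).2.2 (Finset.mem_of_mem_erase hv))).symm),
      Finset.sum_comm]
    refine Finset.sum_congr rfl fun X _ => ?_
    rw [← Finset.mul_sum]
    congr 1
    rw [Finset.card_filter]; push_cast; rfl
  constructor
  · rw [e1, e2]
    refine Finset.sum_le_sum fun f hf => Finset.sum_le_sum fun X _ => ?_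
    exact mul_le_mul_of_nonneg_left (by exact_mod_cast (hit_bounds f X u (hF f hf).2.1).1)
      (hp X)
  · rw [e1, e2, ← Finset.sum_sub_distrib]
    have : ∀ f ∈ F, (∑ X, p X * ((#((f.erase u).filter (· ∈ X)) : ℕ) : ℝ)) - ∑ X, p X *
      ((if u ∉ X ∧ ¬ Disjoint f X then 1 else 0 : ℕ) : ℝ) ≤ 6 * c := by
      intro f hf
      obtain ⟨h3, hu, hA⟩ := hF f hf
      rw [← Finset.sum_sub_distrib]
      calc _ ≤ ∑ X, p X * ((#(f.offDiag.filter (fun q => q.1 ∈ X ∧ q.2 ∈ X)) : ℕ) : ℝ) := by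
            refine Finset.sum_le_sum fun X _ => ?_
            rw [← mul_sub]
            refine mul_le_mul_of_nonneg_left ?_ (hp X)
            rw [sub_le_iff_le_add']
            exact_mod_cast (hit_bounds f X u hu).2
        _ = ∑ q ∈ f.offDiag, ∑ X, p X * (if q.1 ∈ X ∧ q.2 ∈ X then 1 else 0) := by
            rw [Finset.sum_comm]
            refine Finset.sum_congr rfl fun X _ => ?_
            rw [← Finset.mul_sum, Finset.card_filter]; push_cast; rfl
        _ ≤ ∑ q ∈ f.offDiag, c := Finset.sum_le_sum fun q hq => hpair _ _ (mem_offDiag.1 hq).2.2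
        _ = 6 * c := by
            rw [Finset.sum_const, Finset.offDiag_card, h3]; norm_num
    calc _ ≤ ∑ f ∈ F, 6 * c := Finset.sum_le_sum this
      _ = _ := by rw [Finset.sum_const, nsmul_eq_mul]; ring

/-- Some outcome of positive weight does at least as well as the average. -/
lemma exists_le_of_average {O : Type*} [Fintype O] (p val : O → ℝ) (hp : ∀ o, 0 ≤ p o)
    (hp1 : ∑ o, p o ≤ 1) (v0 B : ℝ) (h : v0 + ∑ o, p o * (val o - v0) ≤ B) :
    v0 ≤ B ∨ ∃ o, 0 < p o ∧ val o ≤ B := by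
  by_contra! hcon
  obtain ⟨h0, h1⟩ := hcon
  have h2 : ∑ o, p o * (B - v0) ≤ ∑ o, p o * (val o - v0) := by
    refine Finset.sum_le_sum fun o _ => ?_
    rcases (hp o).eq_or_lt with h | h
    · simp [← h]
    · exact mul_le_mul_of_nonneg_left (by linarith [h1 o h]) (hp o)
  rw [← Finset.sum_mul] at h2
  rcases hp1.eq_or_lt with h3 | h3
  · have : ∃ o ∈ univ, 0 < p o := by
      by_contra! hc
      have := Finset.sum_nonpos hc
      linarith
    obtain ⟨o, ho, hpo⟩ := this
    have h4 : ∑ o, p o * (B - v0) < ∑ o, p o * (val o - v0) := by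
      refine Finset.sum_lt_sum (fun o _ => ?_) ⟨o, ho, by
        exact mul_lt_mul_of_pos_left (by linarith [h1 o hpo]) hpo⟩
      rcases (hp o).eq_or_lt with h | h
      · simp [← h]
      · exact mul_le_mul_of_nonneg_left (by linarith [h1 o h]) (hp o)
    rw [← Finset.sum_mul, h3] at h4
    linarith
  · nlinarith

end

section

variable {U : Type*} [DecidableEq U]

/-- The degree of `u` in the hypergraph `H`. -/
def hdeg (H : Finset (Finset U)) (u : U) : ℝ := #(H.filter (fun f => u ∈ f))

lemma aliveAt_le_hdeg (H : Finset (Finset U)) (A : Finset U) (u : U) :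
    (#(aliveAt H A u) : ℝ) ≤ hdeg H u := by
  unfold hdeg aliveAt
  exact_mod_cast Finset.card_le_card (Finset.monotone_filter_right H
    (p := fun f => f ⊆ A ∧ u ∈ f) (q := fun f => u ∈ f) (fun _ _ h => h.2))

/-- Weight of the outcome `X` of one nibble step. -/
noncomputable def stepWeight (H : Finset (Finset U)) (A : Finset U) (D y W : ℝ) (X : Finset U) : ℝ :=
  (if X ∈ H ∧ X ⊆ A then 1 / W else 0) +
    ∑ u ∈ A, if X = {u} then (D - hdeg H u) * y ^ 2 / W else 0

section
variable (H : Finset (Finset U)) (A : Finset U) (D y W : ℝ)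

lemma stepWeight_nonneg (hD : ∀ u, hdeg H u ≤ D) (hW : 0 < W) (X : Finset U) :
    0 ≤ stepWeight H A D y W X := by
  unfold stepWeight
  refine add_nonneg (by split_ifs <;> positivity) (Finset.sum_nonneg fun u _ => ?_)
  have := hD u
  split_ifs
  · exact div_nonneg (mul_nonneg (by linarith) (by positivity)) hW.le
  · exact le_rfl

lemma stepWeight_pos (X : Finset U) (hX : 0 < stepWeight H A D y W X) :
    (X ∈ H ∧ X ⊆ A) ∨ ∃ u ∈ A, X = {u} ∧ hdeg H u ≠ D := by
  by_contra! hcon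
  obtain ⟨h1, h2⟩ := hcon
  unfold stepWeight at hX
  rw [if_neg (by tauto), zero_add, Finset.sum_eq_zero] at hX
  · exact lt_irrefl _ hX
  · intro u hu
    split_ifs with h
    · rw [h2 u hu h]; simp
    · rfl

/-- The squared degree error. -/
noncomputable def degErr (z : ℝ) : ℝ :=
  ∑ u ∈ A, (#(aliveAt H A u) - hdeg H u * z ^ 2) ^ 2

lemma degErr_sdiff (z : ℝ) (X : Finset U) :
    degErr H (A \ X) z = ∑ u ∈ A, if u ∈ X then 0 else
      ((#(aliveAt H A u) - hdeg H u * z ^ 2) - hits (aliveAt H A u) X) ^ 2 := by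
  unfold degErr
  rw [← Finset.filter_notMem_eq_sdiff, Finset.sum_filter]
  refine Finset.sum_congr rfl fun u _ => ?_
  by_cases hu : u ∈ X
  · simp [hu]
  · rw [Finset.filter_notMem_eq_sdiff, card_aliveAt_sdiff]
    simp only [hu, not_false_eq_true, if_true, if_false]
    ring

variable [Fintype U]

lemma sum_stepWeight_mul (g : Finset U → ℝ) :
    ∑ X, stepWeight H A D y W X * g X = (∑ f ∈ H.filter (· ⊆ A), g f) / W +
      ∑ u ∈ A, (D - hdeg H u) * y ^ 2 / W * g {u} := by
  unfold stepWeight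
  simp only [add_mul, Finset.sum_add_distrib]
  congr 1
  · rw [Finset.sum_div, Finset.sum_filter]
    rw [← Finset.sum_subset (Finset.subset_univ H)]
    · refine Finset.sum_congr rfl fun f hf => ?_
      by_cases h : f ⊆ A <;> simp [hf, h]; ring
    · intro X _ hX; simp [hX]
  · simp only [Finset.sum_mul]
    rw [Finset.sum_comm]
    refine Finset.sum_congr rfl fun u _ => ?_
    simp

lemma stepWeight_point (v : U) (hv : v ∈ A) :
    ∑ X, stepWeight H A D y W X * (if v ∈ X then 1 else 0) =
      (#(aliveAt H A v) + (D - hdeg H v) * y ^ 2) / W := by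
  rw [sum_stepWeight_mul, add_div]
  congr 1
  · rw [Finset.sum_boole, Finset.filter_filter]; rfl
  · simp [hv]

lemma stepWeight_pair (hW : 0 < W) (κ : ℕ)
    (hκ : ∀ a b, a ≠ b → #(H.filter (fun f => a ∈ f ∧ b ∈ f)) ≤ κ) (a b : U) (hab : a ≠ b) :
    ∑ X, stepWeight H A D y W X * (if a ∈ X ∧ b ∈ X then 1 else 0) ≤ κ / W := by
  rw [sum_stepWeight_mul, Finset.sum_eq_zero (s := A), add_zero]
  · rw [Finset.sum_boole]
    gcongr
    refine le_trans (Finset.card_le_card ?_) (hκ a b hab)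
    exact Finset.filter_subset_filter _ (Finset.filter_subset _ _)
  · intro u _
    rw [if_neg]; · simp
    rintro ⟨h1, h2⟩
    simp only [mem_singleton] at h1 h2
    exact hab (h1.trans h2.symm)

lemma sum_hdeg (h3 : ∀ f ∈ H, #f = 3) : ∑ u, hdeg H u = 3 * #H := by
  unfold hdeg
  simp only [Finset.card_filter]
  push_cast
  rw [Finset.sum_comm]
  rw [Finset.sum_congr rfl (g := fun _ => (3 : ℝ))]
  · simp [mul_comm]
  · intro f hf
    rw [Finset.sum_boole]
    simp [h3 f hf]

/-- Expected new error of a single vertex. -/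
lemma expected_vertex_error (p : Finset U → ℝ) (hp : ∀ X, 0 ≤ p X) (hp3 : ∀ X, 0 < p X → #X ≤ 3)
    (F : Finset (Finset U)) (u : U) (κ η : ℝ)
    (hh : ∀ X, #X ≤ 3 → u ∉ X → hits F X ≤ 3 * κ) :
    η ^ 2 + ∑ X, p X * ((if u ∈ X then 0 else (η - hits F X) ^ 2) - η ^ 2) ≤
      η ^ 2 - 2 * η * hitMean p F u + 3 * κ * hitMean p F u := by
  have : ∑ X, p X * ((if u ∈ X then 0 else (η - hits F X) ^ 2) - η ^ 2) ≤
      (3 * κ - 2 * η) * hitMean p F u := by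
    unfold hitMean
    rw [Finset.mul_sum]
    refine Finset.sum_le_sum fun X _ => ?_
    by_cases hu : u ∈ X
    · simp only [hu, if_true, not_true, if_false]
      nlinarith [hp X, mul_nonneg (hp X) (sq_nonneg η)]
    · simp only [hu, if_false, not_false_eq_true, if_true]
      rcases (hp X).eq_or_lt with h0 | h0
      · simp [← h0]
      have h1 := hh X (hp3 X h0) hu
      have h2 := hits_nonneg F X
      have : (η - hits F X) ^ 2 - η ^ 2 ≤ (3 * κ - 2 * η) * hits F X := by nlinarith
      calc _ ≤ p X * ((3 * κ - 2 * η) * hits F X) := mul_le_mul_of_nonneg_left this h0.le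
        _ = _ := by ring
  nlinarith

/-- Pure arithmetic of one vertex in one nibble step. -/
lemma vertex_error_arith (ξ d D y T κ W R M s : ℝ) (hκ : 1 ≤ κ) (hd : 0 ≤ d) (hdD : d ≤ D)
    (hy : 0 < y) (hy1 : y ≤ 1) (hT : 0 < T) (hyT : 1 / T ≤ y) (hW : 0 < W) (hR : 0 ≤ R)
    (hTW : 1 / T ^ 2 ≤ 1 / W)
    (hξ : |ξ| ≤ d) (hM : M = 2 * (ξ + d * y ^ 2) / (T * y) + s / W)
    (hRM : R ≤ M) (hMR : M - R ≤ 6 * (κ / W) * d) (hM2 : M ≤ 2 * d * (D / W)) :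
    let η := ξ + d * (y ^ 2 - (y - 1 / T) ^ 2)
    η ^ 2 - 2 * η * R + 3 * κ * R ≤ ξ ^ 2 - 2 * (ξ * s) / W + 24 * κ * D * d / W := by
  intro η
  have hD : 0 ≤ D := hd.trans hdD
  set b := d * (y ^ 2 - (y - 1 / T) ^ 2) with hb
  have hTi : 0 < 1 / T := by positivity
  have hb0 : 0 ≤ b := by
    apply mul_nonneg hd; nlinarith
  have hb1 : b ≤ 2 * d * (1 / T) := by
    rw [hb]; nlinarith [mul_nonneg hd hTi.le, mul_nonneg (mul_nonneg hd hTi.le) (sub_nonneg.2 hy1), mul_nonneg hd (sq_nonneg (1 / T))]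
  have hb2 : b ^ 2 ≤ 4 * D * d * (1 / W) := by
    have h1 : b ^ 2 ≤ (2 * d * (1 / T)) ^ 2 := by gcongr
    have h2 : (2 * d * (1 / T)) ^ 2 = 4 * d * d * (1 / T ^ 2) := by ring
    have h3 : 4 * d * d * (1 / T ^ 2) ≤ 4 * D * d * (1 / W) := by gcongr
    linarith
  have hbM : b - M = - (2 * ξ * (1 / (T * y))) - d * (1 / T ^ 2) - s / W := by
    rw [hM, hb]; field_simp; ring
  have hA : 2 * ξ * (b - M) ≤ 2 * D * d * (1 / W) - 2 * (ξ * s) / W := by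
    rw [hbM]
    have h1 : 0 ≤ ξ ^ 2 * (1 / (T * y)) := by positivity
    have h2 : -ξ * (d * (1 / T ^ 2)) ≤ D * d * (1 / W) := by
      calc -ξ * (d * (1 / T ^ 2)) ≤ D * (d * (1 / T ^ 2)) := by
            apply mul_le_mul_of_nonneg_right _ (by positivity)
            linarith [neg_abs_le ξ]
        _ ≤ D * (d * (1 / W)) := by gcongr
        _ = _ := by ring
    have h3 : 2 * (ξ * s) / W = 2 * ξ * (s / W) := by ring
    rw [h3]
    nlinarith
  have hB : 2 * ξ * (M - R) ≤ 12 * κ * D * d * (1 / W) := by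
    have h0 : 0 ≤ M - R := by linarith
    calc 2 * ξ * (M - R) ≤ 2 * D * (M - R) := by
          apply mul_le_mul_of_nonneg_right _ h0
          linarith [le_abs_self ξ]
      _ ≤ 2 * D * (6 * (κ / W) * d) := by gcongr
      _ = _ := by ring
  have hC : 3 * κ * R ≤ 6 * κ * D * d * (1 / W) := by
    calc 3 * κ * R ≤ 3 * κ * (2 * d * (D / W)) := by gcongr; linarith
      _ = _ := by ring
  have hE : 6 * D * d * (1 / W) ≤ 6 * κ * D * d * (1 / W) := by
    have : 0 ≤ 6 * D * d * (1 / W) := by positivity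
    nlinarith
  have : η ^ 2 - 2 * η * R + 3 * κ * R = ξ ^ 2 + (2 * ξ * (b - M) + 2 * ξ * (M - R)) + b ^ 2
      - 2 * (b * R) + 3 * κ * R := by simp only [η]; ring
  rw [this]
  have := mul_nonneg hb0 hR
  have h9 : 24 * κ * D * d / W = 24 * κ * D * d * (1 / W) := by ring
  rw [h9]
  linarith

end

end

section

variable {U : Type*} [DecidableEq U]

lemma sum_aliveAt_symm (H : Finset (Finset U)) (A : Finset U) (g : U → U → ℝ) :
    ∑ u ∈ A, ∑ f ∈ aliveAt H A u, ∑ v ∈ f.erase u, g u v =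
      ∑ u ∈ A, ∑ f ∈ aliveAt H A u, ∑ v ∈ f.erase u, g v u := by
  have h : ∀ g : U → U → ℝ, ∑ u ∈ A, ∑ f ∈ aliveAt H A u, ∑ v ∈ f.erase u, g u v =
      ∑ f ∈ H.filter (· ⊆ A), ∑ u ∈ f, ∑ v ∈ f.erase u, g u v := by
    intro g
    apply Finset.sum_comm'
    intro u f
    simp only [aliveAt, mem_filter]
    constructor
    · rintro ⟨h1, h2, h3, h4⟩; exact ⟨h4, h2, h3⟩
    · rintro ⟨h1, h2, h3⟩; exact ⟨h3 h1, h2, h3, h1⟩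
  rw [h, h]
  refine Finset.sum_congr rfl fun f _ => ?_
  apply Finset.sum_comm'
  intro u v
  simp only [mem_erase]
  tauto

lemma cross_term_bound (H : Finset (Finset U)) (h3 : ∀ f ∈ H, #f = 3) (A : Finset U) (D : ℝ)
    (hD : ∀ u, hdeg H u ≤ D) (ξ : U → ℝ) :
    - ∑ u ∈ A, ξ u * ∑ f ∈ aliveAt H A u, ∑ v ∈ f.erase u, ξ v ≤ 2 * D * ∑ u ∈ A, ξ u ^ 2 := by
  have h1 : ∑ u ∈ A, ∑ f ∈ aliveAt H A u, ∑ v ∈ f.erase u, ξ u ^ 2 ≤ 2 * D * ∑ u ∈ A, ξ u ^ 2 := by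
    rw [Finset.mul_sum]
    refine Finset.sum_le_sum fun u _ => ?_
    have : ∀ f ∈ aliveAt H A u, ∑ v ∈ f.erase u, ξ u ^ 2 = 2 * ξ u ^ 2 := by
      intro f hf
      simp only [aliveAt, mem_filter] at hf
      rw [Finset.sum_const, Finset.card_erase_of_mem hf.2.2, h3 f hf.1]; norm_num
    rw [Finset.sum_congr rfl this, Finset.sum_const, nsmul_eq_mul]
    have := (aliveAt_le_hdeg H A u).trans (hD u)
    nlinarith [sq_nonneg (ξ u)]
  have h2 := sum_aliveAt_symm H A (fun u _ => ξ u ^ 2)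
  rw [← Finset.sum_neg_distrib]
  calc _ ≤ ∑ u ∈ A, ∑ f ∈ aliveAt H A u, ∑ v ∈ f.erase u, (ξ u ^ 2 / 2 + ξ v ^ 2 / 2) := by
        refine Finset.sum_le_sum fun u _ => ?_
        rw [Finset.mul_sum, ← Finset.sum_neg_distrib]
        refine Finset.sum_le_sum fun f _ => ?_
        rw [Finset.mul_sum, ← Finset.sum_neg_distrib]
        refine Finset.sum_le_sum fun v _ => ?_
        nlinarith [sq_nonneg (ξ u + ξ v)]
    _ = (∑ u ∈ A, ∑ f ∈ aliveAt H A u, ∑ v ∈ f.erase u, ξ u ^ 2) / 2 +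
        (∑ u ∈ A, ∑ f ∈ aliveAt H A u, ∑ v ∈ f.erase u, ξ v ^ 2) / 2 := by
        simp only [Finset.sum_add_distrib, Finset.sum_div]
    _ ≤ _ := by rw [← h2]; linarith

variable [Fintype U]

lemma expected_degErr (H : Finset (Finset U)) (h3 : ∀ f ∈ H, #f = 3) (A : Finset U) (D y T : ℝ)
    (κ : ℕ) (hκ1 : 1 ≤ κ) (hκ : ∀ a b, a ≠ b → #(H.filter (fun f => a ∈ f ∧ b ∈ f)) ≤ κ)
    (hD0 : 0 < D) (hD : ∀ u, hdeg H u ≤ D) (hy : 0 < y) (hy1 : y ≤ 1) (hT : 0 < T)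
    (hyT : 1 / T ≤ y) (hTD : D ≤ T) :
    let W := D * y ^ 3 * T
    degErr H A (y - 1 / T) + ∑ X, stepWeight H A D y W X *
      (degErr H (A \ X) (y - 1 / T) - degErr H A (y - 1 / T)) ≤
      degErr H A y * (1 + 4 * D / W) + 72 * κ * D * #H / W := by
  intro W
  have hW : 0 < W := by positivity
  set p := stepWeight H A D y W with hp
  have hp0 : ∀ X, 0 ≤ p X := stepWeight_nonneg H A D y W hD hW
  set z := y - 1 / T with hz
  set ξ : U → ℝ := fun u => #(aliveAt H A u) - hdeg H u * y ^ 2 with hξ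
  set η : U → ℝ := fun u => #(aliveAt H A u) - hdeg H u * z ^ 2 with hη
  set F := fun u => aliveAt H A u with hF
  have hp3 : ∀ X, 0 < p X → #X ≤ 3 := by
    intro X hX
    rcases stepWeight_pos H A D y W X hX with h | ⟨u, _, rfl, _⟩
    · exact (h3 X h.1).le
    · simp
  set P : U → ℝ := fun v => (#(aliveAt H A v) + (D - hdeg H v) * y ^ 2) / W with hP
  have hd0 : ∀ u, 0 ≤ hdeg H u := fun u => by unfold hdeg; positivity
  have e1 : degErr H A z + ∑ X, p X * (degErr H (A \ X) z - degErr H A z) =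
      ∑ u ∈ A, (η u ^ 2 + ∑ X, p X * ((if u ∈ X then 0 else (η u - hits (F u) X) ^ 2) - η u ^ 2)) := by
    rw [Finset.sum_add_distrib]
    congr 1
    rw [Finset.sum_comm]
    refine Finset.sum_congr rfl fun X _ => ?_
    rw [← Finset.mul_sum, Finset.sum_sub_distrib, degErr_sdiff]
    rfl
  rw [e1]
  have e2 : ∀ u ∈ A, (η u ^ 2 + ∑ X, p X * ((if u ∈ X then 0 else (η u - hits (F u) X) ^ 2) - η u ^ 2))
      ≤ ξ u ^ 2 - 2 * (ξ u * ∑ f ∈ F u, ∑ v ∈ f.erase u, ξ v) / W + 24 * κ * D * hdeg H u / W := by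
    intro u hu
    refine (expected_vertex_error p hp0 hp3 (F u) u κ (η u) ?_).trans ?_
    · intro X hX hu; exact hits_le H A X u hu κ hκ hX
    have hFu : ∀ f ∈ F u, #f = 3 ∧ u ∈ f ∧ f ⊆ A := by
      intro f hf
      simp only [hF, aliveAt, mem_filter] at hf
      exact ⟨h3 f hf.1, hf.2.2, hf.2.1⟩
    have hb := hitMean_bounds p hp0 P A (fun v hv => stepWeight_point H A D y W v hv) (κ / W)
      (stepWeight_pair H A D y W hW κ hκ) (F u) u hFu
    have hR : 0 ≤ hitMean p (F u) u := by
      unfold hitMean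
      refine Finset.sum_nonneg fun X _ => mul_nonneg (hp0 X) ?_
      by_cases h : u ∈ X
      · simp [h]
      · simp [h, hits_nonneg]
    have hdu := aliveAt_le_hdeg H A u
    have hPv : ∀ v, P v = D * y ^ 2 / W + ξ v / W := by
      intro v; simp only [hP, hξ]; ring
    have hcard : ∀ f ∈ F u, #(f.erase u) = 2 := by
      intro f hf
      rw [Finset.card_erase_of_mem (hFu f hf).2.1, (hFu f hf).1]
    have hM : hitMain P (F u) u = 2 * (ξ u + hdeg H u * y ^ 2) / (T * y) +
        (∑ f ∈ F u, ∑ v ∈ f.erase u, ξ v) / W := by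
      unfold hitMain
      simp only [hPv, Finset.sum_add_distrib, ← Finset.sum_div]
      congr 1
      rw [Finset.sum_congr rfl (g := fun f => 2 * (D * y ^ 2))]
      · simp only [Finset.sum_const, nsmul_eq_mul, hξ, W, hF]
        field_simp
        ring
      · intro f hf
        rw [Finset.sum_const, hcard f hf]; simp
    have hM2 : hitMain P (F u) u ≤ 2 * hdeg H u * (D / W) := by
      unfold hitMain
      calc _ ≤ ∑ f ∈ F u, ∑ v ∈ f.erase u, D / W := by
            refine Finset.sum_le_sum fun f _ => Finset.sum_le_sum fun v _ => ?_
            simp only [hP]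
            gcongr
            have h1 := aliveAt_le_hdeg H A v
            have h2 : (D - hdeg H v) * y ^ 2 ≤ (D - hdeg H v) * 1 :=
              mul_le_mul_of_nonneg_left (pow_le_one₀ hy.le hy1) (by linarith [hD v])
            linarith
        _ = #(F u) * (2 * (D / W)) := by
            rw [Finset.sum_congr rfl (g := fun f => 2 * (D / W))]
            · simp
            · intro f hf
              rw [Finset.sum_const, hcard f hf]; simp
        _ ≤ hdeg H u * (2 * (D / W)) := by gcongr
        _ = _ := by ring
    have hξd : |ξ u| ≤ hdeg H u := by
      have : 0 ≤ hdeg H u * y ^ 2 := mul_nonneg (hd0 u) (by positivity)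
      have : hdeg H u * y ^ 2 ≤ hdeg H u * 1 :=
        mul_le_mul_of_nonneg_left (pow_le_one₀ hy.le hy1) (hd0 u)
      have : (0 : ℝ) ≤ #(aliveAt H A u) := by positivity
      rw [abs_le]; simp only [hξ]; constructor <;> linarith
    have key := vertex_error_arith (ξ u) (hdeg H u) D y T κ W (hitMean p (F u) u)
      (hitMain P (F u) u) (∑ f ∈ F u, ∑ v ∈ f.erase u, ξ v) (by exact_mod_cast hκ1) (hd0 u) (hD u)
      hy hy1 hT hyT hW hR ?_ hξd hM hb.1 (hb.2.trans ?_) hM2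
    · have : η u = ξ u + hdeg H u * (y ^ 2 - (y - 1 / T) ^ 2) := by
        simp only [hξ, hη, hz]; ring
      rw [this]
      exact key
    · apply one_div_le_one_div_of_le hW
      have : y ^ 3 ≤ 1 := pow_le_one₀ hy.le hy1
      calc D * y ^ 3 * T ≤ D * 1 * T := by gcongr
        _ ≤ T ^ 2 := by nlinarith
    · gcongr
  refine (Finset.sum_le_sum e2).trans ?_
  rw [Finset.sum_add_distrib, Finset.sum_sub_distrib, ← Finset.sum_div, ← Finset.sum_div,
    ← Finset.mul_sum, ← Finset.mul_sum]
  have hc := cross_term_bound H h3 A D hD ξ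
  have hs : ∑ u ∈ A, hdeg H u ≤ 3 * #H := by
    rw [← sum_hdeg H h3]
    exact Finset.sum_le_sum_of_subset_of_nonneg (Finset.subset_univ _) (fun u _ _ => hd0 u)
  have e3 : degErr H A y = ∑ u ∈ A, ξ u ^ 2 := rfl
  rw [e3]
  have i1 : -(2 * (∑ u ∈ A, ξ u * ∑ f ∈ F u, ∑ v ∈ f.erase u, ξ v) / W) ≤
      (∑ u ∈ A, ξ u ^ 2) * (4 * D / W) := by
    rw [← neg_div, div_le_iff₀ hW]
    field_simp
    linarith
  have i2 : 24 * κ * D * (∑ u ∈ A, hdeg H u) / W ≤ 72 * κ * D * #H / W := by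
    refine div_le_div_of_nonneg_right ?_ hW.le
    calc 24 * κ * D * (∑ u ∈ A, hdeg H u) ≤ 24 * κ * D * (3 * #H) := by gcongr
      _ = _ := by ring
  linarith

lemma sum_stepWeight (H : Finset (Finset U)) (A : Finset U) (D y W : ℝ) :
    ∑ X, stepWeight H A D y W X = #(H.filter (· ⊆ A)) / W +
      ∑ u ∈ A, (D - hdeg H u) * y ^ 2 / W := by
  have := sum_stepWeight_mul H A D y W (fun _ => 1)
  simpa using this

lemma expected_slots (H : Finset (Finset U)) (A S : Finset U) (D y W : ℝ) :
    ∑ X, stepWeight H A D y W X * ((#(S ∩ (A \ X)) : ℝ) - #(S ∩ A)) =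
      - ∑ s ∈ S ∩ A, (#(aliveAt H A s) + (D - hdeg H s) * y ^ 2) / W := by
  have : ∀ X : Finset U, (#(S ∩ (A \ X)) : ℝ) - #(S ∩ A) =
      - ∑ s ∈ S ∩ A, if s ∈ X then 1 else 0 := by
    intro X
    rw [Finset.sum_boole]
    have h := Finset.card_filter_add_card_filter_not (s := S ∩ A) (fun s => s ∈ X)
    have : (S ∩ A).filter (fun s => s ∉ X) = S ∩ (A \ X) := by
      ext s; simp only [mem_filter, mem_inter, mem_sdiff]; tauto
    rw [this] at h
    rw [← h]; push_cast; ring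
  simp only [this, mul_neg, Finset.sum_neg_distrib]
  congr 1
  simp only [Finset.mul_sum]
  rw [Finset.sum_comm]
  refine Finset.sum_congr rfl fun s hs => ?_
  exact stepWeight_point H A D y W s (Finset.mem_of_mem_inter_right hs)

end

section

variable {U : Type*} [DecidableEq U] [Fintype U]

lemma nibble_step (H : Finset (Finset U)) (h3 : ∀ f ∈ H, #f = 3) (A S : Finset U) (D y T : ℝ)
    (κ : ℕ) (hκ1 : 1 ≤ κ) (hκ : ∀ a b, a ≠ b → #(H.filter (fun f => a ∈ f ∧ b ∈ f)) ≤ κ)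
    (hD0 : 0 < D) (hD : ∀ u, hdeg H u ≤ D) (hS : ∀ s ∈ S, hdeg H s = D) (hHS : #H ≤ D * #S)
    (N : ℝ) (hN : 1 ≤ N) (hy1 : y ≤ 1) (hT : 0 < T) (hyT : 1 / N ≤ y - 1 / T) (hTD : D ≤ T)
    (hTU : N ^ 3 * (#S + Fintype.card U) ≤ T) (θ a a' : ℝ) (hθ : 0 < θ) (ha' : 0 ≤ a')
    (haa : a' * (1 + 4 * N ^ 4 / T) + N ^ 4 / (T * θ * D ^ 2) ≤ a) :
    ∃ X : Finset U, (X = ∅ ∨ (X ∈ H ∧ X ⊆ A) ∨ ∃ u ∈ A, X = {u} ∧ hdeg H u ≠ D) ∧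
      #(S ∩ (A \ X)) / (y - 1 / T) + a' * degErr H (A \ X) (y - 1 / T) ≤
        #(S ∩ A) / y + a * degErr H A y + N ^ 4 * θ * #S / T +
          a' * (72 * κ * D * #S * N ^ 4 / T) := by
  have hTi : 0 < 1 / T := by positivity
  have hNi : 0 < 1 / N := by positivity
  have hy : 0 < y := by linarith
  have hz : 0 < y - 1 / T := by linarith
  set z := y - 1 / T with hzdef
  have hzy : z ≤ y := by linarith
  have hzN : 1 ≤ N * z := by
    have := (div_le_iff₀ (by linarith : 0 < N)).1 hyT
    linarith
  have hyN : 1 ≤ N * y := hzN.trans (by gcongr)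
  have hyN3 : 1 ≤ N ^ 3 * y ^ 3 := by rw [← mul_pow]; exact one_le_pow₀ hyN
  set W := D * y ^ 3 * T with hW
  have hW0 : 0 < W := by positivity
  have hΦ : 0 ≤ degErr H A y := Finset.sum_nonneg fun u _ => sq_nonneg _
  have hd0 : ∀ u, 0 ≤ hdeg H u := fun u => by unfold hdeg; positivity
  have hDW : D * T ≤ N ^ 3 * W := by
    rw [hW]; nlinarith [mul_pos hD0 hT]
  have hDWz : D * T ≤ N ^ 4 * (W * z) := by
    have : 0 < D * T := by positivity
    calc D * T ≤ (N ^ 3 * W) * 1 := by linarith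
      _ ≤ (N ^ 3 * W) * (N * z) := by gcongr
      _ = _ := by ring
  have hps : ∑ X, stepWeight H A D y W X ≤ 1 := by
    rw [sum_stepWeight, ← Finset.sum_div, ← add_div, div_le_one hW0]
    have h1 : (#(H.filter (· ⊆ A)) : ℝ) ≤ D * #S :=
      le_trans (by exact_mod_cast Finset.card_le_card (Finset.filter_subset _ _)) hHS
    have h2 : ∑ u ∈ A, (D - hdeg H u) * y ^ 2 ≤ Fintype.card U * D := by
      calc _ ≤ ∑ u ∈ A, D := by
            refine Finset.sum_le_sum fun u _ => ?_
            have : (D - hdeg H u) * y ^ 2 ≤ (D - hdeg H u) * 1 :=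
              mul_le_mul_of_nonneg_left (pow_le_one₀ hy.le hy1) (by linarith [hD u])
            linarith [hd0 u]
        _ = #A * D := by simp
        _ ≤ _ := by gcongr; exact Finset.card_le_univ A
    have h3 : (N ^ 3 * y ^ 3) * (D * (#S + Fintype.card U)) ≤ W := by
      calc _ = D * y ^ 3 * (N ^ 3 * (#S + Fintype.card U)) := by ring
        _ ≤ _ := by rw [hW]; gcongr
    have h4 : D * (#S + Fintype.card U) ≤ (N ^ 3 * y ^ 3) * (D * (#S + Fintype.card U)) :=
      le_mul_of_one_le_left (by positivity) hyN3
    linarith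
  set B := #(S ∩ A) / y + a * degErr H A y + N ^ 4 * θ * #S / T +
          a' * (72 * κ * D * #S * N ^ 4 / T) with hB
  set val : Finset U → ℝ := fun X => #(S ∩ (A \ X)) / z + a' * degErr H (A \ X) z with hval
  have key : val ∅ + ∑ X, stepWeight H A D y W X * (val X - val ∅) ≤ B := by
    have e1 : val ∅ + ∑ X, stepWeight H A D y W X * (val X - val ∅) =
        (#(S ∩ A) + ∑ X, stepWeight H A D y W X * ((#(S ∩ (A \ X)) : ℝ) - #(S ∩ A))) / z +
        a' * (degErr H A z + ∑ X, stepWeight H A D y W X * (degErr H (A \ X) z - degErr H A z)) := by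
      simp only [hval, Finset.sdiff_empty]
      rw [mul_add, Finset.mul_sum, add_div, Finset.sum_div, add_add_add_comm,
        ← Finset.sum_add_distrib]
      congr 1
      refine Finset.sum_congr rfl fun X _ => ?_
      ring
    rw [e1]
    have h1 := expected_degErr H h3 A D y T κ hκ1 hκ hD0 hD hy hy1 hT (by linarith) hTD
    simp only [← hW, ← hzdef] at h1
    have h2 : degErr H A y * (1 + 4 * D / W) + 72 * κ * D * #H / W ≤
        degErr H A y * (1 + 4 * N ^ 4 / T) + 72 * κ * D * #S * N ^ 4 / T := by
      have hDW4 : D / W ≤ N ^ 4 / T := by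
        rw [div_le_div_iff₀ hW0 hT]
        calc D * T ≤ N ^ 3 * W := hDW
          _ ≤ N ^ 4 * W := by gcongr; norm_num
      have i1 : 4 * D / W ≤ 4 * N ^ 4 / T := by
        rw [mul_div_assoc, mul_div_assoc]; gcongr
      have i2 : 72 * κ * D * #H / W ≤ 72 * κ * D * #S * N ^ 4 / T := by
        calc 72 * κ * D * #H / W ≤ 72 * κ * D * (D * #S) / W := by gcongr
          _ = 72 * κ * D * #S * (D / W) := by ring
          _ ≤ 72 * κ * D * #S * (N ^ 4 / T) := by gcongr
          _ = _ := by ring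
      gcongr
    have h3 := h1.trans h2
    rw [expected_slots]
    set ξ : U → ℝ := fun u => #(aliveAt H A u) - hdeg H u * y ^ 2 with hξ
    have h4 : ∑ s ∈ S ∩ A, (#(aliveAt H A s) + (D - hdeg H s) * y ^ 2) / W =
        #(S ∩ A) / (y * T) + (∑ s ∈ S ∩ A, ξ s) / W := by
      rw [Finset.sum_div, Finset.sum_congr rfl (g := fun s => 1 / (y * T) + ξ s / W)]
      · rw [Finset.sum_add_distrib]; simp [div_eq_mul_inv]
      · intro s hs
        simp only [hξ, hS s (Finset.mem_of_mem_inter_left hs), hW]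
        field_simp
        ring
    rw [h4]
    have h5 : - ∑ s ∈ S ∩ A, ξ s ≤ θ * D * #S + degErr H A y / (θ * D) := by
      rw [← Finset.sum_neg_distrib]
      calc _ ≤ ∑ s ∈ S ∩ A, (θ * D + ξ s ^ 2 / (θ * D)) := by
            refine Finset.sum_le_sum fun s _ => ?_
            have hθD : 0 < θ * D := by positivity
            rw [← sub_nonneg]
            have : θ * D + ξ s ^ 2 / (θ * D) - -ξ s =
                ((θ * D + ξ s / 2) ^ 2 + 3 / 4 * ξ s ^ 2) / (θ * D) := by
              field_simp; ring
            rw [this]; positivity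
        _ = #(S ∩ A) * (θ * D) + (∑ s ∈ S ∩ A, ξ s ^ 2) / (θ * D) := by
            rw [Finset.sum_add_distrib, Finset.sum_div]; simp
        _ ≤ #S * (θ * D) + degErr H A y / (θ * D) := by
            have i1 : (#(S ∩ A) : ℝ) ≤ #S := by
              exact_mod_cast Finset.card_le_card Finset.inter_subset_left
            have i2 : ∑ s ∈ S ∩ A, ξ s ^ 2 ≤ degErr H A y :=
              Finset.sum_le_sum_of_subset_of_nonneg Finset.inter_subset_right
                (fun u _ _ => sq_nonneg _)
            gcongr
        _ = _ := by ring
    have h6 : ((#(S ∩ A) : ℝ) + -(#(S ∩ A) / (y * T) + (∑ s ∈ S ∩ A, ξ s) / W)) / z ≤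
        #(S ∩ A) / y + N ^ 4 * θ * #S / T + N ^ 4 / (T * θ * D ^ 2) * degErr H A y := by
      have i1 : ((#(S ∩ A) : ℝ) + -(#(S ∩ A) / (y * T) + (∑ s ∈ S ∩ A, ξ s) / W)) / z =
          #(S ∩ A) / y + (- ∑ s ∈ S ∩ A, ξ s) / (W * z) := by
        have : (#(S ∩ A) : ℝ) + -(#(S ∩ A) / (y * T) + (∑ s ∈ S ∩ A, ξ s) / W) =
          #(S ∩ A) / y * z + (- ∑ s ∈ S ∩ A, ξ s) / W := by
          rw [hzdef]; field_simp; ring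
        rw [this, add_div, mul_div_cancel_right₀ _ hz.ne', div_div]
      rw [i1]
      have i2 : (- ∑ s ∈ S ∩ A, ξ s) / (W * z) ≤
          (θ * D * #S + degErr H A y / (θ * D)) * (N ^ 4 / (D * T)) := by
        calc _ ≤ (θ * D * #S + degErr H A y / (θ * D)) / (W * z) := by gcongr
          _ = (θ * D * #S + degErr H A y / (θ * D)) * (1 / (W * z)) := by ring
          _ ≤ _ := by
              have : 1 / (W * z) ≤ N ^ 4 / (D * T) := by
                rw [div_le_div_iff₀ (by positivity) (by positivity)]; linarith
              gcongr
      have i3 : (θ * D * #S + degErr H A y / (θ * D)) * (N ^ 4 / (D * T)) =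
          N ^ 4 * θ * #S / T + N ^ 4 / (T * θ * D ^ 2) * degErr H A y := by
        field_simp
      linarith
    have h7 := mul_le_mul_of_nonneg_left h3 ha'
    have h8 := mul_le_mul_of_nonneg_right haa hΦ
    rw [hB]
    nlinarith
  rcases exists_le_of_average (stepWeight H A D y W) val (stepWeight_nonneg H A D y W hD hW0) hps
    (val ∅) B key with h | ⟨X, hX, h⟩
  · exact ⟨∅, Or.inl rfl, h⟩
  · exact ⟨X, Or.inr (stepWeight_pos H A D y W X hX), h⟩

lemma nibble_iterate (H : Finset (Finset U)) (h3 : ∀ f ∈ H, #f = 3) (S : Finset U) (D : ℝ)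
    (κ : ℕ) (hκ1 : 1 ≤ κ) (hκ : ∀ a b, a ≠ b → #(H.filter (fun f => a ∈ f ∧ b ∈ f)) ≤ κ)
    (hD0 : 0 < D) (hD : ∀ u, hdeg H u ≤ D) (hS : ∀ s ∈ S, hdeg H s = D) (hHS : #H ≤ D * #S)
    (N : ℝ) (hN : 1 ≤ N) (T : ℕ) (hT : 0 < T) (hTD : D ≤ T)
    (hTU : N ^ 3 * (#S + Fintype.card U) ≤ T) (θ : ℝ) (hθ : 0 < θ) (t : ℕ)
    (ht : (t : ℝ) / T ≤ 1 - 1 / N) :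
    ∃ A : Finset U, ∃ M : Finset (Finset U), M ⊆ H ∧ (∀ f ∈ M, Disjoint f A) ∧
      (∀ f ∈ M, ∀ g ∈ M, f ≠ g → Disjoint f g) ∧ (∀ s ∈ S, s ∈ A ∨ ∃ f ∈ M, s ∈ f) ∧
      #(S ∩ A) / (1 - (t : ℝ) / T) +
        (1 + 5 * N ^ 4 / T) ^ (T - t) / (θ * D ^ 2) * degErr H A (1 - (t : ℝ) / T) ≤
      #S + t / T * (N ^ 4 * θ * #S +
        Real.exp (5 * N ^ 4) / (θ * D ^ 2) * (72 * κ * D * #S * N ^ 4)) := by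
  have hT' : (0 : ℝ) < T := by exact_mod_cast hT
  induction t with
  | zero =>
    refine ⟨univ, ∅, by simp, by simp, by simp, by simp, ?_⟩
    have : degErr H univ (1 - ((0 : ℕ) : ℝ) / T) = 0 := by
      unfold degErr
      refine Finset.sum_eq_zero fun u _ => ?_
      simp [aliveAt, hdeg]
    rw [this]
    simp
  | succ t ih =>
    have htt : (t : ℝ) / T ≤ ((t + 1 : ℕ) : ℝ) / T := by gcongr; simp
    obtain ⟨A, M, hMH, hMA, hMM, hMS, hΩ⟩ := ih (htt.trans ht)
    have hy : 1 - ((t + 1 : ℕ) : ℝ) / T = (1 - (t : ℝ) / T) - 1 / T := by push_cast; ring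
    have hNi : 0 < 1 / N := by positivity
    have htT : t + 1 ≤ T := by
      have : ((t + 1 : ℕ) : ℝ) / T ≤ 1 := by linarith
      rw [div_le_one hT'] at this
      exact_mod_cast this
    set r := 1 + 5 * N ^ 4 / T with hr
    have hr1 : 1 ≤ r := by rw [hr]; linarith [show (0 : ℝ) ≤ 5 * N ^ 4 / T by positivity]
    have hrT : r ^ (T - (t + 1)) ≤ Real.exp (5 * N ^ 4) := by
      calc r ^ (T - (t + 1)) ≤ r ^ T := pow_le_pow_right₀ hr1 (by omega)
        _ ≤ (Real.exp (5 * N ^ 4 / T)) ^ T := by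
            gcongr; rw [hr, add_comm]; exact Real.add_one_le_exp _
        _ = Real.exp (5 * N ^ 4) := by
            rw [← Real.exp_nat_mul]; congr 1; field_simp
    have hrt : r ^ (T - t) = r ^ (T - (t + 1)) * r := by
      rw [← pow_succ]; congr 1; omega
    obtain ⟨X, hX, hX2⟩ := nibble_step H h3 A S D (1 - (t : ℝ) / T) T κ hκ1 hκ hD0 hD hS hHS N hN
      (by linarith [show (0 : ℝ) ≤ (t : ℝ) / T by positivity]) hT' (by rw [← hy]; linarith) hTD hTU θ
      (r ^ (T - t) / (θ * D ^ 2)) (r ^ (T - (t + 1)) / (θ * D ^ 2)) hθ (by positivity) (by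
        have h1 : 1 ≤ r ^ (T - (t + 1)) := one_le_pow₀ hr1
        have h2 : N ^ 4 / (T * θ * D ^ 2) = (1 * (N ^ 4 / T)) / (θ * D ^ 2) := by field_simp
        rw [hrt, h2, div_mul_eq_mul_div, ← add_div]
        refine div_le_div_of_nonneg_right ?_ (by positivity)
        have h3 : 1 * (N ^ 4 / T) ≤ r ^ (T - (t + 1)) * (N ^ 4 / T) := by gcongr
        calc _ ≤ r ^ (T - (t + 1)) * (1 + 4 * N ^ 4 / T) + r ^ (T - (t + 1)) * (N ^ 4 / T) := by
              linarith
          _ = _ := by rw [hr]; ring)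
    rw [← hy] at hX2
    refine ⟨A \ X, if X ∈ H ∧ X ⊆ A then insert X M else M, ?_, ?_, ?_, ?_, ?_⟩
    · split_ifs with h
      · exact Finset.insert_subset h.1 hMH
      · exact hMH
    · have : ∀ f ∈ M, Disjoint f (A \ X) := fun f hf =>
        (hMA f hf).mono_right Finset.sdiff_subset
      split_ifs with h
      · intro f hf
        rcases Finset.mem_insert.1 hf with rfl | hf
        · exact Finset.disjoint_sdiff
        · exact this f hf
      · exact this
    · split_ifs with h
      · intro f hf g hg hfg
        rcases Finset.mem_insert.1 hf with h1 | h1 <;> rcases Finset.mem_insert.1 hg with h2 | h2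
        · exact absurd (h1.trans h2.symm) hfg
        · rw [h1]; exact ((hMA g h2).mono_right h.2).symm
        · rw [h2]; exact (hMA f h1).mono_right h.2
        · exact hMM f h1 g h2 hfg
      · exact hMM
    · intro s hs
      rcases hMS s hs with h1 | ⟨f, hf, hsf⟩
      · by_cases hsX : s ∈ X
        · right
          rcases hX with h | h | ⟨u, hu, rfl, hne⟩
          · simp [h] at hsX
          · rw [if_pos h]
            exact ⟨X, Finset.mem_insert_self _ _, hsX⟩
          · rw [Finset.mem_singleton] at hsX
            subst hsX
            exact absurd (hS s hs) hne
        · left; simp [h1, hsX]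
      · right
        refine ⟨f, ?_, hsf⟩
        split_ifs
        · exact Finset.mem_insert_of_mem hf
        · exact hf
    · refine hX2.trans ?_
      have h1 : r ^ (T - (t + 1)) / (θ * D ^ 2) * (72 * κ * D * #S * N ^ 4 / T) ≤
          1 / T * (Real.exp (5 * N ^ 4) / (θ * D ^ 2) * (72 * κ * D * #S * N ^ 4)) := by
        calc _ ≤ Real.exp (5 * N ^ 4) / (θ * D ^ 2) * (72 * κ * D * #S * N ^ 4 / T) := by gcongr
          _ = _ := by ring
      have h2 : N ^ 4 * θ * #S / T = 1 / T * (N ^ 4 * θ * #S) := by ring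
      have h3 : ((t + 1 : ℕ) : ℝ) / T = t / T + 1 / T := by push_cast; ring
      rw [h3, h2]
      linarith

/-- The Rödl nibble for 3-uniform hypergraphs: a matching covering nearly all of a set `S` of
vertices of maximum degree. -/
lemma nibble (N : ℕ) (hN : 1 ≤ N) : ∃ δ : ℝ, 0 < δ ∧ ∀ (U : Type) [DecidableEq U] [Fintype U]
    (H : Finset (Finset U)) (S : Finset U) (D : ℝ) (κ : ℕ), (∀ f ∈ H, #f = 3) → 1 ≤ κ →
    (∀ a b, a ≠ b → #(H.filter (fun f => a ∈ f ∧ b ∈ f)) ≤ κ) → 0 < D → (∀ u, hdeg H u ≤ D) →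
    (∀ s ∈ S, hdeg H s = D) → #H ≤ D * #S → κ ≤ δ * D →
    ∃ M ⊆ H, (∀ f ∈ M, ∀ g ∈ M, f ≠ g → Disjoint f g) ∧
      (#(S.filter (fun s => ∀ f ∈ M, s ∉ f)) : ℝ) ≤ 2 / N * #S := by
  have hN' : (1 : ℝ) ≤ N := by exact_mod_cast hN
  set K := Real.exp (5 * (N : ℝ) ^ 4) with hK
  refine ⟨1 / (288 * K * N ^ 8), by positivity, ?_⟩
  intro U _ _ H S D κ h3 hκ1 hκ hD0 hD hS hHS hδ
  obtain ⟨T', hT'⟩ := exists_nat_ge (D + N ^ 3 * (#S + Fintype.card U) + 1)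
  have hp : (0 : ℝ) ≤ N ^ 3 * (#S + Fintype.card U) := by positivity
  have hT'0 : (0 : ℝ) < T' := by linarith
  have hTT : (T' : ℝ) ≤ ((N * T' : ℕ) : ℝ) := by
    push_cast; nlinarith
  have ht : (((N - 1) * T' : ℕ) : ℝ) / ((N * T' : ℕ) : ℝ) = 1 - 1 / N := by
    push_cast [Nat.cast_sub hN]; field_simp
  obtain ⟨A, M, hMH, hMA, hMM, hMS, hΩ⟩ := nibble_iterate H h3 S D κ hκ1 hκ hD0 hD hS hHS N hN'
    (N * T') (by exact_mod_cast hT'0.trans_le hTT) (by linarith) (by linarith)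
    (1 / (2 * N ^ 4)) (by positivity) ((N - 1) * T') ht.le
  refine ⟨M, hMH, hMM, ?_⟩
  have hsub : (#(S.filter (fun s => ∀ f ∈ M, s ∉ f)) : ℝ) ≤ #(S ∩ A) := by
    norm_cast
    apply Finset.card_le_card
    intro s hs
    rw [Finset.mem_filter] at hs
    rcases hMS s hs.1 with h | ⟨f, hf, hsf⟩
    · exact Finset.mem_inter.2 ⟨hs.1, h⟩
    · exact absurd hsf (hs.2 f hf)
  refine hsub.trans ?_
  rw [ht] at hΩ
  have h1 : 0 ≤ (1 + 5 * (N : ℝ) ^ 4 / (N * T' : ℕ)) ^ (N * T' - (N - 1) * T') /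
      (1 / (2 * N ^ 4) * D ^ 2) * degErr H A (1 - (1 - 1 / N)) :=
    mul_nonneg (by positivity) (Finset.sum_nonneg fun u _ => sq_nonneg _)
  have h2 : (N : ℝ) ^ 4 * (1 / (2 * N ^ 4)) * #S = #S / 2 := by field_simp
  have h3 : K / (1 / (2 * (N : ℝ) ^ 4) * D ^ 2) * (72 * κ * D * #S * N ^ 4) ≤ #S / 2 := by
    have e : K / (1 / (2 * (N : ℝ) ^ 4) * D ^ 2) * (72 * κ * D * #S * N ^ 4) =
      (144 * K * N ^ 8 * #S / D) * κ := by field_simp; ring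
    rw [e]
    calc _ ≤ (144 * K * N ^ 8 * #S / D) * (1 / (288 * K * N ^ 8) * D) := by gcongr
      _ = #S / 2 := by
        have : K ≠ 0 := (Real.exp_pos _).ne'
        field_simp; ring
  have h4 : (#(S ∩ A) : ℝ) / (1 - (1 - 1 / N)) ≤ 2 * #S := by
    have h5 : (1 - 1 / (N : ℝ)) * (N ^ 4 * (1 / (2 * N ^ 4)) * #S +
        K / (1 / (2 * (N : ℝ) ^ 4) * D ^ 2) * (72 * κ * D * #S * N ^ 4)) ≤ 1 * (#S / 2 + #S / 2) := by
      rw [h2]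
      have : 0 ≤ 1 - 1 / (N : ℝ) := by
        rw [sub_nonneg, div_le_one (by linarith)]; exact hN'
      have : (0 : ℝ) ≤ 1 / (N : ℝ) := by positivity
      gcongr
      linarith
    linarith
  have h6 : (1 - (1 - 1 / (N : ℝ))) = 1 / N := by ring
  rw [h6, div_le_iff₀ (by positivity)] at h4
  calc (#(S ∩ A) : ℝ) ≤ 2 * #S * (1 / N) := h4
    _ = _ := by ring

end

section
variable {S V Z : Type} [DecidableEq S] [DecidableEq V] [DecidableEq Z]

/-- The hyperedge of a slot, a vertex and a colour. -/
def slotEdge (z : S × V → Z) (q : S × V) : Finset (S ⊕ V ⊕ Z) :=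
  {Sum.inl q.1, Sum.inr (Sum.inl q.2), Sum.inr (Sum.inr (z q))}

lemma inl_mem_slotEdge (z : S × V → Z) (q : S × V) (s : S) :
    (Sum.inl s : S ⊕ V ⊕ Z) ∈ slotEdge z q ↔ q.1 = s := by
  simp [slotEdge, eq_comm]

lemma inr_inl_mem_slotEdge (z : S × V → Z) (q : S × V) (v : V) :
    (Sum.inr (Sum.inl v) : S ⊕ V ⊕ Z) ∈ slotEdge z q ↔ q.2 = v := by
  simp [slotEdge, eq_comm]

lemma inr_inr_mem_slotEdge (z : S × V → Z) (q : S × V) (c : Z) :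
    (Sum.inr (Sum.inr c) : S ⊕ V ⊕ Z) ∈ slotEdge z q ↔ z q = c := by
  simp [slotEdge, eq_comm]

lemma slotEdge_injective (z : S × V → Z) : Function.Injective (slotEdge z) := by
  intro q q' h
  have h1 := (inl_mem_slotEdge z q' q.1).1 (h ▸ (inl_mem_slotEdge z q q.1).2 rfl)
  have h2 := (inr_inl_mem_slotEdge z q' q.2).1 (h ▸ (inr_inl_mem_slotEdge z q q.2).2 rfl)
  exact Prod.ext h1.symm h2.symm

lemma card_filter_image_slotEdge (z : S × V → Z) (E : Finset (S × V))
    (P : Finset (S ⊕ V ⊕ Z) → Prop) [DecidablePred P] :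
    #((E.image (slotEdge z)).filter P) = #(E.filter (fun q => P (slotEdge z q))) := by
  rw [Finset.filter_image, Finset.card_image_of_injective _ (slotEdge_injective z)]

end

/-- The nibble for slots: a system of slots to be filled by vertices along distinct colours. -/
lemma slot_nibble (N : ℕ) (hN : 1 ≤ N) : ∃ δ : ℝ, 0 < δ ∧ ∀ (S V Z : Type) [DecidableEq S]
    [DecidableEq V] [DecidableEq Z] [Fintype S] [Fintype V] [Fintype Z]
    (E : Finset (S × V)) (z : S × V → Z) (D κ : ℕ), 1 ≤ κ → 0 < D →
    (∀ s, #(E.filter (fun q => q.1 = s)) = D) → (∀ v, #(E.filter (fun q => q.2 = v)) ≤ D) →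
    (∀ c, #(E.filter (fun q => z q = c)) ≤ D) →
    (∀ s c, #(E.filter (fun q => q.1 = s ∧ z q = c)) ≤ κ) →
    (∀ v c, #(E.filter (fun q => q.2 = v ∧ z q = c)) ≤ κ) → (κ : ℝ) ≤ δ * D →
    ∃ M ⊆ E, (∀ q ∈ M, ∀ q' ∈ M, q ≠ q' → q.1 ≠ q'.1 ∧ q.2 ≠ q'.2 ∧ z q ≠ z q') ∧
      (#(univ.filter (fun s => ∀ q ∈ M, q.1 ≠ s)) : ℝ) ≤ 2 / N * Fintype.card S := by
  obtain ⟨δ, hδ, hnib⟩ := nibble N hN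
  refine ⟨δ, hδ, ?_⟩
  intro S V Z _ _ _ _ _ _ E z D κ hκ1 hD hS hV hZ hSZ hVZ hκD
  have hsv : ∀ s v, #(E.filter (fun q => q.1 = s ∧ q.2 = v)) ≤ κ := by
    intro s v
    refine le_trans (Finset.card_le_one.2 ?_) hκ1
    intro a ha b hb
    simp only [mem_filter] at ha hb
    exact Prod.ext (ha.2.1.trans hb.2.1.symm) (ha.2.2.trans hb.2.2.symm)
  have hE : #E = D * Fintype.card S := by
    rw [Finset.card_eq_sum_card_fiberwise (f := Prod.fst) (t := univ) (by simp)]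
    simp [hS, mul_comm]
  have hzero : ∀ (p : S × V → Prop) [DecidablePred p], (∀ q, ¬ p q) → #(E.filter p) ≤ κ := by
    intro p _ hp
    rw [Finset.filter_false_of_mem (fun q _ => hp q)]; simp
  have hex := hnib (S ⊕ V ⊕ Z) (E.image (slotEdge z))
    (univ.image Sum.inl) D κ ?_ hκ1 ?_ (by exact_mod_cast hD) ?_ ?_ ?_ hκD
  · obtain ⟨M, hMH, hMM, hMc⟩ := hex
    refine ⟨E.filter (fun q => slotEdge z q ∈ M), Finset.filter_subset _ _, ?_, ?_⟩
    · intro q hq q' hq' hne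
      rw [Finset.mem_filter] at hq hq'
      have hdis := hMM _ hq.2 _ hq'.2 (fun h => hne (slotEdge_injective z h))
      rw [Finset.disjoint_left] at hdis
      refine ⟨fun h => ?_, fun h => ?_, fun h => ?_⟩
      · exact hdis ((inl_mem_slotEdge z q q.1).2 rfl) ((inl_mem_slotEdge z q' q.1).2 h.symm)
      · exact hdis ((inr_inl_mem_slotEdge z q q.2).2 rfl) ((inr_inl_mem_slotEdge z q' q.2).2 h.symm)
      · exact hdis ((inr_inr_mem_slotEdge z q _).2 rfl) ((inr_inr_mem_slotEdge z q' _).2 h.symm)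
    · rw [Finset.card_image_of_injective _ Sum.inl_injective, Finset.card_univ] at hMc
      refine le_trans ?_ hMc
      norm_cast
      rw [← Finset.card_image_of_injective _ (Sum.inl_injective (α := S) (β := V ⊕ Z))]
      apply Finset.card_le_card
      intro x hx
      simp only [mem_image, mem_filter, mem_univ, true_and] at hx ⊢
      obtain ⟨s, hs, rfl⟩ := hx
      refine ⟨⟨s, rfl⟩, fun f hf hsf => ?_⟩
      obtain ⟨q, hq, rfl⟩ := Finset.mem_image.1 (hMH hf)
      exact hs q ⟨hq, hf⟩ ((inl_mem_slotEdge z q s).1 hsf)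
  · intro f hf
    obtain ⟨q, _, rfl⟩ := Finset.mem_image.1 hf
    simp [slotEdge]
  · intro a b hab
    rw [card_filter_image_slotEdge]
    rcases a with s | v | c <;> rcases b with s' | v' | c' <;>
      simp only [inl_mem_slotEdge, inr_inl_mem_slotEdge, inr_inr_mem_slotEdge]
    · exact hzero _ (fun q h => hab (by rw [← h.1, ← h.2]))
    · exact hsv _ _
    · exact hSZ _ _
    · simp only [and_comm]; exact hsv _ _
    · exact hzero _ (fun q h => hab (by rw [← h.1, ← h.2]))
    · exact hVZ _ _
    · simp only [and_comm]; exact hSZ _ _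
    · simp only [and_comm]; exact hVZ _ _
    · exact hzero _ (fun q h => hab (by rw [← h.1, ← h.2]))
  · intro u
    unfold hdeg
    rw [card_filter_image_slotEdge]
    norm_cast
    rcases u with s | v | c <;>
      simp only [inl_mem_slotEdge, inr_inl_mem_slotEdge, inr_inr_mem_slotEdge]
    · exact (hS s).le
    · exact hV v
    · exact hZ c
  · intro u hu
    obtain ⟨s, _, rfl⟩ := Finset.mem_image.1 hu
    unfold hdeg
    rw [card_filter_image_slotEdge]
    simp only [inl_mem_slotEdge, hS]
  · rw [Finset.card_image_of_injective _ (slotEdge_injective z),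
      Finset.card_image_of_injective _ Sum.inl_injective, Finset.card_univ, hE]
    push_cast; exact le_rfl

/-- The sign of a Boolean. -/
def sg (b : Bool) : ℝ := if b then 1 else -1

lemma sg_not (b : Bool) : sg (!b) = - sg b := by cases b <;> simp [sg]

lemma abs_sg (b : Bool) : |sg b| = 1 := by cases b <;> simp [sg]

lemma sg_mul_self (b : Bool) : sg b * sg b = 1 := by cases b <;> simp [sg]

section
variable {B : Type*} [Fintype B] [DecidableEq B]

lemma sum_eq_zero_of_flip (a : B) (f : (B → Bool) → ℝ)
    (h : ∀ σ, f (Function.update σ a (!σ a)) = - f σ) : ∑ σ, f σ = 0 := by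
  have hinv : Function.Involutive (fun σ : B → Bool => Function.update σ a (!σ a)) := by
    intro σ
    simp
  have := Equiv.sum_comp (Function.Involutive.toPerm _ hinv) f
  have h2 : ∑ σ, f ((Function.Involutive.toPerm _ hinv) σ) = - ∑ σ, f σ := by
    rw [← Finset.sum_neg_distrib]
    exact Finset.sum_congr rfl fun σ _ => h σ
  linarith

lemma sum_signs_two (a b : B) (hab : a ≠ b) : ∑ σ : B → Bool, sg (σ a) * sg (σ b) = 0 := by
  apply sum_eq_zero_of_flip a
  intro σ
  simp [Function.update_of_ne hab.symm, sg_not]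

lemma abs_sum_signs_four (a b c d : B) :
    |∑ σ : B → Bool, sg (σ a) * sg (σ b) * sg (σ c) * sg (σ d)| ≤
      2 ^ Fintype.card B * ((if a = b then 1 else 0) + (if a = c then 1 else 0) +
        (if a = d then 1 else 0)) := by
  by_cases h : a = b ∨ a = c ∨ a = d
  · have h1 : |∑ σ : B → Bool, sg (σ a) * sg (σ b) * sg (σ c) * sg (σ d)| ≤
        2 ^ Fintype.card B * 1 := by
      calc _ ≤ ∑ σ : B → Bool, |sg (σ a) * sg (σ b) * sg (σ c) * sg (σ d)| :=
            Finset.abs_sum_le_sum_abs _ _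
        _ = _ := by simp [abs_mul, abs_sg]
    refine h1.trans (mul_le_mul_of_nonneg_left ?_ (by positivity))
    rcases h with h | h | h <;> simp only [h, if_true] <;> split_ifs <;> norm_num
  · push Not at h
    obtain ⟨h1, h2, h3⟩ := h
    rw [sum_eq_zero_of_flip a]
    · simp [h1, h2, h3]
    · intro σ
      simp [Function.update_of_ne h1.symm, Function.update_of_ne h2.symm,
        Function.update_of_ne h3.symm, sg_not]

/-- Second moment of signed sums. -/
lemma sum_signs_sq {I : Type*} [Fintype I] (M : B → I → ℝ) (q : ℝ)
    (hq : ∀ b i, |M b i| ≤ q) :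
    ∑ σ : B → Bool, ∑ i, (∑ b, sg (σ b) * M b i) ^ 2 ≤
      2 ^ Fintype.card B * (q * ∑ i, ∑ b, |M b i|) := by
  rw [Finset.sum_comm]
  rw [Finset.mul_sum, Finset.mul_sum]
  refine Finset.sum_le_sum fun i _ => ?_
  have : ∑ σ : B → Bool, (∑ b, sg (σ b) * M b i) ^ 2 =
      ∑ b, ∑ b', (∑ σ : B → Bool, sg (σ b) * sg (σ b')) * (M b i * M b' i) := by
    have e : ∀ σ : B → Bool, (∑ b, sg (σ b) * M b i) ^ 2 =
        ∑ b, ∑ b', sg (σ b) * sg (σ b') * (M b i * M b' i) := by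
      intro σ
      rw [sq, Finset.sum_mul_sum]
      refine Finset.sum_congr rfl fun b _ => Finset.sum_congr rfl fun b' _ => ?_
      ring
    simp only [e, Finset.sum_mul]
    rw [Finset.sum_comm]
    refine Finset.sum_congr rfl fun b _ => ?_
    rw [Finset.sum_comm]
  rw [this]
  have h2 : ∀ b, ∑ b', (∑ σ : B → Bool, sg (σ b) * sg (σ b')) * (M b i * M b' i) =
      2 ^ Fintype.card B * (M b i) ^ 2 := by
    intro b
    rw [Finset.sum_eq_single b]
    · simp [sg_mul_self, sq]
    · intro b' _ hb
      rw [sum_signs_two b b' hb.symm, zero_mul]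
    · simp
  simp only [h2, ← Finset.mul_sum]
  refine mul_le_mul_of_nonneg_left ?_ (by positivity)
  rw [Finset.mul_sum]
  refine Finset.sum_le_sum fun b _ => ?_
  rw [← sq_abs, sq]
  exact mul_le_mul_of_nonneg_right (hq b i) (abs_nonneg _)

end

section
variable {B X Y : Type*} [Fintype B] [DecidableEq B] [Fintype X] [Fintype Y]

/-- A signed combination of matrices. -/
noncomputable def signedMatrix (M : B → X → Y → ℝ) (σ : B → Bool) (x : X) (y : Y) : ℝ :=
  ∑ b, sg (σ b) * M b x y

omit [DecidableEq B] in
lemma prod_sum_three (w : B → ℝ) (h k : B → ℝ) :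
    ∑ a, ∑ c, ∑ d, w a * (h c * k d) = (∑ a, w a) * (∑ c, h c) * (∑ d, k d) := by
  simp only [← Finset.mul_sum, ← Finset.sum_mul]
  ring

lemma quad_sum_ab (f g h k : B → ℝ) :
    ∑ a, ∑ b, ∑ c, ∑ d, (if a = b then f a * g b else 0) * (h c * k d) =
      (∑ a, f a * g a) * (∑ c, h c) * (∑ d, k d) := by
  rw [← prod_sum_three]
  refine Finset.sum_congr rfl fun a _ => ?_
  rw [Finset.sum_eq_single a]
  · simp
  · intro b _ hb; simp [hb.symm]
  · simp

lemma quad_sum_ac (f g h k : B → ℝ) :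
    ∑ a, ∑ b, ∑ c, ∑ d, (if a = c then f a * h c else 0) * (g b * k d) =
      (∑ a, f a * h a) * (∑ b, g b) * (∑ d, k d) := by
  rw [← quad_sum_ab]
  exact Finset.sum_congr rfl fun a _ => Finset.sum_comm

lemma quad_sum_ad (f g h k : B → ℝ) :
    ∑ a, ∑ b, ∑ c, ∑ d, (if a = d then f a * k d else 0) * (g b * h c) =
      (∑ a, f a * k a) * (∑ b, g b) * (∑ c, h c) := by
  rw [← quad_sum_ac]
  exact Finset.sum_congr rfl fun a _ => Finset.sum_congr rfl fun b _ => Finset.sum_comm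

omit [DecidableEq B] [Fintype X] in
lemma signed_square_expand (M : B → X → Y → ℝ) (σ : B → Bool) (x x' : X) :
    (∑ y, signedMatrix M σ x y * signedMatrix M σ x' y) ^ 2 =
      ∑ y₁, ∑ y₂, ∑ a, ∑ b, ∑ c, ∑ d, (sg (σ a) * sg (σ b) * sg (σ c) * sg (σ d)) *
        (M a x y₁ * M b x' y₁ * M c x y₂ * M d x' y₂) := by
  unfold signedMatrix
  rw [sq, Finset.sum_mul_sum]
  refine Finset.sum_congr rfl fun y₁ _ => Finset.sum_congr rfl fun y₂ _ => ?_
  rw [Finset.sum_mul_sum, Finset.sum_mul_sum, Finset.sum_mul]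
  refine Finset.sum_congr rfl fun a _ => ?_
  rw [Finset.sum_mul]
  refine Finset.sum_congr rfl fun b _ => ?_
  rw [Finset.mul_sum]
  refine Finset.sum_congr rfl fun c _ => ?_
  rw [Finset.mul_sum]
  refine Finset.sum_congr rfl fun d _ => ?_
  ring

omit [Fintype X] in
lemma signed_fourth_pointwise (M N : B → X → Y → ℝ) (hMN : ∀ b x y, |M b x y| ≤ N b x y)
    (x x' : X) :
    ∑ σ : B → Bool, (∑ y, signedMatrix M σ x y * signedMatrix M σ x' y) ^ 2 ≤
      2 ^ Fintype.card B * ∑ y₁, ∑ y₂,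
        ((∑ a, N a x y₁ * N a x' y₁) * (∑ c, N c x y₂) * (∑ d, N d x' y₂) +
         (∑ a, N a x y₁ * N a x y₂) * (∑ b, N b x' y₁) * (∑ d, N d x' y₂) +
         (∑ a, N a x y₁ * N a x' y₂) * (∑ b, N b x' y₁) * (∑ c, N c x y₂)) := by
  have hN : ∀ b x y, 0 ≤ N b x y := fun b x y => (abs_nonneg _).trans (hMN b x y)
  simp only [signed_square_expand]
  rw [Finset.sum_comm, Finset.mul_sum]
  refine Finset.sum_le_sum fun y₁ _ => ?_
  rw [Finset.sum_comm, Finset.mul_sum]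
  refine Finset.sum_le_sum fun y₂ _ => ?_
  calc _ = ∑ a, ∑ b, ∑ c, ∑ d, (∑ σ : B → Bool, sg (σ a) * sg (σ b) * sg (σ c) * sg (σ d)) *
        (M a x y₁ * M b x' y₁ * M c x y₂ * M d x' y₂) := by
        simp only [Finset.sum_mul]
        rw [Finset.sum_comm]; refine Finset.sum_congr rfl fun a _ => ?_
        rw [Finset.sum_comm]; refine Finset.sum_congr rfl fun b _ => ?_
        rw [Finset.sum_comm]; refine Finset.sum_congr rfl fun c _ => ?_
        rw [Finset.sum_comm]
    _ ≤ ∑ a, ∑ b, ∑ c, ∑ d, (2 ^ Fintype.card B * ((if a = b then 1 else 0) +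
        (if a = c then 1 else 0) + (if a = d then 1 else 0))) *
        (N a x y₁ * N b x' y₁ * N c x y₂ * N d x' y₂) := by
        refine Finset.sum_le_sum fun a _ => Finset.sum_le_sum fun b _ =>
          Finset.sum_le_sum fun c _ => Finset.sum_le_sum fun d _ => ?_
        refine (le_abs_self _).trans ?_
        rw [abs_mul]
        refine mul_le_mul (abs_sum_signs_four a b c d) ?_ (abs_nonneg _) (by positivity)
        rw [abs_mul, abs_mul, abs_mul]
        have := hN a x y₁; have := hN b x' y₁; have := hN c x y₂
        gcongr <;> apply hMN
    _ = _ := by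
        have e : ∀ a b c d : B, (2 ^ Fintype.card B * ((if a = b then (1 : ℝ) else 0) +
            (if a = c then 1 else 0) + (if a = d then 1 else 0))) *
            (N a x y₁ * N b x' y₁ * N c x y₂ * N d x' y₂) = 2 ^ Fintype.card B *
            ((if a = b then N a x y₁ * N b x' y₁ else 0) * (N c x y₂ * N d x' y₂) +
             (if a = c then N a x y₁ * N c x y₂ else 0) * (N b x' y₁ * N d x' y₂) +
             (if a = d then N a x y₁ * N d x' y₂ else 0) * (N b x' y₁ * N c x y₂)) := by
          intro a b c d
          split_ifs <;> ring
        rw [← quad_sum_ab (fun a => N a x y₁) (fun b => N b x' y₁) (fun c => N c x y₂)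
            (fun d => N d x' y₂), ← quad_sum_ac (fun a => N a x y₁) (fun b => N b x' y₁)
            (fun c => N c x y₂) (fun d => N d x' y₂), ← quad_sum_ad (fun a => N a x y₁)
            (fun b => N b x' y₁) (fun c => N c x y₂) (fun d => N d x' y₂)]
        simp only [e, ← Finset.sum_add_distrib, Finset.mul_sum]

lemma signed_fourth (M N : B → X → Y → ℝ) (hMN : ∀ b x y, |M b x y| ≤ N b x y) (q k n : ℝ)
    (hq0 : 0 ≤ q) (hk0 : 0 ≤ k) (hn0 : 0 ≤ n)
    (hY : ∀ b x, ∑ y, N b x y ≤ q) (hX : ∀ b y, ∑ x, N b x y ≤ q)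
    (hk : ∀ x y, ∑ b, N b x y ≤ k) (hn : ∀ x, ∑ y, ∑ b, N b x y ≤ n) (hXn : Fintype.card X ≤ n) :
    ∑ σ : B → Bool, ∑ x, ∑ x', (∑ y, signedMatrix M σ x y * signedMatrix M σ x' y) ^ 2 ≤
      2 ^ Fintype.card B * (q * (2 * k + k ^ 2) * n ^ 3) := by
  have hN : ∀ b x y, 0 ≤ N b x y := fun b x y => (abs_nonneg _).trans (hMN b x y)
  have hNb : ∀ x y, 0 ≤ ∑ b, N b x y := fun x y => Finset.sum_nonneg fun b _ => hN b x y
  have hXc : (∑ _x : X, n * n * q : ℝ) ≤ n ^ 3 * q := by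
    rw [Finset.sum_const, Finset.card_univ, nsmul_eq_mul]
    calc (Fintype.card X : ℝ) * (n * n * q) ≤ n * (n * n * q) := by gcongr
      _ = _ := by ring
  have t1 : ∑ x, ∑ x', ∑ y₁, ∑ y₂, (∑ a, N a x y₁ * N a x' y₁) * (∑ c, N c x y₂) *
      (∑ d, N d x' y₂) ≤ k * (n ^ 3 * q) := by
    refine le_trans ?_ (mul_le_mul_of_nonneg_left hXc hk0)
    rw [Finset.mul_sum]
    refine Finset.sum_le_sum fun x _ => ?_
    calc _ ≤ ∑ x', ∑ y₁, ∑ y₂, (∑ a, N a x y₁ * N a x' y₁) * (∑ c, N c x y₂) * k := by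
          refine Finset.sum_le_sum fun x' _ => Finset.sum_le_sum fun y₁ _ =>
            Finset.sum_le_sum fun y₂ _ => mul_le_mul_of_nonneg_left (hk _ _) ?_
          exact mul_nonneg (Finset.sum_nonneg fun a _ => mul_nonneg (hN _ _ _) (hN _ _ _)) (hNb _ _)
      _ = (∑ y₁, ∑ a, N a x y₁ * ∑ x', N a x' y₁) * (∑ y₂, ∑ c, N c x y₂) * k := by
          simp only [← Finset.sum_mul, ← Finset.mul_sum]
          congr 2
          rw [Finset.sum_comm]
          refine Finset.sum_congr rfl fun y₁ _ => ?_
          rw [Finset.sum_comm]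
          simp only [← Finset.mul_sum]
      _ ≤ (n * q) * n * k := by
          have h1 : ∑ y₁, ∑ a, N a x y₁ * ∑ x', N a x' y₁ ≤ ∑ y₁, ∑ a, N a x y₁ * q :=
            Finset.sum_le_sum fun y₁ _ => Finset.sum_le_sum fun a _ =>
              mul_le_mul_of_nonneg_left (hX a y₁) (hN _ _ _)
          have h2 : ∑ y₁, ∑ a, N a x y₁ * q ≤ n * q := by
            simp only [← Finset.sum_mul]
            exact mul_le_mul_of_nonneg_right (hn x) hq0
          refine mul_le_mul_of_nonneg_right ?_ hk0
          exact mul_le_mul (h1.trans h2) (hn x) (Finset.sum_nonneg fun y _ => hNb x y)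
            (by positivity)
      _ = _ := by ring
  have t2 : ∑ x, ∑ x', ∑ y₁, ∑ y₂, (∑ a, N a x y₁ * N a x y₂) * (∑ b, N b x' y₁) *
      (∑ d, N d x' y₂) ≤ k ^ 2 * (n ^ 3 * q) := by
    refine le_trans ?_ (mul_le_mul_of_nonneg_left hXc (by positivity))
    rw [Finset.mul_sum]
    refine Finset.sum_le_sum fun x _ => ?_
    calc _ ≤ ∑ x' : X, ∑ y₁, ∑ y₂, (∑ a, N a x y₁ * N a x y₂) * k * k := by
          refine Finset.sum_le_sum fun x' _ => Finset.sum_le_sum fun y₁ _ =>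
            Finset.sum_le_sum fun y₂ _ => ?_
          have := hNb x' y₁; have := hNb x' y₂
          have : 0 ≤ ∑ a, N a x y₁ * N a x y₂ :=
            Finset.sum_nonneg fun a _ => mul_nonneg (hN _ _ _) (hN _ _ _)
          gcongr
          · exact hk _ _
          · exact hk _ _
      _ = Fintype.card X * (∑ y₁, ∑ a, N a x y₁ * ∑ y₂, N a x y₂) * k * k := by
          simp only [← Finset.sum_mul, Finset.sum_const, Finset.card_univ, nsmul_eq_mul]
          congr 3
          refine Finset.sum_congr rfl fun y₁ _ => ?_
          rw [Finset.sum_comm]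
          simp only [← Finset.mul_sum]
      _ ≤ n * (n * q) * k * k := by
          have h1 : ∑ y₁, ∑ a, N a x y₁ * ∑ y₂, N a x y₂ ≤ ∑ y₁, ∑ a, N a x y₁ * q :=
            Finset.sum_le_sum fun y₁ _ => Finset.sum_le_sum fun a _ =>
              mul_le_mul_of_nonneg_left (hY a x) (hN _ _ _)
          have h2 : ∑ y₁, ∑ a, N a x y₁ * q ≤ n * q := by
            simp only [← Finset.sum_mul]
            exact mul_le_mul_of_nonneg_right (hn x) hq0
          have h3 : 0 ≤ ∑ y₁, ∑ a, N a x y₁ * ∑ y₂, N a x y₂ :=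
            Finset.sum_nonneg fun y _ => Finset.sum_nonneg fun a _ =>
              mul_nonneg (hN _ _ _) (Finset.sum_nonneg fun _ _ => hN _ _ _)
          refine mul_le_mul_of_nonneg_right (mul_le_mul_of_nonneg_right ?_ hk0) hk0
          exact mul_le_mul hXn (h1.trans h2) h3 hn0
      _ = _ := by ring
  have t3 : ∑ x, ∑ x', ∑ y₁, ∑ y₂, (∑ a, N a x y₁ * N a x' y₂) * (∑ b, N b x' y₁) *
      (∑ c, N c x y₂) ≤ k * (n ^ 3 * q) := by
    refine le_trans ?_ (mul_le_mul_of_nonneg_left hXc hk0)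
    rw [Finset.mul_sum]
    refine Finset.sum_le_sum fun x _ => ?_
    calc _ ≤ ∑ x', ∑ y₁, ∑ y₂, (∑ a, N a x y₁ * N a x' y₂) * k * (∑ c, N c x y₂) := by
          refine Finset.sum_le_sum fun x' _ => Finset.sum_le_sum fun y₁ _ =>
            Finset.sum_le_sum fun y₂ _ => ?_
          have := hNb x y₂
          have : 0 ≤ ∑ a, N a x y₁ * N a x' y₂ :=
            Finset.sum_nonneg fun a _ => mul_nonneg (hN _ _ _) (hN _ _ _)
          gcongr
          exact hk _ _
      _ = ∑ y₁, ∑ a, N a x y₁ * (∑ y₂, (∑ x', N a x' y₂) * (∑ c, N c x y₂)) * k := by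
          rw [Finset.sum_comm]
          refine Finset.sum_congr rfl fun y₁ _ => ?_
          calc _ = ∑ x', ∑ a, ∑ y₂, N a x y₁ * N a x' y₂ * k * (∑ c, N c x y₂) := by
                refine Finset.sum_congr rfl fun x' _ => ?_
                rw [Finset.sum_comm]
                refine Finset.sum_congr rfl fun y₂ _ => ?_
                rw [Finset.sum_mul, Finset.sum_mul]
            _ = ∑ a, ∑ x', ∑ y₂, N a x y₁ * N a x' y₂ * k * (∑ c, N c x y₂) :=
                Finset.sum_comm
            _ = _ := by
                refine Finset.sum_congr rfl fun a _ => ?_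
                rw [Finset.sum_comm, Finset.mul_sum, Finset.sum_mul]
                refine Finset.sum_congr rfl fun y₂ _ => ?_
                rw [← Finset.sum_mul, ← Finset.sum_mul, ← Finset.mul_sum]
                ring
      _ ≤ ∑ y₁, ∑ a, N a x y₁ * (∑ y₂, q * (∑ c, N c x y₂)) * k := by
          have h1 : ∀ a y₂, (∑ x', N a x' y₂) * (∑ c, N c x y₂) ≤ q * (∑ c, N c x y₂) :=
            fun a y₂ => mul_le_mul_of_nonneg_right (hX a y₂) (hNb _ _)
          refine Finset.sum_le_sum fun y₁ _ => Finset.sum_le_sum fun a _ => ?_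
          exact mul_le_mul_of_nonneg_right (mul_le_mul_of_nonneg_left
            (Finset.sum_le_sum fun y₂ _ => h1 a y₂) (hN a x y₁)) hk0
      _ ≤ (n * (q * n)) * k := by
          simp only [← Finset.sum_mul, ← Finset.mul_sum]
          have h0 : 0 ≤ ∑ y, ∑ b, N b x y := Finset.sum_nonneg fun y _ => hNb x y
          exact mul_le_mul_of_nonneg_right (mul_le_mul (hn x)
            (mul_le_mul_of_nonneg_left (hn x) hq0) (mul_nonneg hq0 h0) hn0) hk0
      _ = _ := by ring
  calc _ = ∑ x, ∑ x', ∑ σ : B → Bool,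
        (∑ y, signedMatrix M σ x y * signedMatrix M σ x' y) ^ 2 := by
        rw [Finset.sum_comm]
        refine Finset.sum_congr rfl fun x _ => ?_
        rw [Finset.sum_comm]
    _ ≤ _ := Finset.sum_le_sum fun x _ => Finset.sum_le_sum fun x' _ =>
        signed_fourth_pointwise M N hMN x x'
    _ ≤ _ := by
        simp only [← Finset.mul_sum, Finset.sum_add_distrib]
        refine mul_le_mul_of_nonneg_left ?_ (by positivity)
        linarith

omit [Fintype B] [DecidableEq B] in
/-- A bilinear form is controlled by the Gram matrix of its rows. -/
lemma bilinear_fourth (F : X → Y → ℝ) (a : X → ℝ) (b : Y → ℝ) :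
    (∑ x, ∑ y, a x * b y * F x y) ^ 4 ≤ (∑ x, a x ^ 2) ^ 2 * (∑ y, b y ^ 2) ^ 2 *
      ∑ x, ∑ x', (∑ y, F x y * F x' y) ^ 2 := by
  set G : X → X → ℝ := fun x x' => ∑ y, F x y * F x' y with hG
  have h1 : (∑ x, ∑ y, a x * b y * F x y) ^ 2 ≤ (∑ y, b y ^ 2) * ∑ y, (∑ x, a x * F x y) ^ 2 := by
    have : ∑ x, ∑ y, a x * b y * F x y = ∑ y, b y * ∑ x, a x * F x y := by
      rw [Finset.sum_comm]
      refine Finset.sum_congr rfl fun y _ => ?_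
      rw [Finset.mul_sum]
      refine Finset.sum_congr rfl fun x _ => ?_
      ring
    rw [this]
    exact Finset.sum_mul_sq_le_sq_mul_sq _ _ _
  have h2 : ∑ y, (∑ x, a x * F x y) ^ 2 = ∑ p : X × X, (a p.1 * a p.2) * G p.1 p.2 := by
    rw [Fintype.sum_prod_type]
    have e : ∀ y, (∑ x, a x * F x y) ^ 2 = ∑ x, ∑ x', (a x * F x y) * (a x' * F x' y) := by
      intro y
      rw [sq, Finset.sum_mul_sum]
    simp only [e]
    rw [Finset.sum_comm]
    refine Finset.sum_congr rfl fun x _ => ?_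
    rw [Finset.sum_comm]
    refine Finset.sum_congr rfl fun x' _ => ?_
    rw [hG, Finset.mul_sum]
    refine Finset.sum_congr rfl fun y _ => ?_
    ring
  have h3 : (∑ p : X × X, (a p.1 * a p.2) * G p.1 p.2) ^ 2 ≤
      (∑ x, a x ^ 2) ^ 2 * ∑ x, ∑ x', G x x' ^ 2 := by
    refine (Finset.sum_mul_sq_le_sq_mul_sq _ _ _).trans (le_of_eq ?_)
    have e1 : ∑ p : X × X, (a p.1 * a p.2) ^ 2 = (∑ x, a x ^ 2) ^ 2 := by
      rw [Fintype.sum_prod_type, sq (∑ x, a x ^ 2), Finset.sum_mul_sum]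
      simp only [mul_pow]
    have e2 : ∑ p : X × X, G p.1 p.2 ^ 2 = ∑ x, ∑ x', G x x' ^ 2 := Fintype.sum_prod_type _
    rw [e1, e2]
  have h0 : 0 ≤ ∑ y, b y ^ 2 := Finset.sum_nonneg fun _ _ => sq_nonneg _
  have h4 : 0 ≤ ∑ y, (∑ x, a x * F x y) ^ 2 := Finset.sum_nonneg fun _ _ => sq_nonneg _
  calc _ = ((∑ x, ∑ y, a x * b y * F x y) ^ 2) ^ 2 := by ring
    _ ≤ ((∑ y, b y ^ 2) * ∑ y, (∑ x, a x * F x y) ^ 2) ^ 2 := by gcongr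
    _ = (∑ y, b y ^ 2) ^ 2 * (∑ y, (∑ x, a x * F x y) ^ 2) ^ 2 := by ring
    _ ≤ (∑ y, b y ^ 2) ^ 2 * ((∑ x, a x ^ 2) ^ 2 * ∑ x, ∑ x', G x x' ^ 2) := by
        rw [h2]; gcongr
    _ = _ := by ring

end

/-- One outcome satisfies all of finitely many first-moment bounds up to the number of tests. -/
lemma exists_good_outcome {Ω J : Type*} [Fintype Ω] [Nonempty Ω] [Fintype J]
    (f : J → Ω → ℝ) (hf : ∀ j ω, 0 ≤ f j ω) (m : J → ℝ) (hm : ∀ j, 0 < m j)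
    (h : ∀ j, ∑ ω, f j ω ≤ Fintype.card Ω * m j) :
    ∃ ω, ∀ j, f j ω ≤ Fintype.card J * m j := by
  by_contra! hcon
  have h1 : ∀ ω, (Fintype.card J : ℝ) < ∑ j, f j ω / m j := by
    intro ω
    obtain ⟨j, hj⟩ := hcon ω
    have : f j ω / m j ≤ ∑ j, f j ω / m j :=
      Finset.single_le_sum (f := fun j => f j ω / m j)
        (fun j _ => div_nonneg (hf j ω) (hm j).le) (Finset.mem_univ j)
    exact lt_of_lt_of_le ((lt_div_iff₀ (hm j)).2 hj) this
  have h2 : ∑ ω : Ω, (Fintype.card J : ℝ) < ∑ ω, ∑ j, f j ω / m j :=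
    Finset.sum_lt_sum_of_nonempty Finset.univ_nonempty (fun ω _ => h1 ω)
  rw [Finset.sum_comm] at h2
  have h3 : ∑ j, ∑ ω, f j ω / m j ≤ ∑ _j : J, (Fintype.card Ω : ℝ) := by
    refine Finset.sum_le_sum fun j _ => ?_
    rw [← Finset.sum_div, div_le_iff₀ (hm j)]
    exact h j
  simp only [Finset.sum_const, Finset.card_univ, nsmul_eq_mul] at h2 h3
  linarith

section
variable {U : Type*} [DecidableEq U]

/-- Pairs `(u, i)` with `u ∈ S` whose involution `lam i` leads from `S` into `R \ S`. -/
def crossing (lam : Bool → U → U) (R S : Finset U) : Finset (U × Bool) :=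
  (S ×ˢ univ).filter fun p => lam p.2 p.1 ∈ R \ S

lemma crossing_insert (lam : Bool → U → U) (hlam : ∀ i u, lam i (lam i u) = u) (R S : Finset U)
    (u : U) (i : Bool) (hui : (u, i) ∈ crossing lam R S) :
    #(crossing lam R (insert (lam i u) S)) ≤ #(crossing lam R S) := by
  have hu : u ∈ S ∧ lam i u ∈ R ∧ lam i u ∉ S := by
    simpa [crossing] using hui
  have hsub : crossing lam R (insert (lam i u) S) ⊆
      insert (lam i u, !i) ((crossing lam R S).erase (u, i)) := by
    rintro ⟨w, j⟩ hw
    simp only [crossing, mem_filter, mem_product, mem_insert, mem_univ, and_true, mem_sdiff,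
      not_or, mem_erase] at hw ⊢
    obtain ⟨hw1, hw2, hw3, hw4⟩ := hw
    rcases hw1 with rfl | hw1
    · left
      by_cases hij : j = i
      · subst hij
        rw [hlam] at hw4
        exact absurd hu.1 hw4
      · rw [Prod.mk.injEq]
        refine ⟨rfl, ?_⟩
        cases i <;> cases j <;> simp_all
    · right
      refine ⟨?_, hw1, hw2, hw4⟩
      rintro h
      rw [Prod.mk.injEq] at h
      obtain ⟨rfl, rfl⟩ := h
      exact hw3 rfl
  have h1 := card_le_card hsub
  have h2 := card_insert_le (lam i u, !i) ((crossing lam R S).erase (u, i))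
  have h3 := card_erase_of_mem hui
  have h4 : 0 < #(crossing lam R S) := card_pos.2 ⟨_, hui⟩
  omega

lemma exists_block (lam : Bool → U → U) (hlam : ∀ i u, lam i (lam i u) = u) (R : Finset U)
    (hR : R.Nonempty) (l : ℕ) (hl : 1 ≤ l) :
    ∃ S ⊆ R, S.Nonempty ∧ #S ≤ l ∧ #(crossing lam R S) ≤ 2 ∧
      (#S = l ∨ crossing lam R S = ∅) := by
  induction l, hl using Nat.le_induction with
  | base =>
    obtain ⟨u, hu⟩ := hR
    refine ⟨{u}, by simpa using hu, by simp, by simp, ?_, by simp⟩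
    refine (card_filter_le _ _).trans ?_
    simp
  | succ l hl ih =>
    obtain ⟨S, hSR, hS, hSl, hc, h⟩ := ih
    by_cases hce : crossing lam R S = ∅
    · exact ⟨S, hSR, hS, by omega, hc, Or.inr hce⟩
    · have hSl' : #S = l := h.resolve_right hce
      obtain ⟨⟨u, i⟩, hui⟩ := nonempty_iff_ne_empty.2 hce
      have hu : u ∈ S ∧ lam i u ∈ R ∧ lam i u ∉ S := by
        simpa [crossing] using hui
      have hcard : #(insert (lam i u) S) = l + 1 := by
        rw [card_insert_of_notMem hu.2.2, hSl']
      refine ⟨insert (lam i u) S, insert_subset hu.2.1 hSR, insert_nonempty _ _, hcard.le,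
        (crossing_insert lam hlam R S u i hui).trans hc, Or.inl hcard⟩

/-- Pairs within `R` separated by the block map `κ`. -/
def separated (lam : Bool → U → U) (κ : U → U) (R : Finset U) : Finset (U × Bool) :=
  (R ×ˢ univ).filter fun p => lam p.2 p.1 ∈ R ∧ κ (lam p.2 p.1) ≠ κ p.1

lemma exists_block_map (lam : Bool → U → U) (hlam : ∀ i u, lam i (lam i u) = u) (l : ℕ)
    (hl : 1 ≤ l) (R : Finset U) :
    ∃ κ : U → U, (∀ u ∈ R, κ u ∈ R) ∧ (∀ u ∉ R, κ u = u) ∧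
      (∀ w, #(R.filter fun u => κ u = w) ≤ l) ∧ l * #(separated lam κ R) ≤ 4 * #R := by
  induction R using Finset.strongInduction with
  | H R ih =>
    rcases R.eq_empty_or_nonempty with rfl | hR
    · exact ⟨id, by simp, by simp, by simp, by simp [separated]⟩
    obtain ⟨S, hSR, hS, hSl, hc, h⟩ := exists_block lam hlam R hR l hl
    have hss : R \ S ⊂ R := sdiff_ssubset hSR hS
    obtain ⟨κ, h1, h2, h3, h4⟩ := ih _ hss
    obtain ⟨s, hs⟩ := hS
    refine ⟨fun u => if u ∈ S then s else κ u, ?_, ?_, ?_, ?_⟩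
    · intro u hu
      by_cases huS : u ∈ S
      · simpa [huS] using hSR hs
      · simpa [huS] using (mem_sdiff.1 (h1 u (mem_sdiff.2 ⟨hu, huS⟩))).1
    · intro u hu
      have huS : u ∉ S := fun h => hu (hSR h)
      simp only [huS, if_false]
      exact h2 u fun h => hu (mem_sdiff.1 h).1
    · intro w
      by_cases hw : w ∈ S
      · refine le_trans (card_le_card ?_) hSl
        intro u hu
        simp only [mem_filter] at hu
        by_contra huS
        simp only [huS, if_false] at hu
        have := h1 u (mem_sdiff.2 ⟨hu.1, huS⟩)
        rw [hu.2] at this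
        exact (mem_sdiff.1 this).2 hw
      · refine le_trans (card_le_card ?_) (h3 w)
        intro u hu
        simp only [mem_filter, mem_sdiff] at hu ⊢
        by_cases huS : u ∈ S
        · simp only [huS, if_true] at hu
          exact absurd (hu.2 ▸ hs) hw
        · simp only [huS, if_false] at hu
          exact ⟨⟨hu.1, huS⟩, hu.2⟩
    · have hsub : separated lam (fun u => if u ∈ S then s else κ u) R ⊆
          separated lam κ (R \ S) ∪ (crossing lam R S ∪
            (crossing lam R S).image fun p => (lam p.2 p.1, p.2)) := by
        rintro ⟨u, i⟩ hu
        simp only [separated, crossing, mem_filter, mem_product, mem_univ, and_true, mem_union,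
          mem_image, mem_sdiff, Prod.exists] at hu ⊢
        obtain ⟨hu1, hu2, hu3⟩ := hu
        by_cases huS : u ∈ S
        · by_cases hlS : lam i u ∈ S
          · simp [huS, hlS] at hu3
          · exact Or.inr (Or.inl ⟨huS, hu2, hlS⟩)
        · by_cases hlS : lam i u ∈ S
          · refine Or.inr (Or.inr ⟨lam i u, i, ⟨hlS, ?_, ?_⟩, ?_⟩)
            · rwa [hlam]
            · rwa [hlam]
            · rw [hlam]
          · simp only [huS, hlS, if_false] at hu3
            exact Or.inl ⟨⟨hu1, huS⟩, ⟨hu2, hlS⟩, hu3⟩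
      have hcard := card_le_card hsub
      have hu1 := card_union_le (separated lam κ (R \ S)) (crossing lam R S ∪
            (crossing lam R S).image fun p => (lam p.2 p.1, p.2))
      have hu2 := card_union_le (crossing lam R S)
        ((crossing lam R S).image fun p => (lam p.2 p.1, p.2))
      have hu3 : #((crossing lam R S).image fun p => (lam p.2 p.1, p.2)) ≤ _ := card_image_le
      have hRS := card_sdiff_add_card_eq_card hSR
      rcases h with h | h
      · have : #(separated lam (fun u => if u ∈ S then s else κ u) R) ≤
            #(separated lam κ (R \ S)) + 4 := by omega
        calc _ ≤ l * (#(separated lam κ (R \ S)) + 4) := Nat.mul_le_mul_left _ this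
          _ = l * #(separated lam κ (R \ S)) + 4 * #S := by rw [h]; ring
          _ ≤ _ := by omega
      · rw [h] at hcard hu2 hu1 hu3
        simp only [image_empty, union_empty] at hcard
        calc _ ≤ l * #(separated lam κ (R \ S)) := Nat.mul_le_mul_left _ hcard
          _ ≤ _ := by omega

/-- A finite set carrying two involutions is cut into small blocks that separate few pairs. -/
lemma exists_blocks [Fintype U] (lam : Bool → U → U) (hlam : ∀ i u, lam i (lam i u) = u) (l : ℕ)
    (hl : 1 ≤ l) :
    ∃ κ : U → U, (∀ w, #(univ.filter fun u => κ u = w) ≤ l) ∧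
      l * #(univ.filter fun p : U × Bool => κ (lam p.2 p.1) ≠ κ p.1) ≤
        4 * #(univ.filter fun u : U => ∃ i, lam i u ≠ u) := by
  set R := univ.filter fun u : U => ∃ i, lam i u ≠ u with hRdef
  obtain ⟨κ, h1, h2, h3, h4⟩ := exists_block_map lam hlam l hl R
  have hout : ∀ u ∉ R, ∀ i, lam i u = u := by
    intro u hu i
    by_contra hne
    exact hu (mem_filter.2 ⟨mem_univ _, i, hne⟩)
  refine ⟨κ, ?_, ?_⟩
  · intro w
    by_cases hw : w ∈ R
    · refine le_trans (card_le_card ?_) (h3 w)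
      intro u hu
      simp only [mem_filter, mem_univ, true_and] at hu ⊢
      refine ⟨?_, hu⟩
      by_contra huR
      rw [h2 u huR] at hu
      exact huR (hu ▸ hw)
    · refine le_trans (card_le_card (t := {w}) ?_) (by simpa using hl)
      intro u hu
      simp only [mem_filter, mem_univ, true_and] at hu
      by_cases huR : u ∈ R
      · exact absurd (hu ▸ h1 u huR) hw
      · rw [mem_singleton, ← hu, h2 u huR]
  · refine le_trans (Nat.mul_le_mul_left _ (card_le_card ?_)) h4
    rintro ⟨u, i⟩ hu
    simp only [separated, mem_filter, mem_univ, true_and, mem_product, and_true] at hu ⊢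
    have huR : u ∈ R := by
      by_contra huR
      rw [hout u huR] at hu
      exact hu rfl
    refine ⟨huR, ?_, hu⟩
    by_contra hlR
    have := hout _ hlR i
    rw [hlam] at this
    rw [← this] at hlR
    exact hlR huR

end

/-- The Euclidean norm of a finitely supported vector. -/
noncomputable def nrm {X : Type*} [Fintype X] (a : X → ℝ) : ℝ := Real.sqrt (∑ x, a x ^ 2)

lemma nrm_nonneg {X : Type*} [Fintype X] (a : X → ℝ) : 0 ≤ nrm a := Real.sqrt_nonneg _

lemma nrm_sq {X : Type*} [Fintype X] (a : X → ℝ) : nrm a ^ 2 = ∑ x, a x ^ 2 :=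
  Real.sq_sqrt (Finset.sum_nonneg fun _ _ => sq_nonneg _)

lemma abs_bilinear_le {X Y : Type*} [Fintype X] [Fintype Y] (F : X → Y → ℝ) (a : X → ℝ)
    (b : Y → ℝ) (β : ℝ) (hβ : 0 ≤ β)
    (h : ∑ x, ∑ x', (∑ y, F x y * F x' y) ^ 2 ≤ β ^ 4) :
    |∑ x, ∑ y, a x * b y * F x y| ≤ β * nrm a * nrm b := by
  have h1 := bilinear_fourth F a b
  rw [← nrm_sq a, ← nrm_sq b] at h1
  have h0 := nrm_nonneg a
  have h0' := nrm_nonneg b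
  have h2 : |∑ x, ∑ y, a x * b y * F x y| ^ 4 ≤ (β * nrm a * nrm b) ^ 4 := by
    have e4 : |∑ x, ∑ y, a x * b y * F x y| ^ 4 = (∑ x, ∑ y, a x * b y * F x y) ^ 4 :=
      Even.pow_abs (by decide) _
    rw [e4]
    refine h1.trans ?_
    calc _ ≤ (nrm a ^ 2) ^ 2 * (nrm b ^ 2) ^ 2 * β ^ 4 :=
          mul_le_mul_of_nonneg_left h (by positivity)
      _ = _ := by ring
  exact le_of_pow_le_pow_left₀ (by norm_num) (by positivity) h2

lemma abs_linear_le {X : Type*} [Fintype X] (F a : X → ℝ) (β : ℝ) (hβ : 0 ≤ β)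
    (h : ∑ x, F x ^ 2 ≤ β ^ 2) : |∑ x, a x * F x| ≤ β * nrm a := by
  have h0 := nrm_nonneg a
  refine abs_le_of_sq_le_sq ?_ (by positivity)
  refine (Finset.sum_mul_sq_le_sq_mul_sq _ _ _).trans ?_
  rw [← nrm_sq a, mul_pow, mul_comm]
  exact mul_le_mul_of_nonneg_right h (by positivity)

section
variable {V Z U : Type*} [Fintype V] [DecidableEq V] [DecidableEq Z]
  [Fintype U] [DecidableEq U]

lemma card_colours_le (χ : V → V → Z) (k : ℕ)
    (hk : ∀ x z, #(univ.filter fun v => v ≠ x ∧ χ x v = z) ≤ k) (x : V) (P : Finset Z) :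
    #(univ.filter fun v => v ≠ x ∧ χ x v ∈ P) ≤ #P * k := by
  have : (univ.filter fun v => v ≠ x ∧ χ x v ∈ P) ⊆
      P.biUnion fun z => univ.filter fun v => v ≠ x ∧ χ x v = z := by
    intro v hv
    simp only [mem_filter, mem_univ, true_and, mem_biUnion] at hv ⊢
    exact ⟨_, hv.2, hv.1, rfl⟩
  exact (card_le_card this).trans (card_biUnion_le_card_mul _ _ _ fun z _ => hk x z)

lemma sum_sg_ite (σ : U → Bool) (u : U) (t : ℝ) :
    ∑ b, sg (σ b) * (if u = b then t else 0) = sg (σ u) * t := by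
  simp

variable [Fintype Z]

/-- Fourth moment of the colour noise. -/
lemma colour_noise (χ : V → V → Z) (k l : ℕ) (hk0 : 1 ≤ k) (hsymm : ∀ x v, χ x v = χ v x)
    (hk : ∀ x z, #(univ.filter fun v => v ≠ x ∧ χ x v = z) ≤ k) (e : V → V → ℝ)
    (he : ∀ x v, |e x v| ≤ if x = v then 0 else 1) (κ : Z → U)
    (hκ : ∀ b, #(univ.filter fun z => κ z = b) ≤ l) (d : Z → ℝ) (hd : ∀ z, |d z| ≤ 1) :
    ∑ σ : U → Bool, ∑ x, ∑ x',
      (∑ v, (e x v * (sg (σ (κ (χ x v))) * d (χ x v))) *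
        (e x' v * (sg (σ (κ (χ x' v))) * d (χ x' v)))) ^ 2 ≤
      2 ^ Fintype.card U * ((l * k) * (2 * k + k ^ 2) * (Fintype.card V : ℝ) ^ 3) := by
  set M : U → V → V → ℝ := fun b x v => if κ (χ x v) = b then e x v * d (χ x v) else 0 with hM
  set N : U → V → V → ℝ := fun b x v => if v ≠ x ∧ κ (χ x v) = b then 1 else 0 with hN
  have hF : ∀ σ x v, signedMatrix M σ x v = e x v * (sg (σ (κ (χ x v))) * d (χ x v)) := by
    intro σ x v
    rw [signedMatrix, hM, sum_sg_ite]
    ring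
  have hrow : ∀ b x, ∑ v, N b x v ≤ (l * k : ℝ) := by
    intro b x
    simp only [hN, Finset.sum_boole]
    have h1 := card_colours_le χ k hk x (univ.filter fun z => κ z = b)
    simp only [mem_filter, mem_univ, true_and] at h1
    exact_mod_cast h1.trans (Nat.mul_le_mul_right _ (hκ b))
  have hcol : ∀ b v, ∑ x, N b x v ≤ (l * k : ℝ) := by
    intro b v
    refine le_trans (le_of_eq ?_) (hrow b v)
    simp only [hN]
    refine Finset.sum_congr rfl fun x _ => if_congr ?_ rfl rfl
    rw [hsymm x v, ne_comm]
  have hNb : ∀ x v, ∑ b, N b x v ≤ 1 := by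
    intro x v
    simp only [hN, Finset.sum_boole]
    have : #(univ.filter fun b => v ≠ x ∧ κ (χ x v) = b) ≤ #({κ (χ x v)} : Finset U) := by
      refine card_le_card fun b hb => ?_
      simp only [mem_filter, mem_univ, true_and] at hb
      simp [hb.2]
    exact_mod_cast this
  have hmain := signed_fourth M N ?_ (l * k) k (Fintype.card V) (by positivity) (by positivity)
    (by positivity) hrow hcol ?_ ?_ le_rfl
  · simp only [hF] at hmain
    exact hmain
  · intro b x v
    simp only [hM, hN]
    by_cases hb : κ (χ x v) = b
    · simp only [hb, if_true, and_true]
      rw [abs_mul]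
      have h1 := he x v
      have h2 := hd (χ x v)
      by_cases hxv : x = v
      · subst hxv
        simp only [if_true] at h1
        have : |e x x| = 0 := le_antisymm h1 (abs_nonneg _)
        simp [this]
      · simp only [hxv, if_false] at h1
        rw [if_pos (Ne.symm hxv)]
        exact mul_le_one₀ h1 (abs_nonneg _) h2
    · simp [hb]
  · intro x v
    exact (hNb x v).trans (by exact_mod_cast hk0)
  · intro x
    refine (Finset.sum_le_sum fun v _ => hNb x v).trans ?_
    simp

/-- Fourth moment of the vertex noise. -/
lemma vertex_noise (χ : V → V → Z) (k l : ℕ) (hsymm : ∀ x v, χ x v = χ v x)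
    (hk0 : 1 ≤ k)
    (hk : ∀ x z, #(univ.filter fun v => v ≠ x ∧ χ x v = z) ≤ k) (e : V → V → ℝ)
    (he : ∀ x v, |e x v| ≤ if x = v then 0 else 1) (κ : V → U)
    (hκ : ∀ b, #(univ.filter fun v => κ v = b) ≤ l) (d : V → ℝ) (hd : ∀ v, |d v| ≤ 1) :
    ∑ σ : U → Bool, ∑ x, ∑ x',
      (∑ z, (∑ v, if χ x v = z then e x v * (sg (σ (κ v)) * d v) else 0) *
        (∑ v, if χ x' v = z then e x' v * (sg (σ (κ v)) * d v) else 0)) ^ 2 ≤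
      2 ^ Fintype.card U * ((l * k) * (2 * k + k ^ 2) * (Fintype.card V : ℝ) ^ 3) := by
  set M : U → V → Z → ℝ := fun b x z => ∑ v, if χ x v = z then
    (if κ v = b then e x v * d v else 0) else 0 with hM
  set N : U → V → Z → ℝ := fun b x z =>
    ∑ v, if v ≠ x ∧ χ x v = z ∧ κ v = b then 1 else 0 with hN
  have hF : ∀ σ x z, signedMatrix M σ x z =
      ∑ v, if χ x v = z then e x v * (sg (σ (κ v)) * d v) else 0 := by
    intro σ x z
    rw [signedMatrix, hM]
    simp only [Finset.mul_sum]
    rw [Finset.sum_comm]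
    refine Finset.sum_congr rfl fun v _ => ?_
    by_cases h : χ x v = z
    · simp only [h, if_true]
      rw [sum_sg_ite]
      ring
    · simp [h]
  have hNb : ∀ x z, ∑ b, N b x z ≤ (k : ℝ) := by
    intro x z
    simp only [hN]
    rw [Finset.sum_comm]
    have : ∀ v, ∑ b, (if v ≠ x ∧ χ x v = z ∧ κ v = b then (1 : ℝ) else 0) =
        if v ≠ x ∧ χ x v = z then 1 else 0 := by
      intro v
      by_cases h : v ≠ x ∧ χ x v = z
      · simp [h.1, h.2]
      · have h' : ∀ b, ¬ (v ≠ x ∧ χ x v = z ∧ κ v = b) := fun b hb => h ⟨hb.1, hb.2.1⟩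
        simp only [h, h', if_false, Finset.sum_const_zero]
    simp only [this, Finset.sum_boole]
    exact_mod_cast hk x z
  have hrow1 : ∀ b x, ∑ z, N b x z = #(univ.filter fun v => v ≠ x ∧ κ v = b) := by
    intro b x
    simp only [hN]
    rw [Finset.sum_comm, ← Finset.sum_boole]
    refine Finset.sum_congr rfl fun v _ => ?_
    by_cases h : v ≠ x ∧ κ v = b
    · simp [h.1, h.2]
    · have h' : ∀ z, ¬ (v ≠ x ∧ χ x v = z ∧ κ v = b) := fun b hb => h ⟨hb.1, hb.2.2⟩
      simp only [h, h', if_false, Finset.sum_const_zero]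
  have hrow : ∀ b x, ∑ z, N b x z ≤ (l * k : ℝ) := by
    intro b x
    rw [hrow1]
    have h1 : #(univ.filter fun v => v ≠ x ∧ κ v = b) ≤ #(univ.filter fun v => κ v = b) :=
      card_le_card fun v hv => by
        simp only [mem_filter, mem_univ, true_and] at hv ⊢
        exact hv.2
    exact_mod_cast (h1.trans (hκ b)).trans (Nat.le_mul_of_pos_right _ hk0)
  have hcol : ∀ b z, ∑ x, N b x z ≤ (l * k : ℝ) := by
    intro b z
    simp only [hN]
    rw [Finset.sum_comm]
    calc _ ≤ ∑ v, if κ v = b then (k : ℝ) else 0 := by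
          refine Finset.sum_le_sum fun v _ => ?_
          by_cases h : κ v = b
          · simp only [h, and_true, if_true, Finset.sum_boole]
            have h2 := hk v z
            have : (univ.filter fun x => v ≠ x ∧ χ x v = z) =
                univ.filter fun x => x ≠ v ∧ χ v x = z := by
              ext x
              simp only [mem_filter, mem_univ, true_and]
              rw [hsymm x v, ne_comm]
            rw [this]
            exact_mod_cast h2
          · simp [h]
      _ = #(univ.filter fun v => κ v = b) * (k : ℝ) := by
          rw [← Finset.sum_filter, Finset.sum_const, nsmul_eq_mul]
      _ ≤ _ := by
          have := hκ b
          gcongr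
  have hmain := signed_fourth M N ?_ (l * k) k (Fintype.card V) (by positivity) (by positivity)
    (by positivity) hrow hcol hNb ?_ le_rfl
  · simp only [hF] at hmain
    exact hmain
  · intro b x z
    simp only [hM, hN]
    refine (Finset.abs_sum_le_sum_abs _ _).trans (Finset.sum_le_sum fun v _ => ?_)
    by_cases hz : χ x v = z
    · by_cases hb : κ v = b
      · simp only [hz, hb, if_true, and_true]
        rw [abs_mul]
        have h1 := he x v
        have h2 := hd v
        by_cases hxv : x = v
        · subst hxv
          simp only [if_true] at h1
          have : |e x x| = 0 := le_antisymm h1 (abs_nonneg _)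
          simp [this]
        · simp only [hxv, if_false] at h1
          rw [if_pos (Ne.symm hxv)]
          exact mul_le_one₀ h1 (abs_nonneg _) h2
      · simp [hb]
    · simp [hz]
  · intro x
    rw [Finset.sum_comm]
    simp only [hrow1]
    have : ∑ b, #(univ.filter fun v => v ≠ x ∧ κ v = b) ≤ Fintype.card V := by
      calc _ ≤ ∑ b, #(univ.filter fun v => κ v = b) := Finset.sum_le_sum fun b _ =>
            card_le_card fun v hv => by
              simp only [mem_filter, mem_univ, true_and] at hv ⊢
              exact hv.2
        _ = Fintype.card V := by
          rw [← Finset.card_univ]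
          exact (Finset.card_eq_sum_card_fiberwise fun v _ => mem_univ _).symm
    exact_mod_cast this

end

section
variable {V Z U G I : Type*} [Fintype V] [DecidableEq V] [DecidableEq Z] [Fintype Z]
  [Fintype U] [DecidableEq U] [Fintype G] [Fintype I]

/-- Second moment of the degree noise. -/
lemma degree_noise (l : ℕ) (e : V → V → ℝ)
    (he : ∀ x v, |e x v| ≤ if x = v then 0 else 1) (κ : V → U)
    (hκ : ∀ b, #(univ.filter fun v => κ v = b) ≤ l) (d : V → ℝ) (hd : ∀ v, |d v| ≤ 1) :
    ∑ σ : U → Bool, ∑ x, (∑ v, e x v * (sg (σ (κ v)) * d v)) ^ 2 ≤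
      2 ^ Fintype.card U * (l * (Fintype.card V : ℝ) ^ 2) := by
  have he1 : ∀ x v, |e x v * d v| ≤ 1 := by
    intro x v
    rw [abs_mul]
    refine mul_le_one₀ ((he x v).trans ?_) (abs_nonneg _) (hd v)
    split_ifs <;> norm_num
  have hb : ∀ b x, |∑ v, if κ v = b then e x v * d v else 0| ≤
      (#(univ.filter fun v => κ v = b) : ℝ) := by
    intro b x
    refine (Finset.abs_sum_le_sum_abs _ _).trans ?_
    rw [← Finset.sum_boole]
    refine Finset.sum_le_sum fun v _ => ?_
    split_ifs
    · exact he1 x v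
    · simp
  have h := sum_signs_sq (fun (b : U) (x : V) => ∑ v, if κ v = b then e x v * d v else 0) l
    fun b x => (hb b x).trans (by exact_mod_cast hκ b)
  have hF : ∀ (σ : U → Bool) x, ∑ b, sg (σ b) * (∑ v, if κ v = b then e x v * d v else 0) =
      ∑ v, e x v * (sg (σ (κ v)) * d v) := by
    intro σ x
    simp only [Finset.mul_sum]
    rw [Finset.sum_comm]
    refine Finset.sum_congr rfl fun v _ => ?_
    rw [sum_sg_ite]
    ring
  simp only [hF] at h
  refine h.trans (mul_le_mul_of_nonneg_left (mul_le_mul_of_nonneg_left ?_ (by positivity))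
    (by positivity))
  have hx : ∀ x : V, ∑ b, |∑ v, if κ v = b then e x v * d v else 0| ≤ (Fintype.card V : ℝ) := by
    intro x
    refine (Finset.sum_le_sum fun b _ => hb b x).trans ?_
    have : ∑ b, #(univ.filter fun v => κ v = b) = Fintype.card V := by
      rw [← Finset.card_univ]
      exact (Finset.card_eq_sum_card_fiberwise fun v _ => mem_univ _).symm
    exact_mod_cast this.le
  refine (Finset.sum_le_sum fun x _ => hx x).trans (le_of_eq ?_)
  simp [sq]

/-- Signs making all the noise terms of a merging step small. -/
lemma exists_signs [Nonempty V] (χ : V → V → Z) (k l : ℕ) (hk0 : 1 ≤ k) (hl : 1 ≤ l)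
    (hsymm : ∀ x v, χ x v = χ v x)
    (hk : ∀ x z, #(univ.filter fun v => v ≠ x ∧ χ x v = z) ≤ k) (e : V → V → ℝ)
    (he : ∀ x v, |e x v| ≤ if x = v then 0 else 1) (κ : V → U) (κ' : Z → U)
    (hκ : ∀ b, #(univ.filter fun v => κ v = b) ≤ l)
    (hκ' : ∀ b, #(univ.filter fun z => κ' z = b) ≤ l)
    (d : G → V → ℝ) (d' : G → Z → ℝ) (hd : ∀ g v, |d g v| ≤ 1) (hd' : ∀ g z, |d' g z| ≤ 1)
    (c : U → I → ℝ) (hc : ∀ b i, |c b i| ≤ l) (hcs : ∑ i, ∑ b, |c b i| ≤ Fintype.card V)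
    (β : ℝ) (hβ0 : 0 ≤ β)
    (hβ4 : (3 * Fintype.card G + 1 : ℝ) * ((l * k) * (2 * k + k ^ 2) *
      (Fintype.card V : ℝ) ^ 3) ≤ β ^ 4)
    (hβ2 : (3 * Fintype.card G + 1 : ℝ) * (l * Fintype.card V) ≤ β ^ 2) :
    ∃ σ : U → Bool,
      (∀ g (a b : V → ℝ), |∑ x, ∑ v, a x * b v * (e x v * (sg (σ (κ' (χ x v))) * d' g (χ x v)))| ≤
        β * nrm a * nrm b) ∧
      (∀ g (a : V → ℝ) (b : Z → ℝ),
        |∑ x, ∑ v, a x * b (χ x v) * (e x v * (sg (σ (κ v)) * d g v))| ≤ β * nrm a * nrm b) ∧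
      (∀ g (a : V → ℝ), |∑ x, ∑ v, a x * (e x v * (sg (σ (κ v)) * d g v))| ≤
        β * Real.sqrt (Fintype.card V) * nrm a) ∧
      ∑ i, |∑ b, sg (σ b) * c b i| ≤
        Real.sqrt (Fintype.card I * ((3 * Fintype.card G + 1) * (l * Fintype.card V))) := by
  have hn : (0 : ℝ) < Fintype.card V := by exact_mod_cast Fintype.card_pos
  have hk1 : (1 : ℝ) ≤ k := by exact_mod_cast hk0
  have hl1 : (1 : ℝ) ≤ l := by exact_mod_cast hl
  set n : ℝ := (Fintype.card V : ℝ) with hndef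
  set m4 : ℝ := (l * k) * (2 * k + k ^ 2) * n ^ 3 with hm4
  have hm4pos : 0 < m4 := by positivity
  set f1 : G → (U → Bool) → ℝ := fun g σ => ∑ x, ∑ x',
      (∑ v, (e x v * (sg (σ (κ' (χ x v))) * d' g (χ x v))) *
        (e x' v * (sg (σ (κ' (χ x' v))) * d' g (χ x' v)))) ^ 2 with hf1
  set f2 : G → (U → Bool) → ℝ := fun g σ => ∑ x, ∑ x',
      (∑ z, (∑ v, if χ x v = z then e x v * (sg (σ (κ v)) * d g v) else 0) *
        (∑ v, if χ x' v = z then e x' v * (sg (σ (κ v)) * d g v) else 0)) ^ 2 with hf2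
  set f3 : G → (U → Bool) → ℝ := fun g σ => ∑ x, (∑ v, e x v * (sg (σ (κ v)) * d g v)) ^ 2
    with hf3
  set f4 : (U → Bool) → ℝ := fun σ => ∑ i, (∑ b, sg (σ b) * c b i) ^ 2 with hf4
  have hΩ : ((Fintype.card (U → Bool) : ℕ) : ℝ) = 2 ^ Fintype.card U := by simp
  have hex := exists_good_outcome (Ω := U → Bool) (J := (G ⊕ G ⊕ G) ⊕ Unit)
    (Sum.elim (Sum.elim f1 (Sum.elim f2 f3)) fun _ => f4) ?_
    (Sum.elim (Sum.elim (fun _ => m4) (Sum.elim (fun _ => m4) fun _ => l * n ^ 2))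
      fun _ => l * n) ?_ ?_
  · obtain ⟨σ, hσ⟩ := hex
    have hJ : ((Fintype.card ((G ⊕ G ⊕ G) ⊕ Unit) : ℕ) : ℝ) = 3 * Fintype.card G + 1 := by
      simp only [Fintype.card_sum, Fintype.card_unit]
      push_cast
      ring
    rw [hJ] at hσ
    refine ⟨σ, ?_, ?_, ?_, ?_⟩
    · intro g a b
      exact abs_bilinear_le (fun x v => e x v * (sg (σ (κ' (χ x v))) * d' g (χ x v))) a b β hβ0
        ((hσ (Sum.inl (Sum.inl g))).trans hβ4)
    · intro g a b
      have h := abs_bilinear_le (fun x z => ∑ v, if χ x v = z then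
        e x v * (sg (σ (κ v)) * d g v) else 0) a b β hβ0
        ((hσ (Sum.inl (Sum.inr (Sum.inl g)))).trans hβ4)
      refine le_trans (le_of_eq ?_) h
      congr 1
      refine Finset.sum_congr rfl fun x _ => ?_
      simp only [Finset.mul_sum]
      rw [Finset.sum_comm]
      refine Finset.sum_congr rfl fun v _ => ?_
      rw [Finset.sum_eq_single (χ x v)]
      · simp
      · intro z _ hz
        simp [hz.symm]
      · simp
    · intro g a
      have h := abs_linear_le (fun x => ∑ v, e x v * (sg (σ (κ v)) * d g v)) a
        (β * Real.sqrt n) (by positivity) ?_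
      · simpa only [Finset.mul_sum] using h
      · refine (hσ (Sum.inl (Sum.inr (Sum.inr g)))).trans ?_
        rw [mul_pow, Real.sq_sqrt hn.le]
        calc _ = (3 * Fintype.card G + 1 : ℝ) * (l * n) * n := by
              simp only [Sum.elim_inl, Sum.elim_inr]; ring
          _ ≤ _ := mul_le_mul_of_nonneg_right hβ2 hn.le
    · refine Real.le_sqrt_of_sq_le ?_
      refine sq_sum_le_card_mul_sum_sq.trans ?_
      rw [Finset.card_univ]
      refine mul_le_mul_of_nonneg_left ?_ (by positivity)
      simp only [sq_abs]
      exact hσ (Sum.inr ())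
  · rintro ((g | g | g) | u) σ
    · exact Finset.sum_nonneg fun _ _ => Finset.sum_nonneg fun _ _ => sq_nonneg _
    · exact Finset.sum_nonneg fun _ _ => Finset.sum_nonneg fun _ _ => sq_nonneg _
    · exact Finset.sum_nonneg fun _ _ => sq_nonneg _
    · exact Finset.sum_nonneg fun _ _ => sq_nonneg _
  · rintro ((g | g | g) | u)
    · exact hm4pos
    · exact hm4pos
    · simp only [Sum.elim_inl, Sum.elim_inr]; positivity
    · simp only [Sum.elim_inr]; positivity
  · rw [hΩ]
    rintro ((g | g | g) | u)
    · exact colour_noise χ k l hk0 hsymm hk e he κ' hκ' (d' g) (hd' g)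
    · exact vertex_noise χ k l hsymm hk0 hk e he κ hκ (d g) (hd g)
    · exact degree_noise l e he κ hκ (d g) (hd g)
    · refine (sum_signs_sq c l hc).trans ?_
      exact mul_le_mul_of_nonneg_left (mul_le_mul_of_nonneg_left hcs (by positivity))
        (by positivity)

end

/-- A family of slots; the slot `s` can serve the vertices of `dom s`, the vertex `v` via the
colour `mt s v`. -/
structure SlotSystem (V Z Sl G I : Type*) where
  dom : Sl → Finset V
  mt : Sl → V → Z
  inj : ∀ s, Set.InjOn (mt s) (dom s)
  lab : Sl → I
  grp : Sl → G

namespace SlotSystem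
variable {V Z Sl G I : Type*} (S : SlotSystem V Z Sl G I)

/-- The vertex `v` and its matched colour are given to the same slot. -/
def Good (τ : V → Sl) (τ' : Z → Sl) (v : V) : Prop :=
  v ∈ S.dom (τ v) ∧ τ' (S.mt (τ v) v) = τ v

open Classical in
/-- The involution exchanging a good vertex and its matched colour. -/
noncomputable def swap (τ : V → Sl) (τ' : Z → Sl) : V ⊕ Z → V ⊕ Z :=
  Sum.elim (fun v => if S.Good τ τ' v then Sum.inr (S.mt (τ v) v) else Sum.inl v)
    (fun z => if h : ∃ v, S.Good τ τ' v ∧ S.mt (τ v) v = z then Sum.inl h.choose else Sum.inr z)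

lemma swap_inl {τ : V → Sl} {τ' : Z → Sl} {v : V} (h : S.Good τ τ' v) :
    S.swap τ τ' (Sum.inl v) = Sum.inr (S.mt (τ v) v) := by
  simp [swap, h]

lemma swap_involutive (τ : V → Sl) (τ' : Z → Sl) (u : V ⊕ Z) :
    S.swap τ τ' (S.swap τ τ' u) = u := by
  rcases u with v | z
  · by_cases h : S.Good τ τ' v
    · rw [S.swap_inl h]
      have hex : ∃ w, S.Good τ τ' w ∧ S.mt (τ w) w = S.mt (τ v) v := ⟨v, h, rfl⟩
      have hc := hex.choose_spec
      have hτ : τ hex.choose = τ v := by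
        rw [← hc.1.2, hc.2, h.2]
      have : hex.choose = v := by
        have h1 := hc.1.1
        have h2 := hc.2
        rw [hτ] at h1 h2
        exact S.inj _ h1 h.1 h2
      simp only [swap, Sum.elim_inr]
      rw [dif_pos hex, this]
    · simp [swap, h]
  · by_cases h : ∃ v, S.Good τ τ' v ∧ S.mt (τ v) v = z
    · have hc := h.choose_spec
      have e1 : S.swap τ τ' (Sum.inr z) = Sum.inl h.choose := by
        simp only [swap, Sum.elim_inr]
        rw [dif_pos h]
      rw [e1, S.swap_inl hc.1, hc.2]
    · have e1 : S.swap τ τ' (Sum.inr z) = Sum.inr z := by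
        simp only [swap, Sum.elim_inr]
        rw [dif_neg h]
      rw [e1, e1]

lemma swap_moved (τ : V → Sl) (τ' : Z → Sl) (u : V ⊕ Z) (h : S.swap τ τ' u ≠ u) :
    ∃ v, u = Sum.inl v ∨ u = S.swap τ τ' (Sum.inl v) := by
  rcases u with v | z
  · exact ⟨v, Or.inl rfl⟩
  · by_cases hz : ∃ v, S.Good τ τ' v ∧ S.mt (τ v) v = z
    · obtain ⟨v, hv, rfl⟩ := hz
      exact ⟨v, Or.inr (S.swap_inl hv).symm⟩
    · refine absurd ?_ h
      simp only [swap, Sum.elim_inr]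
      rw [dif_neg hz]

variable [Fintype V] [DecidableEq V] [Fintype Z] [DecidableEq Z] [DecidableEq Sl]
  [DecidableEq G] [DecidableEq I] [Fintype I]

omit [DecidableEq Sl] [DecidableEq G] [DecidableEq I] [Fintype I] in
lemma card_moved (τ τ₁ : V → Sl) (τ' τ₁' : Z → Sl) :
    #(univ.filter fun u : V ⊕ Z => ∃ i : Bool,
      (if i then S.swap τ τ' else S.swap τ₁ τ₁') u ≠ u) ≤ 3 * Fintype.card V := by
  have : (univ.filter fun u : V ⊕ Z => ∃ i : Bool,
      (if i then S.swap τ τ' else S.swap τ₁ τ₁') u ≠ u) ⊆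
      univ.image Sum.inl ∪ (univ.image (fun v => S.swap τ τ' (Sum.inl v)) ∪
        univ.image fun v => S.swap τ₁ τ₁' (Sum.inl v)) := by
    intro u hu
    simp only [mem_filter, mem_univ, true_and] at hu
    obtain ⟨i, hi⟩ := hu
    simp only [mem_union, mem_image, mem_univ, true_and]
    cases i
    · obtain ⟨v, hv | hv⟩ := S.swap_moved τ₁ τ₁' u hi
      · exact Or.inl ⟨v, hv.symm⟩
      · exact Or.inr (Or.inr ⟨v, hv.symm⟩)
    · obtain ⟨v, hv | hv⟩ := S.swap_moved τ τ' u hi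
      · exact Or.inl ⟨v, hv.symm⟩
      · exact Or.inr (Or.inl ⟨v, hv.symm⟩)
  refine (card_le_card this).trans ((card_union_le _ _).trans ?_)
  have h1 : #((univ : Finset V).image (Sum.inl : V → V ⊕ Z)) ≤ #(univ : Finset V) :=
    card_image_le
  have h2 : #((univ : Finset V).image (fun v => S.swap τ τ' (Sum.inl v))) ≤
    #(univ : Finset V) := card_image_le
  have h3 : #((univ : Finset V).image (fun v => S.swap τ₁ τ₁' (Sum.inl v))) ≤
    #(univ : Finset V) := card_image_le
  have h4 := card_union_le ((univ : Finset V).image (fun v => S.swap τ τ' (Sum.inl v)))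
    (univ.image fun v => S.swap τ₁ τ₁' (Sum.inl v))
  rw [card_univ] at h1 h2 h3
  omega

open Classical in
/-- The number of good vertices with a given label. -/
noncomputable def cnt (τ : V → Sl) (τ' : Z → Sl) (i : I) : ℕ :=
  #(univ.filter fun v => S.Good τ τ' v ∧ S.lab (τ v) = i)

/-- The assignment `(τ, τ')` of vertices and colours to slots behaves like a random one: group `g`
receives a proportion `α g`, and label `i` has about `mean i` good vertices. -/
structure Balanced (χ : V → V → Z) (e : V → V → ℝ) (τ : V → Sl) (τ' : Z → Sl) (α : G → ℝ)
    (mean : I → ℝ) (β δ : ℝ) : Prop where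
  colour : ∀ g (a b : V → ℝ), |∑ x, ∑ v, a x * b v *
    (e x v * ((if S.grp (τ' (χ x v)) = g then 1 else 0) - α g))| ≤ β * nrm a * nrm b
  vertex : ∀ g (a : V → ℝ) (b : Z → ℝ), |∑ x, ∑ v, a x * b (χ x v) *
    (e x v * ((if S.grp (τ v) = g then 1 else 0) - α g))| ≤ β * nrm a * nrm b
  degree : ∀ g (a : V → ℝ), |∑ x, ∑ v, a x *
    (e x v * ((if S.grp (τ v) = g then 1 else 0) - α g))| ≤
      β * Real.sqrt (Fintype.card V) * nrm a
  deficit : ∑ i, max (mean i - S.cnt τ τ' i) 0 ≤ δ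

omit [DecidableEq Sl] [DecidableEq Z] [DecidableEq V] in
lemma balanced_const [Nonempty V] (χ : V → V → Z) (e : V → V → ℝ) (s : Sl) :
    S.Balanced χ e (fun _ => s) (fun _ => s) (fun g => if S.grp s = g then 1 else 0)
      (fun i => if S.lab s = i then (#(S.dom s) : ℝ) else 0) 0 0 := by
  refine ⟨by simp, by simp, by simp, ?_⟩
  refine Finset.sum_nonpos fun i _ => ?_
  refine max_le ?_ le_rfl
  by_cases h : S.lab s = i
  · rw [if_pos h, sub_nonpos, Nat.cast_le, cnt]
    refine card_le_card fun v hv => ?_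
    simp only [mem_filter, mem_univ, true_and]
    exact ⟨⟨hv, rfl⟩, h⟩
  · simp [h]

omit [DecidableEq V] [Fintype Z] [DecidableEq Z] [DecidableEq Sl] [DecidableEq G]
  [DecidableEq I] [Fintype I] in
lemma merged_form (F : V → V → ℝ) (φ₁ φ₂ s d φ : V → V → ℝ) (M₁ M₂ M₃ : ℝ)
    (hφ : ∀ x v, φ x v = (φ₁ x v + φ₂ x v) / 2 + s x v * d x v)
    (h₁ : |∑ x, ∑ v, F x v * φ₁ x v| ≤ M₁) (h₂ : |∑ x, ∑ v, F x v * φ₂ x v| ≤ M₂)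
    (h₃ : |∑ x, ∑ v, F x v * (s x v * d x v)| ≤ M₃) :
    |∑ x, ∑ v, F x v * φ x v| ≤ (M₁ + M₂) / 2 + M₃ := by
  have : ∑ x, ∑ v, F x v * φ x v = (∑ x, ∑ v, F x v * φ₁ x v + ∑ x, ∑ v, F x v * φ₂ x v) / 2 +
      ∑ x, ∑ v, F x v * (s x v * d x v) := by
    simp only [hφ, mul_add, Finset.sum_add_distrib, Finset.sum_div, add_div, mul_div_assoc]
  rw [this]
  rw [abs_le] at *
  constructor <;> linarith [h₁.1, h₁.2, h₂.1, h₂.2, h₃.1, h₃.2]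

end SlotSystem

namespace SlotSystem
variable {V Z Sl G I : Type*} (S : SlotSystem V Z Sl G I)
variable [Fintype V] [DecidableEq V] [Fintype Z] [DecidableEq Z]
  [DecidableEq G] [DecidableEq I] [Fintype I] [Fintype G]

open Classical in
lemma balanced_merge [Nonempty V] (χ : V → V → Z) (k l : ℕ) (hk0 : 1 ≤ k) (hl : 1 ≤ l)
    (hsymm : ∀ x v, χ x v = χ v x)
    (hk : ∀ x z, #(univ.filter fun v => v ≠ x ∧ χ x v = z) ≤ k) (e : V → V → ℝ)
    (he : ∀ x v, |e x v| ≤ if x = v then 0 else 1)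
    (β δ : ℝ) (hβ0 : 0 ≤ β)
    (hβ4 : (3 * Fintype.card G + 1 : ℝ) * ((l * k) * (2 * k + k ^ 2) *
      (Fintype.card V : ℝ) ^ 3) ≤ β ^ 4)
    (hβ2 : (3 * Fintype.card G + 1 : ℝ) * (l * Fintype.card V) ≤ β ^ 2)
    (hδ : Real.sqrt (Fintype.card I * ((3 * Fintype.card G + 1) * (l * Fintype.card V))) +
      12 * Fintype.card V / l ≤ δ)
    {τ₁ τ₂ : V → Sl} {τ₁' τ₂' : Z → Sl} {α₁ α₂ : G → ℝ} {mean₁ mean₂ : I → ℝ} {β₀ δ₀ : ℝ}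
    (h₁ : S.Balanced χ e τ₁ τ₁' α₁ mean₁ β₀ δ₀) (h₂ : S.Balanced χ e τ₂ τ₂' α₂ mean₂ β₀ δ₀) :
    ∃ τ τ', S.Balanced χ e τ τ' (fun g => (α₁ g + α₂ g) / 2) (fun i => (mean₁ i + mean₂ i) / 2)
      (β₀ + β) (δ₀ + δ) := by
  set lam : Bool → V ⊕ Z → V ⊕ Z := fun i => if i then S.swap τ₁ τ₁' else S.swap τ₂ τ₂' with hlam
  have hinv : ∀ i u, lam i (lam i u) = u := by
    intro i u
    cases i
    · exact S.swap_involutive τ₂ τ₂' u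
    · exact S.swap_involutive τ₁ τ₁' u
  obtain ⟨κ, hκ, hbr⟩ := exists_blocks lam hinv l hl
  have hbr2 := hbr.trans (Nat.mul_le_mul_left 4 (S.card_moved τ₁ τ₂ τ₁' τ₂'))
  have hκV : ∀ b, #(univ.filter fun v : V => κ (Sum.inl v) = b) ≤ l := by
    intro b
    refine le_trans ?_ (hκ b)
    rw [← card_image_of_injective _ (Sum.inl_injective (α := V) (β := Z))]
    refine card_le_card fun u hu => ?_
    simp only [mem_image, mem_filter, mem_univ, true_and] at hu ⊢
    obtain ⟨v, hv, rfl⟩ := hu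
    exact hv
  have hκZ : ∀ b, #(univ.filter fun z : Z => κ (Sum.inr z) = b) ≤ l := by
    intro b
    refine le_trans ?_ (hκ b)
    rw [← card_image_of_injective _ (Sum.inr_injective (α := V) (β := Z))]
    refine card_le_card fun u hu => ?_
    simp only [mem_image, mem_filter, mem_univ, true_and] at hu ⊢
    obtain ⟨v, hv, rfl⟩ := hu
    exact hv
  set P₁ : V → I → ℝ := fun v i => if S.Good τ₁ τ₁' v ∧ S.lab (τ₁ v) = i ∧
    κ (lam true (Sum.inl v)) = κ (Sum.inl v) then 1 else 0 with hP₁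
  set P₂ : V → I → ℝ := fun v i => if S.Good τ₂ τ₂' v ∧ S.lab (τ₂ v) = i ∧
    κ (lam false (Sum.inl v)) = κ (Sum.inl v) then 1 else 0 with hP₂
  have hP₁0 : ∀ v i, 0 ≤ P₁ v i := fun v i => by simp only [hP₁]; split_ifs <;> norm_num
  have hP₂0 : ∀ v i, 0 ≤ P₂ v i := fun v i => by simp only [hP₂]; split_ifs <;> norm_num
  have hP₁1 : ∀ v i, P₁ v i ≤ if S.lab (τ₁ v) = i then 1 else 0 := fun v i => by
    simp only [hP₁]
    by_cases h : S.lab (τ₁ v) = i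
    · simp only [h, if_true]; split_ifs <;> norm_num
    · simp [h]
  have hP₂1 : ∀ v i, P₂ v i ≤ if S.lab (τ₂ v) = i then 1 else 0 := fun v i => by
    simp only [hP₂]
    by_cases h : S.lab (τ₂ v) = i
    · simp only [h, if_true]; split_ifs <;> norm_num
    · simp [h]
  have hPabs : ∀ v i, |(P₁ v i - P₂ v i) / 2| ≤ (P₁ v i + P₂ v i) / 2 := fun v i => by
    have := hP₁0 v i
    have := hP₂0 v i
    rw [abs_le]; constructor <;> linarith
  have hle1 : ∀ v i, (P₁ v i + P₂ v i) / 2 ≤ 1 := fun v i => by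
    have h1 := hP₁1 v i
    have h2 := hP₂1 v i
    have h3 : (if S.lab (τ₁ v) = i then (1 : ℝ) else 0) ≤ 1 := by split_ifs <;> norm_num
    have h4 : (if S.lab (τ₂ v) = i then (1 : ℝ) else 0) ≤ 1 := by split_ifs <;> norm_num
    linarith
  have hPsum : ∀ v, ∑ i, (P₁ v i + P₂ v i) / 2 ≤ 1 := fun v => by
    calc _ ≤ ∑ i, ((if S.lab (τ₁ v) = i then (1 : ℝ) else 0) +
          (if S.lab (τ₂ v) = i then 1 else 0)) / 2 :=
        Finset.sum_le_sum fun i _ => by linarith [hP₁1 v i, hP₂1 v i]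
      _ = 1 := by
        rw [← Finset.sum_div, Finset.sum_add_distrib]
        simp
  set c : V ⊕ Z → I → ℝ := fun b i => ∑ v, if κ (Sum.inl v) = b then (P₁ v i - P₂ v i) / 2 else 0
    with hc
  have hcb : ∀ b i, |c b i| ≤ ∑ v, if κ (Sum.inl v) = b then (P₁ v i + P₂ v i) / 2 else 0 := by
    intro b i
    refine (Finset.abs_sum_le_sum_abs _ _).trans (Finset.sum_le_sum fun v _ => ?_)
    split_ifs
    · exact hPabs v i
    · simp
  have hdabs : ∀ (p q : Prop) [Decidable p] [Decidable q],
      |((if p then (1 : ℝ) else 0) - (if q then 1 else 0)) / 2| ≤ 1 := by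
    intro p q _ _
    rw [abs_le]
    constructor <;> split_ifs <;> norm_num
  obtain ⟨σ, hσ1, hσ2, hσ3, hσ4⟩ := exists_signs (G := G) (I := I) χ k l hk0 hl hsymm hk e he
    (fun v => κ (Sum.inl v)) (fun z => κ (Sum.inr z)) hκV hκZ
    (fun g v => ((if S.grp (τ₁ v) = g then 1 else 0) - (if S.grp (τ₂ v) = g then 1 else 0)) / 2)
    (fun g z => ((if S.grp (τ₁' z) = g then 1 else 0) - (if S.grp (τ₂' z) = g then 1 else 0)) / 2)
    (fun g v => hdabs _ _) (fun g z => hdabs _ _) c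
    (fun b i => by
      refine (hcb b i).trans ?_
      calc _ ≤ ∑ v, if κ (Sum.inl v) = b then (1 : ℝ) else 0 := by
            refine Finset.sum_le_sum fun v _ => ?_
            split_ifs
            · exact hle1 v i
            · exact le_rfl
        _ ≤ _ := by
            rw [Finset.sum_boole]
            exact_mod_cast hκV b)
    (by
      calc _ ≤ ∑ i, ∑ b, ∑ v, (if κ (Sum.inl v) = b then (P₁ v i + P₂ v i) / 2 else 0) :=
            Finset.sum_le_sum fun i _ => Finset.sum_le_sum fun b _ => hcb b i
        _ = ∑ i, ∑ v, (P₁ v i + P₂ v i) / 2 := by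
            refine Finset.sum_congr rfl fun i _ => ?_
            rw [Finset.sum_comm]
            simp
        _ = ∑ v, ∑ i, (P₁ v i + P₂ v i) / 2 := Finset.sum_comm
        _ ≤ ∑ _v : V, (1 : ℝ) := Finset.sum_le_sum fun v _ => hPsum v
        _ = _ := by simp) β hβ0 hβ4 hβ2
  have hmid : ∀ (s : Bool) (t₁ t₂ : Sl) (g : G),
      (if S.grp (if s then t₁ else t₂) = g then (1 : ℝ) else 0) - (α₁ g + α₂ g) / 2 =
      (((if S.grp t₁ = g then 1 else 0) - α₁ g) + ((if S.grp t₂ = g then 1 else 0) - α₂ g)) / 2 +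
      sg s * (((if S.grp t₁ = g then 1 else 0) - (if S.grp t₂ = g then 1 else 0)) / 2) := by
    intro s t₁ t₂ g
    cases s
    · simp only [sg, Bool.false_eq_true, if_false]; ring
    · simp only [sg, if_true]; ring
  refine ⟨fun v => if σ (κ (Sum.inl v)) then τ₁ v else τ₂ v,
    fun z => if σ (κ (Sum.inr z)) then τ₁' z else τ₂' z, ?_, ?_, ?_, ?_⟩
  · intro g a b
    have := merged_form (fun x v => a x * b v * e x v) _ _ _ _ _ _ _ _
      (fun x v => hmid (σ (κ (Sum.inr (χ x v)))) (τ₁' (χ x v)) (τ₂' (χ x v)) g)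
      (by simpa only [mul_assoc] using h₁.colour g a b)
      (by simpa only [mul_assoc] using h₂.colour g a b)
      (by simpa only [mul_assoc] using hσ1 g a b)
    simp only [mul_assoc] at this ⊢
    linarith
  · intro g a b
    have := merged_form (fun x v => a x * b (χ x v) * e x v) _ _ _ _ _ _ _ _
      (fun x v => hmid (σ (κ (Sum.inl v))) (τ₁ v) (τ₂ v) g)
      (by simpa only [mul_assoc] using h₁.vertex g a b)
      (by simpa only [mul_assoc] using h₂.vertex g a b)
      (by simpa only [mul_assoc] using hσ2 g a b)
    simp only [mul_assoc] at this ⊢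
    linarith
  · intro g a
    have := merged_form (fun x v => a x * e x v) _ _ _ _ _ _ _ _
      (fun x v => hmid (σ (κ (Sum.inl v))) (τ₁ v) (τ₂ v) g)
      (by simpa only [mul_assoc] using h₁.degree g a)
      (by simpa only [mul_assoc] using h₂.degree g a)
      (by simpa only [mul_assoc] using hσ3 g a)
    simp only [mul_assoc] at this ⊢
    linarith
  · set τ : V → Sl := fun v => if σ (κ (Sum.inl v)) then τ₁ v else τ₂ v with hτ
    set τ' : Z → Sl := fun z => if σ (κ (Sum.inr z)) then τ₁' z else τ₂' z with hτ'
    have hpt : ∀ v i, (P₁ v i + P₂ v i) / 2 + sg (σ (κ (Sum.inl v))) * ((P₁ v i - P₂ v i) / 2) ≤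
        if S.Good τ τ' v ∧ S.lab (τ v) = i then 1 else 0 := by
      intro v i
      cases hs : σ (κ (Sum.inl v))
      · have e1 : (P₁ v i + P₂ v i) / 2 + sg false * ((P₁ v i - P₂ v i) / 2) = P₂ v i := by
          simp only [sg, Bool.false_eq_true, if_false]; ring
        rw [e1]
        by_cases hp : S.Good τ₂ τ₂' v ∧ S.lab (τ₂ v) = i ∧
          κ (lam false (Sum.inl v)) = κ (Sum.inl v)
        · obtain ⟨hg, hl', hu⟩ := hp
          have hτv : τ v = τ₂ v := by simp [hτ, hs]
          have hsw : lam false (Sum.inl v) = Sum.inr (S.mt (τ₂ v) v) := S.swap_inl hg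
          rw [hsw] at hu
          have hgood : S.Good τ τ' v := by
            refine ⟨by rw [hτv]; exact hg.1, ?_⟩
            rw [hτv]
            simp only [hτ', hu, hs, Bool.false_eq_true, if_false]
            exact hg.2
          rw [if_pos ⟨hgood, by rw [hτv]; exact hl'⟩]
          exact (hP₂1 v i).trans (by split_ifs; norm_num)
        · simp only [hP₂, hp, if_false]
          split_ifs <;> norm_num
      · have e1 : (P₁ v i + P₂ v i) / 2 + sg true * ((P₁ v i - P₂ v i) / 2) = P₁ v i := by
          simp only [sg, if_true]; ring
        rw [e1]
        by_cases hp : S.Good τ₁ τ₁' v ∧ S.lab (τ₁ v) = i ∧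
          κ (lam true (Sum.inl v)) = κ (Sum.inl v)
        · obtain ⟨hg, hl', hu⟩ := hp
          have hτv : τ v = τ₁ v := by simp [hτ, hs]
          have hsw : lam true (Sum.inl v) = Sum.inr (S.mt (τ₁ v) v) := S.swap_inl hg
          rw [hsw] at hu
          have hgood : S.Good τ τ' v := by
            refine ⟨by rw [hτv]; exact hg.1, ?_⟩
            rw [hτv]
            simp only [hτ', hu, hs, if_true]
            exact hg.2
          rw [if_pos ⟨hgood, by rw [hτv]; exact hl'⟩]
          exact (hP₁1 v i).trans (by split_ifs; norm_num)
        · simp only [hP₁, hp, if_false]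
          split_ifs <;> norm_num
    have hnoise : ∀ i, ∑ b, sg (σ b) * c b i =
        ∑ v, sg (σ (κ (Sum.inl v))) * ((P₁ v i - P₂ v i) / 2) := by
      intro i
      simp only [hc, Finset.mul_sum]
      rw [Finset.sum_comm]
      exact Finset.sum_congr rfl fun v _ => sum_sg_ite _ _ _
    have hcnt : ∀ i, (∑ v, P₁ v i + ∑ v, P₂ v i) / 2 + ∑ b, sg (σ b) * c b i ≤ S.cnt τ τ' i := by
      intro i
      rw [hnoise, cnt, ← Finset.sum_boole, ← Finset.sum_add_distrib, Finset.sum_div,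
        ← Finset.sum_add_distrib]
      exact Finset.sum_le_sum fun v _ => hpt v i
    set D₁ : V → I → ℝ := fun v i => if S.lab (τ₁ v) = i then
      (if κ (lam true (Sum.inl v)) ≠ κ (Sum.inl v) then 1 else 0) else 0 with hD₁
    set D₂ : V → I → ℝ := fun v i => if S.lab (τ₂ v) = i then
      (if κ (lam false (Sum.inl v)) ≠ κ (Sum.inl v) then 1 else 0) else 0 with hD₂
    have hc1 : ∀ i, (S.cnt τ₁ τ₁' i : ℝ) ≤ ∑ v, P₁ v i + ∑ v, D₁ v i := by
      intro i
      rw [cnt, ← Finset.sum_boole, ← Finset.sum_add_distrib]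
      refine Finset.sum_le_sum fun v _ => ?_
      simp only [hP₁, hD₁]
      by_cases h1 : S.lab (τ₁ v) = i <;> by_cases h2 : S.Good τ₁ τ₁' v <;>
        by_cases h3 : κ (lam true (Sum.inl v)) = κ (Sum.inl v) <;> simp [h1, h2, h3]
    have hc2 : ∀ i, (S.cnt τ₂ τ₂' i : ℝ) ≤ ∑ v, P₂ v i + ∑ v, D₂ v i := by
      intro i
      rw [cnt, ← Finset.sum_boole, ← Finset.sum_add_distrib]
      refine Finset.sum_le_sum fun v _ => ?_
      simp only [hP₂, hD₂]
      by_cases h1 : S.lab (τ₂ v) = i <;> by_cases h2 : S.Good τ₂ τ₂' v <;>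
        by_cases h3 : κ (lam false (Sum.inl v)) = κ (Sum.inl v) <;> simp [h1, h2, h3]
    have hbroken : (∑ i, ∑ v, D₁ v i) + (∑ i, ∑ v, D₂ v i) ≤ 12 * Fintype.card V / l := by
      have hl0 : (0 : ℝ) < l := by exact_mod_cast hl
      rw [le_div_iff₀ hl0]
      have e1 : ∑ i, ∑ v, D₁ v i =
          #(univ.filter fun v : V => κ (lam true (Sum.inl v)) ≠ κ (Sum.inl v)) := by
        rw [Finset.sum_comm, ← Finset.sum_boole]
        refine Finset.sum_congr rfl fun v _ => ?_
        simp [hD₁]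
      have e2 : ∑ i, ∑ v, D₂ v i =
          #(univ.filter fun v : V => κ (lam false (Sum.inl v)) ≠ κ (Sum.inl v)) := by
        rw [Finset.sum_comm, ← Finset.sum_boole]
        refine Finset.sum_congr rfl fun v _ => ?_
        simp [hD₂]
      rw [e1, e2]
      have hle : #(univ.filter fun v : V => κ (lam true (Sum.inl v)) ≠ κ (Sum.inl v)) +
          #(univ.filter fun v : V => κ (lam false (Sum.inl v)) ≠ κ (Sum.inl v)) ≤
          #(univ.filter fun p : (V ⊕ Z) × Bool => κ (lam p.2 p.1) ≠ κ p.1) := by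
        rw [← card_image_of_injective (f := fun v : V => ((Sum.inl v : V ⊕ Z), true)) _
            (fun a b h => by simpa using h),
          ← card_image_of_injective (f := fun v : V => ((Sum.inl v : V ⊕ Z), false)) (univ.filter
            fun v : V => κ (lam false (Sum.inl v)) ≠ κ (Sum.inl v)) (fun a b h => by simpa using h),
          ← card_union_of_disjoint]
        · refine card_le_card fun p hp => ?_
          simp only [mem_union, mem_image, mem_filter, mem_univ, true_and] at hp ⊢
          rcases hp with ⟨v, hv, rfl⟩ | ⟨v, hv, rfl⟩
          · exact hv
          · exact hv
        · rw [Finset.disjoint_left]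
          intro p hp hq
          simp only [mem_image] at hp hq
          obtain ⟨v, _, rfl⟩ := hp
          obtain ⟨w, _, hw⟩ := hq
          simp at hw
      have h3 := (Nat.mul_le_mul_left l hle).trans hbr2
      have h4 : (l : ℝ) * (#(univ.filter fun v : V => κ (lam true (Sum.inl v)) ≠ κ (Sum.inl v)) +
          #(univ.filter fun v : V => κ (lam false (Sum.inl v)) ≠ κ (Sum.inl v))) ≤
          4 * (3 * Fintype.card V) := by exact_mod_cast h3
      linarith
    have hfin : ∀ i, max ((mean₁ i + mean₂ i) / 2 - S.cnt τ τ' i) 0 ≤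
        (max (mean₁ i - S.cnt τ₁ τ₁' i) 0 + max (mean₂ i - S.cnt τ₂ τ₂' i) 0) / 2 +
        (∑ v, D₁ v i + ∑ v, D₂ v i) / 2 + |∑ b, sg (σ b) * c b i| := by
      intro i
      have a1 := le_max_left (mean₁ i - S.cnt τ₁ τ₁' i) 0
      have a2 := le_max_left (mean₂ i - S.cnt τ₂ τ₂' i) 0
      have a3 := le_max_right (mean₁ i - S.cnt τ₁ τ₁' i) 0
      have a4 := le_max_right (mean₂ i - S.cnt τ₂ τ₂' i) 0
      have a5 : 0 ≤ ∑ v, D₁ v i := Finset.sum_nonneg fun v _ => by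
        simp only [hD₁]; split_ifs <;> norm_num
      have a6 : 0 ≤ ∑ v, D₂ v i := Finset.sum_nonneg fun v _ => by
        simp only [hD₂]; split_ifs <;> norm_num
      have a7 := neg_abs_le (∑ b, sg (σ b) * c b i)
      have a8 := abs_nonneg (∑ b, sg (σ b) * c b i)
      refine max_le ?_ ?_
      · linarith [hcnt i, hc1 i, hc2 i]
      · linarith
    refine (Finset.sum_le_sum fun i _ => hfin i).trans ?_
    simp only [Finset.sum_add_distrib, ← Finset.sum_div]
    have b1 := h₁.deficit
    have b2 := h₂.deficit
    have b3 : 0 ≤ 12 * (Fintype.card V : ℝ) / l := by positivity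
    linarith

end SlotSystem

namespace SlotSystem
variable {V Z Sl G I : Type*} (S : SlotSystem V Z Sl G I)
variable [Fintype V] [DecidableEq V] [Fintype Z] [DecidableEq Z]
  [DecidableEq G] [DecidableEq I] [Fintype I] [Fintype G]

/-- Any list of `2 ^ h` slots has a balanced assignment. -/
lemma exists_balanced [Nonempty V] (χ : V → V → Z) (k l : ℕ) (hk0 : 1 ≤ k) (hl : 1 ≤ l)
    (hsymm : ∀ x v, χ x v = χ v x)
    (hk : ∀ x z, #(univ.filter fun v => v ≠ x ∧ χ x v = z) ≤ k) (e : V → V → ℝ)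
    (he : ∀ x v, |e x v| ≤ if x = v then 0 else 1)
    (β δ : ℝ) (hβ0 : 0 ≤ β)
    (hβ4 : (3 * Fintype.card G + 1 : ℝ) * ((l * k) * (2 * k + k ^ 2) *
      (Fintype.card V : ℝ) ^ 3) ≤ β ^ 4)
    (hβ2 : (3 * Fintype.card G + 1 : ℝ) * (l * Fintype.card V) ≤ β ^ 2)
    (hδ : Real.sqrt (Fintype.card I * ((3 * Fintype.card G + 1) * (l * Fintype.card V))) +
      12 * Fintype.card V / l ≤ δ) (h : ℕ) (L : List Sl) (hL : L.length = 2 ^ h) :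
    ∃ τ τ', S.Balanced χ e τ τ'
      (fun g => (L.map fun s => if S.grp s = g then (1 : ℝ) else 0).sum / 2 ^ h)
      (fun i => (L.map fun s => if S.lab s = i then (#(S.dom s) : ℝ) else 0).sum / 2 ^ h)
      (h * β) (h * δ) := by
  induction h generalizing L with
  | zero =>
    obtain ⟨s, rfl⟩ := List.length_eq_one_iff.1 (by simpa using hL)
    refine ⟨fun _ => s, fun _ => s, ?_⟩
    simpa using S.balanced_const χ e s
  | succ h ih =>
    have h1 : (L.take (2 ^ h)).length = 2 ^ h := by
      rw [List.length_take, hL, pow_succ]; omega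
    have h2 : (L.drop (2 ^ h)).length = 2 ^ h := by
      rw [List.length_drop, hL, pow_succ]; omega
    obtain ⟨τ₁, τ₁', hb1⟩ := ih _ h1
    obtain ⟨τ₂, τ₂', hb2⟩ := ih _ h2
    obtain ⟨τ, τ', hb⟩ := S.balanced_merge χ k l hk0 hl hsymm hk e he β δ hβ0 hβ4 hβ2 hδ hb1 hb2
    refine ⟨τ, τ', ?_⟩
    have key : ∀ f : Sl → ℝ, (L.map f).sum / 2 ^ (h + 1) =
        (((L.take (2 ^ h)).map f).sum / 2 ^ h + ((L.drop (2 ^ h)).map f).sum / 2 ^ h) / 2 := by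
      intro f
      conv_lhs => rw [← List.take_append_drop (2 ^ h) L]
      rw [List.map_append, List.sum_append, pow_succ]
      field_simp
    simp only [key]
    push_cast
    rw [add_mul, add_mul, one_mul, one_mul]
    exact hb

end SlotSystem

/-- A finite tree has a root and a parent function through which every edge passes. -/
lemma exists_rooted {α : Type*} [Fintype α] [DecidableEq α] (T : SimpleGraph α) (hT : T.IsTree) :
    ∃ (root : α) (par : α → α) (dep : α → ℕ), par root = root ∧ dep root = 0 ∧
      (∀ v, v ≠ root → dep (par v) + 1 = dep v) ∧
      (∀ u v, T.Adj u v → (u ≠ root ∧ par u = v) ∨ (v ≠ root ∧ par v = u)) := by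
  classical
  obtain ⟨root⟩ := hT.connected.nonempty
  have hstep : ∀ v, v ≠ root → ∃ u, T.Adj v u ∧ T.dist root u + 1 = T.dist root v := by
    intro v hv
    obtain ⟨p, hp⟩ := hT.connected.exists_walk_length_eq_dist v root
    cases p with
    | nil => exact absurd rfl hv
    | @cons _ u _ h q =>
      refine ⟨u, h, ?_⟩
      have h1 : T.dist u root ≤ q.length := SimpleGraph.dist_le q
      rw [SimpleGraph.Walk.length_cons] at hp
      rw [T.dist_comm (u := root) (v := u), T.dist_comm (u := root) (v := v)]
      rcases hT.dist_eq_dist_add_one_of_adj root h with h2 | h2 <;>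
        rw [T.dist_comm (u := root) (v := u), T.dist_comm (u := root) (v := v)] at h2 <;> omega
  choose! p hp1 hp2 using hstep
  let par : α → α := fun v => if v = root then root else p v
  have hpar : ∀ v, v ≠ root → par v = p v := fun v hv => by simp [par, hv]
  refine ⟨root, par, T.dist root, by simp [par], by simp, ?_, ?_⟩
  · intro v hv
    rw [hpar v hv, hp2 v hv]
  · have hsub : (univ.erase root).image (fun v => s(v, p v)) ⊆ T.edgeFinset := by
      intro e he
      simp only [mem_image, mem_erase, mem_univ, and_true] at he
      obtain ⟨v, hv, rfl⟩ := he
      simpa using hp1 v hv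
    have hinj : Set.InjOn (fun v => s(v, p v)) ((univ.erase root : Finset α) : Set α) := by
      intro u hu v hv huv
      have hu' : u ≠ root := by simpa using hu
      have hv' : v ≠ root := by simpa using hv
      have h1 := hp2 u hu'
      have h2 := hp2 v hv'
      simp only [Sym2.eq_iff] at huv
      rcases huv with h | h
      · exact h.1
      · have h3 : T.dist root u = T.dist root (p v) := by rw [h.1]
        have h4 : T.dist root (p u) = T.dist root v := by rw [h.2]
        omega
    have hcard : #((univ.erase root).image (fun v => s(v, p v))) = #T.edgeFinset := by
      rw [card_image_of_injOn hinj, card_erase_of_mem (mem_univ _), card_univ]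
      have := hT.card_edgeFinset
      omega
    have heq := eq_of_subset_of_card_le hsub hcard.ge
    intro u v huv
    have hmem : s(u, v) ∈ T.edgeFinset := by simpa using huv
    rw [← heq] at hmem
    simp only [mem_image, mem_erase, mem_univ, and_true, Sym2.eq_iff] at hmem
    obtain ⟨w, hw, h | h⟩ := hmem
    · left
      obtain ⟨rfl, rfl⟩ := h
      exact ⟨hw, hpar w hw⟩
    · right
      obtain ⟨rfl, rfl⟩ := h
      exact ⟨hw, hpar w hw⟩

/-- An order of embedding for a rooted tree: the vertices of `K` come first (stage `0`), the
connecting pairs `b, par b` with `b ∈ Bs` form stage `L + 1`, and every other vertex comes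
strictly after its parent and strictly before its children. -/
structure Staging {α : Type*} (root : α) (par : α → α) (L : ℕ) (K Bs : Finset α) (ch : α → α)
    (st : α → ℕ) : Prop where
  root_mem : root ∈ K
  stage_zero : ∀ v, st v = 0 ↔ v ∈ K
  stage_link : ∀ v, st v = L + 1 ↔ v ∈ Bs ∨ ∃ b ∈ Bs, par b = v
  stage_le : ∀ v, st v ≤ 2 * L
  link : ∀ b ∈ Bs, par b ∉ Bs ∧ ch b ∈ K ∧ ch b ≠ root ∧ par (ch b) = b ∧ st (par (par b)) ≤ L
  link_inj : Set.InjOn par Bs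
  link_top : ∀ b ∈ Bs, ∀ v, v ≠ root → par v = par b → v ≠ b → L + 1 < st v
  link_bot : ∀ b ∈ Bs, ∀ v, v ≠ root → par v = b → v ≠ ch b → L + 1 < st v
  parent : ∀ v, st v ≠ 0 → st v ≠ L + 1 → st (par v) < st v
  child : ∀ v, st v ≠ 0 → st v ≠ L + 1 → ∀ c, c ≠ root → par c = v → st v < st c

section

variable {α : Type*} [DecidableEq α]

/-- Recursive stage function with fuel `n`. -/
def stageAux (par : α → α) (L : ℕ) (K C : Finset α) : ℕ → α → ℕ
  | 0, _ => 0
  | n + 1, v => if v ∈ K then 0 else if v ∈ C then L + 1 else stageAux par L K C n (par v) + 1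

end

section

variable {α : Type*} [Fintype α] [DecidableEq α]

omit [DecidableEq α] in
/-- The residue class of levels modulo `L` of least size. -/
lemma exists_sparse_levels (dep : α → ℕ) (L : ℕ) (hL : 1 ≤ L) :
    ∃ c, L * #(univ.filter fun v => (dep v + c) % L = 0) ≤ Fintype.card α := by
  by_contra! hcon
  have h1 : ∑ c ∈ range L, #(univ.filter fun v => (dep v + c) % L = 0) ≤ Fintype.card α := by
    simp_rw [card_filter]
    rw [sum_comm]
    have : ∀ v : α, ∑ c ∈ range L, (if (dep v + c) % L = 0 then 1 else 0) ≤ 1 := by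
      intro v
      rw [← card_filter, card_le_one]
      intro a ha b hb
      simp only [mem_filter, mem_range] at ha hb
      have h1 : dep v + a ≡ dep v + b [MOD L] := by
        rw [Nat.ModEq, ha.2, hb.2]
      have h2 := Nat.ModEq.add_left_cancel' _ h1
      exact h2.eq_of_lt_of_lt ha.1 hb.1
    calc _ ≤ ∑ v : α, 1 := sum_le_sum fun v _ => this v
      _ = Fintype.card α := by simp
  have h2 : ∑ c ∈ range L, Fintype.card α <
      ∑ c ∈ range L, L * #(univ.filter fun v => (dep v + c) % L = 0) :=
    sum_lt_sum_of_nonempty (nonempty_range_iff.2 (by omega)) fun c _ => hcon c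
  rw [sum_const, card_range, smul_eq_mul, ← mul_sum] at h2
  exact absurd (Nat.mul_le_mul_left L h1) (not_le.2 h2)

open Classical in
/-- Every rooted tree has a staging with few first vertices and few connecting pairs. -/
lemma exists_staging (root : α) (par : α → α) (dep : α → ℕ) (hroot : par root = root)
    (hdep0 : dep root = 0) (hdep : ∀ v, v ≠ root → dep (par v) + 1 = dep v) (L : ℕ) (hL : 1 ≤ L)
    (Big : Finset α) :
    ∃ (K Bs : Finset α) (ch : α → α) (st : α → ℕ), Staging root par L K Bs ch st ∧ Big ⊆ K ∧
      L * #K ≤ 4 * (Fintype.card α + L * #Big + L) ∧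
      L * #Bs ≤ 4 * (Fintype.card α + L * #Big + L) := by
  obtain ⟨c, hc⟩ := exists_sparse_levels dep L hL
  set Lev := univ.filter fun v => (dep v + c) % L = 0 with hLev
  let J : Finset α := insert root (Lev ∪ Big)
  have hJcard : L * #J ≤ Fintype.card α + L * #Big + L := by
    have h1 : #J ≤ #Lev + #Big + 1 :=
      (card_insert_le _ _).trans (Nat.add_le_add_right (card_union_le _ _) 1)
    calc L * #J ≤ L * (#Lev + #Big + 1) := Nat.mul_le_mul_left _ h1
      _ = L * #Lev + L * #Big + L := by ring
      _ ≤ _ := by omega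
  let w : α → Prop := fun u => ∃ j ∈ J, ∃ i, par^[i] j = u
  have hrootJ : root ∈ J := mem_insert_self _ _
  have hwJ : ∀ j ∈ J, w j := fun j hj => ⟨j, hj, 0, rfl⟩
  have hwpar : ∀ u, w u → w (par u) := by
    rintro u ⟨j, hj, i, rfl⟩
    exact ⟨j, hj, i + 1, by rw [Function.iterate_succ_apply']⟩
  let WC : α → Finset α := fun u => univ.filter fun v => v ≠ root ∧ par v = u ∧ w v
  have hWC : ∀ u v, v ∈ WC u ↔ v ≠ root ∧ par v = u ∧ w v := fun u v => by simp [WC]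
  have hchild : ∀ u, w u → u ∉ J → (WC u).Nonempty := by
    rintro u ⟨j, hj, i, hi⟩ hu
    cases i with
    | zero => exact absurd (hi ▸ hj) hu
    | succ i =>
      rw [Function.iterate_succ_apply'] at hi
      refine ⟨par^[i] j, (hWC _ _).2 ⟨?_, hi, j, hj, i, rfl⟩⟩
      intro h
      rw [h, hroot] at hi
      exact hu (hi ▸ hrootJ)
  let Br : Finset α := univ.filter fun u => w u ∧ 2 ≤ #(WC u)
  have hBr : #Br ≤ #J := by
    let W : Finset α := univ.filter w
    have h1 : ∑ u ∈ W, #(WC u) ≤ #W := by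
      rw [← card_biUnion]
      · apply card_le_card
        intro v hv
        simp only [mem_biUnion] at hv
        obtain ⟨u, -, hv⟩ := hv
        simpa [W] using ((hWC _ _).1 hv).2.2
      · intro u _ u' _ huu
        rw [Function.onFun, disjoint_left]
        intro v hv hv'
        exact huu (((hWC _ _).1 hv).2.1.symm.trans ((hWC _ _).1 hv').2.1)
    have h2 : ∑ u ∈ W, (1 + if u ∈ Br then 1 else 0) ≤
        ∑ u ∈ W, (#(WC u) + if u ∈ J then 1 else 0) := by
      refine sum_le_sum fun u hu => ?_
      have hwu : w u := by simpa [W] using hu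
      by_cases hB : u ∈ Br
      · have : 2 ≤ #(WC u) := by
          have := hB
          simp only [Br, mem_filter] at this
          exact this.2.2
        simp only [hB, if_true]
        omega
      · simp only [hB, if_false]
        by_cases hJ : u ∈ J
        · simp [hJ]
        · have := (hchild u hwu hJ).card_pos
          simp only [hJ, if_false]
          omega
    rw [sum_add_distrib, sum_add_distrib, sum_const, smul_eq_mul, mul_one] at h2
    have h3 : ∑ u ∈ W, (if u ∈ Br then 1 else 0) = #Br := by
      rw [← card_filter]
      congr 1
      ext u
      simp only [W, Br, mem_filter, mem_univ, true_and]
      tauto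
    have h4 : ∑ u ∈ W, (if u ∈ J then 1 else 0) ≤ #J := by
      rw [← card_filter]
      exact card_le_card fun u hu => (mem_filter.1 hu).2
    omega
  let Js : Finset α := J ∪ Br
  have hJs : #Js ≤ 2 * #J := (card_union_le _ _).trans (by omega)
  have hwJs : ∀ u ∈ Js, w u := by
    intro u hu
    rcases mem_union.1 hu with h | h
    · exact hwJ u h
    · exact (mem_filter.1 h).2.1
  have huniq : ∀ u, u ∉ Js → ∀ v v', v ∈ WC u → v' ∈ WC u → v = v' := by
    intro u hu v v' hv hv'
    by_contra hne
    have hwu : w u := by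
      have := ((hWC _ _).1 hv)
      rw [← this.2.1]
      exact hwpar _ this.2.2
    refine hu (mem_union_right _ (mem_filter.2 ⟨mem_univ _, hwu, ?_⟩))
    exact one_lt_card.2 ⟨v, hv, v', hv', hne⟩
  have hex : ∀ u, ∃ v, w u → u ∉ Js → v ∈ WC u := by
    intro u
    by_cases h : w u ∧ u ∉ Js
    · obtain ⟨v, hv⟩ := hchild u h.1 (fun h' => h.2 (mem_union_left _ h'))
      exact ⟨v, fun _ _ => hv⟩
    · exact ⟨u, fun h1 h2 => absurd ⟨h1, h2⟩ h⟩
  choose ch hch using hex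
  let Sh : Finset α := univ.filter fun u => w u ∧ u ∉ Js ∧ par u ∈ Js ∧ ch u ∈ Js
  have hSh : ∀ u, u ∈ Sh ↔ w u ∧ u ∉ Js ∧ par u ∈ Js ∧ ch u ∈ Js := fun u => by simp [Sh]
  have hShc : #Sh ≤ #Js := by
    refine card_le_card_of_injOn ch (fun u hu => ((hSh u).1 hu).2.2.2) ?_
    intro u hu v hv huv
    have hu := (hSh u).1 hu
    have hv := (hSh v).1 hv
    have h1 := ((hWC _ _).1 (hch u hu.1 hu.2.1)).2.1
    have h2 := ((hWC _ _).1 (hch v hv.1 hv.2.1)).2.1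
    rw [← h1, ← h2, huv]
  let K : Finset α := Js ∪ Sh
  have hKc : #K ≤ 4 * #J := (card_union_le _ _).trans (by omega)
  have hwK : ∀ u ∈ K, w u := by
    intro u hu
    rcases mem_union.1 hu with h | h
    · exact hwJs u h
    · exact ((hSh u).1 h).1
  have hKJs : ∀ u, u ∉ K → u ∉ Js := fun u hu h => hu (mem_union_left _ h)
  let Bs : Finset α := univ.filter fun u => w u ∧ u ∉ K ∧ ch u ∈ Js
  have hBs : ∀ u, u ∈ Bs ↔ w u ∧ u ∉ K ∧ ch u ∈ Js := fun u => by simp [Bs]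
  have hrootK : root ∈ K := mem_union_left _ (mem_union_left _ hrootJ)
  have hchp : ∀ u, w u → u ∉ K → ch u ≠ root ∧ par (ch u) = u ∧ w (ch u) :=
    fun u h1 h2 => (hWC _ _).1 (hch u h1 (hKJs u h2))
  have hBsc : #Bs ≤ #Js := by
    refine card_le_card_of_injOn ch (fun u hu => ((hBs u).1 hu).2.2) ?_
    intro u hu v hv huv
    have hu := (hBs u).1 hu
    have hv := (hBs v).1 hv
    rw [← (hchp u hu.1 hu.2.1).2.1, ← (hchp v hv.1 hv.2.1).2.1, huv]
  have hchu : ∀ u, u ∉ K → ∀ v, v ≠ root → par v = u → w v → v = ch u := by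
    intro u hu v hv hvu hwv
    have hwu : w u := hvu ▸ hwpar v hwv
    exact huniq u (hKJs u hu) _ _ ((hWC _ _).2 ⟨hv, hvu, hwv⟩) (hch u hwu (hKJs u hu))
  have hnr : ∀ u, u ∉ K → u ≠ root := fun u hu h => hu (h ▸ hrootK)
  -- a child in `K` of a vertex outside `K` makes it a member of `Bs`
  have hparK : ∀ v ∈ K, par v ∉ K → par v ∈ Bs := by
    intro v hv hp
    have hvr : v ≠ root := by
      rintro rfl
      exact hp (hroot.symm ▸ hrootK)
    have hvc := hchu (par v) hp v hvr rfl (hwK v hv)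
    refine (hBs _).2 ⟨hwpar v (hwK v hv), hp, ?_⟩
    rw [← hvc]
    rcases mem_union.1 hv with h | h
    · exact h
    · exact absurd ((hSh v).1 h).2.2.1 (hKJs _ hp)
  -- the upper vertices of the pairs
  have htop : ∀ b ∈ Bs, par b ∉ K ∧ w (par b) ∧ ch (par b) = b ∧ par b ∉ Bs := by
    intro b hb
    have hb' := (hBs b).1 hb
    have h1 : par b ∉ Js := by
      intro h
      exact hb'.2.1 (mem_union_right _ ((hSh b).2 ⟨hb'.1, hKJs b hb'.2.1, h, hb'.2.2⟩))
    have hwp := hwpar b hb'.1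
    have h2 : ch (par b) = b := huniq _ h1 _ _ (hch _ hwp h1)
      ((hWC _ _).2 ⟨hnr b hb'.2.1, rfl, hb'.1⟩)
    have h3 : par b ∉ K := by
      intro h
      rcases mem_union.1 h with h | h
      · exact h1 h
      · have := ((hSh _).1 h).2.2.2
        rw [h2] at this
        exact hKJs b hb'.2.1 this
    refine ⟨h3, hwp, h2, fun h => ?_⟩
    have := ((hBs _).1 h).2.2
    rw [h2] at this
    exact hKJs b hb'.2.1 this
  let C : Finset α := Bs ∪ Bs.image par
  have hC : ∀ u, u ∈ C ↔ u ∈ Bs ∨ ∃ b ∈ Bs, par b = u := fun u => by simp [C]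
  have hCK : ∀ u ∈ C, u ∉ K := by
    intro u hu
    rcases (hC u).1 hu with h | ⟨b, hb, rfl⟩
    · exact ((hBs u).1 h).2.1
    · exact (htop b hb).1
  have hCw : ∀ u ∈ C, w u := by
    intro u hu
    rcases (hC u).1 hu with h | ⟨b, hb, rfl⟩
    · exact ((hBs u).1 h).1
    · exact (htop b hb).2.1
  -- a `w`-child of a vertex of `C` lies in `C` or `K`
  have hCch : ∀ v, v ≠ root → w v → par v ∈ C → v ∈ C ∨ v ∈ K := by
    intro v hv hwv hp
    have h1 := hchu _ (hCK _ hp) v hv rfl hwv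
    rcases (hC _).1 hp with h | ⟨b, hb, hbv⟩
    · right
      rw [h1]
      exact mem_union_left _ ((hBs _).1 h).2.2
    · left
      rw [← hbv, (htop b hb).2.2.1] at h1
      rw [h1]
      exact (hC b).2 (Or.inl hb)
  let st : α → ℕ := fun v => stageAux par L K C (dep v) v
  have hst : ∀ v, st v = if v ∈ K then 0 else if v ∈ C then L + 1 else st (par v) + 1 := by
    intro v
    by_cases hv : v = root
    · subst hv
      simp [st, hdep0, stageAux, hrootK]
    · simp only [st]
      rw [← hdep v hv, stageAux]
  have hstK : ∀ v ∈ K, st v = 0 := fun v hv => by rw [hst, if_pos hv]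
  have hstC : ∀ v ∈ C, st v = L + 1 := fun v hv => by rw [hst, if_neg (hCK v hv), if_pos hv]
  have hsto : ∀ v, v ∉ K → v ∉ C → st v = st (par v) + 1 := fun v h1 h2 => by
    rw [hst, if_neg h1, if_neg h2]
  let φ : α → ℕ := fun v => (dep v + c) % L
  have hφL : ∀ v, φ v < L := fun v => Nat.mod_lt _ (by omega)
  have hφ0 : ∀ v, v ∉ K → φ v ≠ 0 := by
    intro v hv h
    exact hv (mem_union_left _ (mem_union_left _ (mem_insert_of_mem (mem_union_left _
      (by simpa [Lev] using h)))))
  have hφs : ∀ v, v ∉ K → φ v = φ (par v) + 1 := by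
    intro v hv
    have h1 := hφ0 v hv
    have h2 := hdep v (hnr v hv)
    simp only [φ] at h1 ⊢
    rw [← h2] at h1 ⊢
    have h3 : dep (par v) + 1 + c = (dep (par v) + c) + 1 := by ring
    rw [h3] at h1 ⊢
    rw [Nat.add_mod] at h1 ⊢
    rcases Nat.lt_or_ge ((dep (par v) + c) % L + 1) L with h4 | h4
    · by_cases hL1 : L = 1
      · subst hL1
        simp [Nat.mod_one] at h1
      · have h1L : 1 % L = 1 := Nat.mod_eq_of_lt (by omega)
        rw [h1L, Nat.mod_eq_of_lt h4]
    · exfalso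
      apply h1
      by_cases hL1 : L = 1
      · subst hL1
        simp [Nat.mod_one]
      · have h1L : 1 % L = 1 := Nat.mod_eq_of_lt (by omega)
        have h5 : (dep (par v) + c) % L < L := Nat.mod_lt _ (by omega)
        rw [h1L, show (dep (par v) + c) % L + 1 = L by omega, Nat.mod_self]
  have key : ∀ n v, dep v = n → (v ∉ C → st v ≤ φ v ∨ (L + 2 ≤ st v ∧ ¬ w v)) ∧
      st v ≤ L + φ v := by
    intro n
    induction n with
    | zero =>
      intro v hv
      have hvr : v = root := by
        by_contra h
        have := hdep v h
        omega
      subst hvr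
      rw [hstK _ hrootK]
      omega
    | succ n ih =>
      intro v hv
      by_cases hvK : v ∈ K
      · rw [hstK v hvK]
        omega
      by_cases hvC : v ∈ C
      · have := hφ0 v hvK
        rw [hstC v hvC]
        exact ⟨fun h => absurd hvC h, by omega⟩
      have hvr := hnr v hvK
      have hd := hdep v hvr
      obtain ⟨h1, h2⟩ := ih (par v) (by omega)
      have h3 := hφs v hvK
      have h4 := hsto v hvK hvC
      refine ⟨fun _ => ?_, by omega⟩
      by_cases hpC : par v ∈ C
      · right
        refine ⟨by rw [h4, hstC _ hpC], fun hwv => ?_⟩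
        rcases hCch v hvr hwv hpC with h | h
        · exact hvC h
        · exact hvK h
      · rcases h1 hpC with h | h
        · left; omega
        · right
          exact ⟨by omega, fun hwv => h.2 (hwpar v hwv)⟩
  have hst0 : ∀ v, st v = 0 ↔ v ∈ K := by
    intro v
    refine ⟨fun h => ?_, hstK v⟩
    by_contra hv
    by_cases hC' : v ∈ C
    · rw [hstC v hC'] at h; omega
    · rw [hsto v hv hC'] at h; omega
  have hstL : ∀ v, st v = L + 1 ↔ v ∈ C := by
    intro v
    refine ⟨fun h => ?_, hstC v⟩
    by_contra hv
    have h1 := (key _ v rfl).1 hv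
    have h2 := hφL v
    omega
  have hnw : ∀ b ∈ C, ∀ v, v ≠ root → par v = b → v ∉ C → v ∉ K → L + 1 < st v := by
    intro b hb v hv hvb hvC hvK
    rw [hsto v hvK hvC, hvb, hstC b hb]
    omega
  refine ⟨K, Bs, ch, st, ⟨hrootK, hst0, fun v => (hstL v).trans (hC v), ?_, ?_, ?_, ?_, ?_, ?_, ?_⟩,
    ?_, ?_, ?_⟩
  · intro v
    have h1 := (key _ v rfl).2
    have h2 := hφL v
    omega
  · intro b hb
    have hb' := (hBs b).1 hb
    obtain ⟨h1, h2, h3, h4⟩ := htop b hb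
    obtain ⟨h5, h6, -⟩ := hchp b hb'.1 hb'.2.1
    refine ⟨h4, mem_union_left _ hb'.2.2, h5, h6, ?_⟩
    have h7 : par (par b) ∉ C := by
      intro h
      rcases (hC _).1 h with h | ⟨b', hb2, hbb⟩
      · have := ((hBs _).1 h).2.2
        rw [← hchu _ ((hBs _).1 h).2.1 (par b) (hnr _ h1) rfl h2] at this
        exact hKJs _ h1 this
      · obtain ⟨h1', h2', h3', h4'⟩ := htop b' hb2
        have := hchu (par b') h1' (par b) (hnr _ h1) hbb.symm h2
        rw [h3'] at this
        exact h4 (this ▸ hb2)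
    rcases (key _ _ rfl).1 h7 with h | h
    · have := hφL (par (par b))
      omega
    · exact absurd (hwpar _ h2) h.2
  · intro b hb b' hb' hbb
    rw [← (htop b hb).2.2.1, ← (htop b' hb').2.2.1, hbb]
  · intro b hb v hv hvb hne
    obtain ⟨h1, h2, h3, h4⟩ := htop b hb
    have hnwv : ¬ w v := by
      intro hwv
      apply hne
      rw [hchu (par b) h1 v hv hvb hwv, h3]
    exact hnw (par b) ((hC _).2 (Or.inr ⟨b, hb, rfl⟩)) v hv hvb (fun h => hnwv (hCw v h))
      (fun h => hnwv (hwK v h))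
  · intro b hb v hv hvb hne
    have hb' := (hBs b).1 hb
    have hnwv : ¬ w v := fun hwv => hne (hchu b hb'.2.1 v hv hvb hwv)
    exact hnw b ((hC _).2 (Or.inl hb)) v hv hvb (fun h => hnwv (hCw v h))
      (fun h => hnwv (hwK v h))
  · intro v h0 h1
    rw [hsto v (fun h => h0 ((hst0 v).2 h)) (fun h => h1 ((hstL v).2 h))]
    omega
  · intro v h0 h1 u hu huv
    have hvK : v ∉ K := fun h => h0 ((hst0 v).2 h)
    have hvC : v ∉ C := fun h => h1 ((hstL v).2 h)
    have huK : u ∉ K := by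
      intro h
      have := hparK u h (huv ▸ hvK)
      rw [huv] at this
      exact hvC ((hC v).2 (Or.inl this))
    by_cases huC : u ∈ C
    · rw [hstC u huC]
      have hwv : w v := huv ▸ hwpar u (hCw u huC)
      rcases (key _ v rfl).1 hvC with h | h
      · have := hφL v
        omega
      · exact absurd hwv h.2
    · rw [hsto u huK huC, huv]
      omega
  · intro v hv
    exact mem_union_left _ (mem_union_left _ (mem_insert_of_mem (mem_union_right _ hv)))
  · calc L * #K ≤ L * (4 * #J) := Nat.mul_le_mul_left _ hKc
      _ = 4 * (L * #J) := by ring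
      _ ≤ _ := Nat.mul_le_mul_left _ hJcard
  · calc L * #Bs ≤ L * (4 * #J) := Nat.mul_le_mul_left _ (by omega)
      _ = 4 * (L * #J) := by ring
      _ ≤ _ := Nat.mul_le_mul_left _ hJcard

end

lemma le_sq_div_sq_of_mul_le_mul_sqrt {t c B : ℝ} (ht : 0 < t) (hc : 0 ≤ c)
    (h : t * c ≤ B * Real.sqrt c) : c ≤ B ^ 2 / t ^ 2 := by
  rcases hc.eq_or_lt with rfl | hc
  · positivity
  · have hs : 0 < Real.sqrt c := Real.sqrt_pos.2 hc
    have h1 : t * Real.sqrt c ≤ B := by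
      have h2 : t * c = (t * Real.sqrt c) * Real.sqrt c := by
        rw [mul_assoc, Real.mul_self_sqrt hc.le]
      rw [h2] at h
      exact le_of_mul_le_mul_right h hs
    rw [le_div_iff₀ (by positivity)]
    calc c * t ^ 2 = (t * Real.sqrt c) ^ 2 := by rw [mul_pow, Real.sq_sqrt hc.le]; ring
      _ ≤ B ^ 2 := pow_le_pow_left₀ (by positivity) h1 2

lemma nrm_indicator {V : Type*} [Fintype V] [DecidableEq V] (X : Finset V) :
    nrm (fun v => if v ∈ X then (1 : ℝ) else 0) = Real.sqrt #X := by
  unfold nrm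
  congr 1
  simp

lemma nrm_indicator_le {V : Type*} [Fintype V] (p : V → Prop) [DecidablePred p] :
    nrm (fun v => if p v then (1 : ℝ) else 0) ≤ Real.sqrt (Fintype.card V) := by
  unfold nrm
  apply Real.sqrt_le_sqrt
  calc ∑ v, (if p v then (1 : ℝ) else 0) ^ 2 ≤ ∑ v : V, 1 :=
        sum_le_sum fun v _ => by split_ifs <;> norm_num
    _ = _ := by simp

section

variable {V Z : Type*} [Fintype V] [DecidableEq V] [Fintype Z] [DecidableEq Z]
  (χ : V → V → Z) (E : V → V → Prop) [∀ x v, Decidable (E x v)] (p : V → Prop) [DecidablePred p]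
  (q : Z → Prop) [DecidablePred q] (α β t : ℝ) (μ : V → ℝ)

omit [Fintype Z] [DecidableEq Z] in
/-- Few vertices see too much of `μ` through colours in `q`. -/
lemma card_bad_vertices (ht : 0 < t) (hα : 0 ≤ α) (hμ : ∀ y, 0 ≤ μ y)
    (hcol : ∀ a b : V → ℝ, |∑ x, ∑ v, a x * b v * ((if E x v then (1 : ℝ) else 0) *
      ((if q (χ x v) then 1 else 0) - α))| ≤ β * nrm a * nrm b) :
    (#(univ.filter fun v => α * ∑ y, μ y + t < ∑ y, μ y * if E y v ∧ q (χ y v) then 1 else 0) : ℝ)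
      ≤ (β * nrm μ) ^ 2 / t ^ 2 := by
  set X := univ.filter fun v => α * ∑ y, μ y + t < ∑ y, μ y * if E y v ∧ q (χ y v) then 1 else 0
  apply le_sq_div_sq_of_mul_le_mul_sqrt ht (Nat.cast_nonneg _)
  have h1 := (le_abs_self _).trans (hcol μ (fun v => if v ∈ X then 1 else 0))
  rw [nrm_indicator] at h1
  refine le_trans ?_ h1
  rw [sum_comm]
  have h2 : t * (#X : ℝ) = ∑ v, if v ∈ X then t else 0 := by
    rw [← sum_filter]
    simp [mul_comm]
  rw [h2]
  refine sum_le_sum fun v _ => ?_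
  split_ifs with hv
  · have hv' := (mem_filter.1 hv).2
    have h3 : ∑ y, μ y * (1 : ℝ) * ((if E y v then (1 : ℝ) else 0) *
        ((if q (χ y v) then 1 else 0) - α)) =
        (∑ y, μ y * if E y v ∧ q (χ y v) then 1 else 0) -
          α * ∑ y, μ y * if E y v then 1 else 0 := by
      rw [mul_sum, ← sum_sub_distrib]
      refine sum_congr rfl fun y _ => ?_
      by_cases h : E y v <;> by_cases h' : q (χ y v) <;> simp [h, h'] <;> ring
    have h4 : ∑ y, μ y * (if E y v then (1 : ℝ) else 0) ≤ ∑ y, μ y := by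
      refine sum_le_sum fun y _ => ?_
      have := hμ y
      split_ifs <;> simp [this]
    have h5 := mul_le_mul_of_nonneg_left h4 hα
    rw [h3]
    linarith
  · simp

/-- Few colours see too much of `μ` through vertices in `p`. -/
lemma card_bad_colours (k : ℕ) (hE : ∀ y v, E y v → v ≠ y)
    (hk : ∀ x z, #(univ.filter fun v => v ≠ x ∧ χ x v = z) ≤ k)
    (ht : 0 < t) (hα : 0 ≤ α) (hμ : ∀ y, 0 ≤ μ y)
    (hver : ∀ (a : V → ℝ) (b : Z → ℝ), |∑ x, ∑ v, a x * b (χ x v) *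
      ((if E x v then (1 : ℝ) else 0) * ((if p v then 1 else 0) - α))| ≤ β * nrm a * nrm b) :
    (#(univ.filter fun z => α * (k * ∑ y, μ y) + t <
      ∑ y, μ y * ∑ v, if E y v ∧ p v ∧ χ y v = z then 1 else 0) : ℝ)
      ≤ (β * nrm μ) ^ 2 / t ^ 2 := by
  set X := univ.filter fun z => α * (k * ∑ y, μ y) + t <
      ∑ y, μ y * ∑ v, if E y v ∧ p v ∧ χ y v = z then 1 else 0
  apply le_sq_div_sq_of_mul_le_mul_sqrt ht (Nat.cast_nonneg _)
  have h1 := (le_abs_self _).trans (hver μ (fun v => if v ∈ X then 1 else 0))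
  rw [nrm_indicator] at h1
  refine le_trans ?_ h1
  have h2 : t * (#X : ℝ) = ∑ z, if z ∈ X then t else 0 := by
    rw [← sum_filter]
    simp [mul_comm]
  have h0 : ∑ x, ∑ v, μ x * (if χ x v ∈ X then (1 : ℝ) else 0) *
      ((if E x v then (1 : ℝ) else 0) * ((if p v then 1 else 0) - α)) =
      ∑ z, if z ∈ X then ∑ x, ∑ v, μ x * ((if E x v ∧ χ x v = z then (1 : ℝ) else 0) *
        ((if p v then 1 else 0) - α)) else 0 := by
    have h3 : ∀ z, (if z ∈ X then ∑ x, ∑ v, μ x * ((if E x v ∧ χ x v = z then (1 : ℝ) else 0) *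
        ((if p v then 1 else 0) - α)) else 0) = ∑ x, ∑ v, if χ x v = z then
        (if z ∈ X then μ x * ((if E x v then (1 : ℝ) else 0) * ((if p v then 1 else 0) - α))
          else 0) else 0 := by
      intro z
      by_cases hz : z ∈ X
      · simp only [hz, if_true]
        refine sum_congr rfl fun x _ => sum_congr rfl fun v _ => ?_
        by_cases h : χ x v = z <;> simp [h]
      · simp [hz]
    simp_rw [h3]
    conv_rhs => rw [sum_comm]
    refine sum_congr rfl fun x _ => ?_
    conv_rhs => rw [sum_comm]
    refine sum_congr rfl fun v _ => ?_
    rw [sum_ite_eq]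
    by_cases h : χ x v ∈ X <;> simp [h]
  rw [h2, h0]
  refine sum_le_sum fun z _ => ?_
  split_ifs with hv
  · have hv' := (mem_filter.1 hv).2
    have h3 : ∑ x, ∑ v, μ x * ((if E x v ∧ χ x v = z then (1 : ℝ) else 0) *
        ((if p v then 1 else 0) - α)) =
        (∑ y, μ y * ∑ v, if E y v ∧ p v ∧ χ y v = z then 1 else 0) -
          α * ∑ y, μ y * ∑ v, if E y v ∧ χ y v = z then 1 else 0 := by
      simp_rw [mul_sum]
      rw [← sum_sub_distrib]
      refine sum_congr rfl fun y _ => ?_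
      rw [← sum_sub_distrib]
      refine sum_congr rfl fun v _ => ?_
      by_cases h : E y v <;> by_cases h' : p v <;> by_cases h'' : χ y v = z <;>
        simp [h, h', h''] <;> ring
    have h4 : ∑ y, μ y * ∑ v, (if E y v ∧ χ y v = z then (1 : ℝ) else 0) ≤ k * ∑ y, μ y := by
      rw [mul_sum]
      refine sum_le_sum fun y _ => ?_
      rw [mul_comm]
      refine mul_le_mul_of_nonneg_right ?_ (hμ y)
      rw [sum_boole]
      refine Nat.cast_le.2 (le_trans (card_le_card ?_) (hk y z))
      intro v hv
      simp only [mem_filter, mem_univ, true_and] at hv ⊢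
      exact ⟨hE _ _ hv.1, hv.2⟩
    have h5 := mul_le_mul_of_nonneg_left h4 hα
    rw [h3]
    linarith
  · exact le_rfl

omit [Fintype Z] [DecidableEq Z] in
/-- Few vertices have too small a degree into `p` through `q`. -/
lemma card_bad_rows (ht : 0 < t) (hα : 0 ≤ α) (hα1 : α ≤ 1) (hβ : 0 ≤ β)
    (hcol : ∀ a b : V → ℝ, |∑ x, ∑ v, a x * b v * ((if E x v then (1 : ℝ) else 0) *
      ((if q (χ x v) then 1 else 0) - α))| ≤ β * nrm a * nrm b)
    (hdeg : ∀ a : V → ℝ, |∑ x, ∑ v, a x * ((if E x v then (1 : ℝ) else 0) *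
      ((if p v then 1 else 0) - α))| ≤ β * Real.sqrt (Fintype.card V) * nrm a) :
    (#(univ.filter fun y => (∑ v, if E y v ∧ p v ∧ q (χ y v) then (1 : ℝ) else 0) <
      α ^ 2 * (∑ v, if E y v then 1 else 0) - t) : ℝ) ≤
      4 * β ^ 2 * Fintype.card V / t ^ 2 := by
  set X := univ.filter fun y => (∑ v, if E y v ∧ p v ∧ q (χ y v) then (1 : ℝ) else 0) <
      α ^ 2 * (∑ v, if E y v then 1 else 0) - t
  have hfin : 4 * β ^ 2 * Fintype.card V / t ^ 2 =
      (2 * β * Real.sqrt (Fintype.card V)) ^ 2 / t ^ 2 := by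
    rw [mul_pow, Real.sq_sqrt (Nat.cast_nonneg _)]
    ring
  rw [hfin]
  apply le_sq_div_sq_of_mul_le_mul_sqrt ht (Nat.cast_nonneg _)
  have h1 := (neg_le_abs _).trans (hcol (fun v => if v ∈ X then 1 else 0)
    (fun v => if p v then 1 else 0))
  have h2 := (neg_le_abs _).trans (hdeg (fun v => if v ∈ X then 1 else 0))
  rw [nrm_indicator] at h1 h2
  have h3 : β * Real.sqrt #X * nrm (fun v => if p v then (1 : ℝ) else 0) ≤
      β * Real.sqrt #X * Real.sqrt (Fintype.card V) :=
    mul_le_mul_of_nonneg_left (nrm_indicator_le p) (by positivity)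
  have h4 : t * (#X : ℝ) = ∑ v, if v ∈ X then t else 0 := by
    rw [← sum_filter]
    simp [mul_comm]
  have h5 : ∑ y, (if y ∈ X then t else 0) ≤
      -(∑ x, ∑ v, (if x ∈ X then (1 : ℝ) else 0) * (if p v then 1 else 0) *
        ((if E x v then (1 : ℝ) else 0) * ((if q (χ x v) then 1 else 0) - α))) +
      α * -(∑ x, ∑ v, (if x ∈ X then (1 : ℝ) else 0) * ((if E x v then (1 : ℝ) else 0) *
        ((if p v then 1 else 0) - α))) := by
    rw [← sum_neg_distrib, ← sum_neg_distrib, mul_sum, ← sum_add_distrib]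
    refine sum_le_sum fun y _ => ?_
    split_ifs with hy
    · have hy' := (mem_filter.1 hy).2
      have h6 : -(∑ v, 1 * (if p v then (1 : ℝ) else 0) *
          ((if E y v then (1 : ℝ) else 0) * ((if q (χ y v) then 1 else 0) - α))) +
          α * -(∑ v, 1 * ((if E y v then (1 : ℝ) else 0) * ((if p v then 1 else 0) - α))) =
          α ^ 2 * (∑ v, if E y v then 1 else 0) -
            ∑ v, if E y v ∧ p v ∧ q (χ y v) then (1 : ℝ) else 0 := by
        rw [← sum_neg_distrib, ← sum_neg_distrib, mul_sum, mul_sum, ← sum_add_distrib,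
          ← sum_sub_distrib]
        refine sum_congr rfl fun v _ => ?_
        by_cases h : E y v <;> by_cases h' : p v <;> by_cases h'' : q (χ y v) <;>
          simp [h, h', h''] <;> ring
      rw [h6]
      linarith
    · simp
  have h7 : α * -(∑ x, ∑ v, (if x ∈ X then (1 : ℝ) else 0) * ((if E x v then (1 : ℝ) else 0) *
        ((if p v then 1 else 0) - α))) ≤ β * Real.sqrt (Fintype.card V) * Real.sqrt #X := by
    have h8 : 0 ≤ β * Real.sqrt (Fintype.card V) * Real.sqrt #X := by positivity
    calc _ ≤ α * (β * Real.sqrt (Fintype.card V) * Real.sqrt #X) :=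
          mul_le_mul_of_nonneg_left h2 hα
      _ ≤ 1 * _ := mul_le_mul_of_nonneg_right hα1 h8
      _ = _ := one_mul _
  rw [h4]
  linarith

end

section

variable {Γ V : Type*} [Fintype Γ] [Fintype V] [DecidableEq V]

lemma sum_comp_mult (x : Γ → V) (F : V → ℝ) :
    ∑ s, F (x s) = ∑ y, (#(univ.filter fun s => x s = y) : ℝ) * F y := by
  have : ∀ y, (#(univ.filter fun s => x s = y) : ℝ) * F y =
      ∑ s, if x s = y then F y else 0 := by
    intro y
    rw [← sum_filter, sum_const, nsmul_eq_mul]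
  simp_rw [this]
  rw [sum_comm]
  simp

lemma nrm_mult_sq_le (x : Γ → V) (Δ : ℕ) (hmult : ∀ y, #(univ.filter fun s => x s = y) ≤ Δ) :
    nrm (fun y => (#(univ.filter fun s => x s = y) : ℝ)) ^ 2 ≤ Δ * Fintype.card Γ := by
  rw [nrm_sq]
  have h1 := sum_comp_mult x (fun _ => (1 : ℝ))
  simp only [sum_const, card_univ, nsmul_eq_mul, mul_one] at h1
  rw [h1, mul_sum]
  refine sum_le_sum fun y _ => ?_
  rw [sq]
  exact mul_le_mul_of_nonneg_right (by exact_mod_cast hmult y) (Nat.cast_nonneg _)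

end

/-- One round of the embedding: almost all slots get distinct vertices of the part `p`, joined
to their anchors by distinct colours of the part `q`. -/
lemma exists_round (N : ℕ) (hN : 1 ≤ N) : ∃ δ : ℝ, 0 < δ ∧
    ∀ (Γ V Z : Type) [Fintype Γ] [DecidableEq Γ] [Fintype V] [DecidableEq V] [Fintype Z]
      [DecidableEq Z] (χ : V → V → Z) (E : V → V → Prop) [∀ x v, Decidable (E x v)]
      (p : V → Prop) [DecidablePred p] (q : Z → Prop) [DecidablePred q] (α β t r : ℝ)
      (x : Γ → V) (k Δ D : ℕ),
      1 ≤ k → 1 ≤ Δ → 0 < D → 0 < t → 0 ≤ α → α ≤ 1 → 0 ≤ β →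
      (∀ y v, χ y v = χ v y) →
      (∀ y v, E y v → v ≠ y) →
      (∀ y z, #(univ.filter fun v => v ≠ y ∧ χ y v = z) ≤ k) →
      (∀ a b : V → ℝ, |∑ x, ∑ v, a x * b v * ((if E x v then (1 : ℝ) else 0) *
        ((if q (χ x v) then 1 else 0) - α))| ≤ β * nrm a * nrm b) →
      (∀ (a : V → ℝ) (b : Z → ℝ), |∑ x, ∑ v, a x * b (χ x v) *
        ((if E x v then (1 : ℝ) else 0) * ((if p v then 1 else 0) - α))| ≤ β * nrm a * nrm b) →
      (∀ a : V → ℝ, |∑ x, ∑ v, a x * ((if E x v then (1 : ℝ) else 0) *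
        ((if p v then 1 else 0) - α))| ≤ β * Real.sqrt (Fintype.card V) * nrm a) →
      (∀ y, #(univ.filter fun s => x s = y) ≤ Δ) →
      Fintype.card Γ ≤ Fintype.card V →
      (∀ s, r ≤ ∑ v, if E (x s) v then 1 else 0) →
      α * (k * Fintype.card Γ) + t ≤ D →
      D ≤ α ^ 2 * r - t - (1 + k) * (β ^ 2 * (Δ * Fintype.card V) / t ^ 2) →
      (k * Δ : ℝ) ≤ δ * D →
      ∃ (A : Finset Γ) (f : Γ → V), Set.InjOn f A ∧
        (∀ s ∈ A, E (x s) (f s) ∧ p (f s) ∧ q (χ (x s) (f s))) ∧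
        Set.InjOn (fun s => χ (x s) (f s)) A ∧
        (#Aᶜ : ℝ) ≤ 2 / N * Fintype.card Γ + Δ * (4 * β ^ 2 * Fintype.card V / t ^ 2) := by
  obtain ⟨δ, hδ, hnib⟩ := slot_nibble N hN
  refine ⟨δ, hδ, ?_⟩
  intro Γ V Z _ _ _ _ _ _ χ E _ p _ q _ α β t r x k Δ D hk1 hΔ hD ht hα hα1 hβ hsymm hE hk hcol
    hver hdeg hmult hΓ hrow H1 H2 H3
  set μ : V → ℝ := fun y => (#(univ.filter fun s => x s = y) : ℝ) with hμ
  have hμ0 : ∀ y, 0 ≤ μ y := fun y => Nat.cast_nonneg _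
  have hμs : ∑ y, μ y = Fintype.card Γ := by
    have h1 := sum_comp_mult x (fun _ => (1 : ℝ))
    simpa using h1.symm
  have hnrm : nrm μ ^ 2 ≤ Δ * Fintype.card V :=
    (nrm_mult_sq_le x Δ hmult).trans
      (mul_le_mul_of_nonneg_left (by exact_mod_cast hΓ) (Nat.cast_nonneg _))
  set w : ℝ := β ^ 2 * (Δ * Fintype.card V) / t ^ 2 with hw
  have hwb : (β * nrm μ) ^ 2 / t ^ 2 ≤ w := by
    rw [hw, mul_pow]
    exact div_le_div_of_nonneg_right (mul_le_mul_of_nonneg_left hnrm (sq_nonneg _)) (by positivity)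
  have hVb := (card_bad_vertices χ E q α β t μ ht hα hμ0 hcol).trans hwb
  have hZb := (card_bad_colours χ E p α β t μ k hE hk ht hα hμ0 hver).trans hwb
  have hXb := card_bad_rows χ E p q α β t ht hα hα1 hβ hcol hdeg
  rw [hμs] at hVb hZb
  set Vb := univ.filter fun v => α * (Fintype.card Γ : ℝ) + t <
    ∑ y, μ y * if E y v ∧ q (χ y v) then 1 else 0 with hVbd
  set Zb := univ.filter fun z => α * (k * (Fintype.card Γ : ℝ)) + t <
      ∑ y, μ y * ∑ v, if E y v ∧ p v ∧ χ y v = z then 1 else 0 with hZbd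
  set Xb := univ.filter fun y => (∑ v, if E y v ∧ p v ∧ q (χ y v) then (1 : ℝ) else 0) <
      α ^ 2 * (∑ v, if E y v then 1 else 0) - t with hXbd
  let row : V → Finset V := fun y => univ.filter fun v =>
    (E y v ∧ p v ∧ q (χ y v)) ∧ v ∉ Vb ∧ χ y v ∉ Zb
  have hrowc : ∀ s, x s ∉ Xb → D ≤ #(row (x s)) := by
    intro s hs
    have h1 : α ^ 2 * r - t ≤ #(univ.filter fun v => E (x s) v ∧ p v ∧ q (χ (x s) v)) := by
      have h2 : ¬ ((∑ v, if E (x s) v ∧ p v ∧ q (χ (x s) v) then (1 : ℝ) else 0) <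
          α ^ 2 * (∑ v, if E (x s) v then 1 else 0) - t) := fun h =>
        hs (mem_filter.2 ⟨mem_univ _, h⟩)
      rw [not_lt] at h2
      rw [← sum_boole]
      have h3 := mul_le_mul_of_nonneg_left (hrow s) (sq_nonneg α)
      linarith
    have h2 : (univ.filter fun v => E (x s) v ∧ p v ∧ q (χ (x s) v)) ⊆ row (x s) ∪ (Vb ∪
        Zb.biUnion fun z => univ.filter fun v => v ≠ x s ∧ χ (x s) v = z) := by
      intro v hv
      have hv' := (mem_filter.1 hv).2
      simp only [mem_union, mem_biUnion]
      by_cases h3 : v ∈ Vb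
      · exact Or.inr (Or.inl h3)
      by_cases h4 : χ (x s) v ∈ Zb
      · exact Or.inr (Or.inr ⟨_, h4, by simp [hE _ _ hv'.1]⟩)
      · exact Or.inl (mem_filter.2 ⟨mem_univ _, hv', h3, h4⟩)
    have h3 : #(univ.filter fun v => E (x s) v ∧ p v ∧ q (χ (x s) v)) ≤
        #(row (x s)) + (#Vb + #Zb * k) :=
      (card_le_card h2).trans ((card_union_le _ _).trans (Nat.add_le_add_left
        ((card_union_le _ _).trans (Nat.add_le_add_left
          (card_biUnion_le_card_mul _ _ _ fun z _ => hk _ _) _)) _))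
    have h4 : (#(univ.filter fun v => E (x s) v ∧ p v ∧ q (χ (x s) v)) : ℝ) ≤
        #(row (x s)) + (#Vb + #Zb * k) := by exact_mod_cast h3
    have h5 : (#Zb * k : ℝ) ≤ w * k := mul_le_mul_of_nonneg_right hZb (Nat.cast_nonneg _)
    have h6 : (D : ℝ) ≤ #(row (x s)) := by linarith
    exact_mod_cast h6
  have hch : ∀ s : {s // x s ∉ Xb}, ∃ R ⊆ row (x s), #R = D := fun s =>
    exists_subset_card_eq (hrowc s s.2)
  choose R hR hRc using hch
  let F : Finset ({s // x s ∉ Xb} × V) := univ.filter fun e => e.2 ∈ R e.1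
  have hF : ∀ e, e ∈ F ↔ e.2 ∈ R e.1 := fun e => by simp [F]
  have hFr : ∀ e ∈ F, (E (x e.1) e.2 ∧ p e.2 ∧ q (χ (x e.1) e.2)) ∧ e.2 ∉ Vb ∧
      χ (x e.1) e.2 ∉ Zb := fun e he => (mem_filter.1 (hR _ ((hF e).1 he))).2
  have hαD : α * (Fintype.card Γ : ℝ) + t ≤ D := by
    have h1 : (Fintype.card Γ : ℝ) ≤ k * Fintype.card Γ := by
      have : (1 : ℝ) ≤ k := by exact_mod_cast hk1
      have h0 : (0 : ℝ) ≤ Fintype.card Γ := Nat.cast_nonneg _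
      nlinarith
    have := mul_le_mul_of_nonneg_left h1 hα
    linarith
  have hex := hnib {s // x s ∉ Xb} V Z F (fun e => χ (x e.1) e.2) D (k * Δ)
    (Nat.mul_pos hk1 hΔ) hD ?_ ?_ ?_ ?_ ?_ ?_
  · obtain ⟨M, hMF, hM, hMc⟩ := hex
    let A : Finset Γ := univ.filter fun s => ∃ v, ∃ h : x s ∉ Xb, (⟨s, h⟩, v) ∈ M
    have hA : ∀ s ∈ A, ∃ v, ∃ h : x s ∉ Xb, (⟨s, h⟩, v) ∈ M := fun s hs => (mem_filter.1 hs).2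
    have hf : ∀ s, ∃ v, s ∈ A → ∃ h : x s ∉ Xb, (⟨s, h⟩, v) ∈ M := by
      intro s
      by_cases hs : s ∈ A
      · obtain ⟨v, hv⟩ := hA s hs
        exact ⟨v, fun _ => hv⟩
      · exact ⟨x s, fun h => absurd h hs⟩
    choose f hf using hf
    refine ⟨A, f, ?_, ?_, ?_, ?_⟩
    · intro s hs s' hs' hss
      obtain ⟨h1, h2⟩ := hf s hs
      obtain ⟨h1', h2'⟩ := hf s' hs'
      by_contra hne
      exact (hM _ h2 _ h2' (fun h => hne (congrArg (fun e => (e.1 : Γ)) h))).2.1 hss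
    · intro s hs
      obtain ⟨h1, h2⟩ := hf s hs
      exact (hFr _ (hMF h2)).1
    · intro s hs s' hs' hss
      obtain ⟨h1, h2⟩ := hf s hs
      obtain ⟨h1', h2'⟩ := hf s' hs'
      by_contra hne
      exact (hM _ h2 _ h2' (fun h => hne (congrArg (fun e => (e.1 : Γ)) h))).2.2 hss
    · have h1 : Aᶜ ⊆ (univ.filter fun s => x s ∈ Xb) ∪
          (univ.filter fun s : {s // x s ∉ Xb} => ∀ q ∈ M, q.1 ≠ s).map
            (Function.Embedding.subtype _) := by
        intro s hs
        rw [mem_union]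
        by_cases h : x s ∈ Xb
        · exact Or.inl (mem_filter.2 ⟨mem_univ _, h⟩)
        · right
          refine mem_map.2 ⟨⟨s, h⟩, mem_filter.2 ⟨mem_univ _, ?_⟩, rfl⟩
          rintro ⟨s', v⟩ hsv rfl
          exact (mem_compl.1 hs) (mem_filter.2 ⟨mem_univ _, v, h, hsv⟩)
      have h2 : #(univ.filter fun s => x s ∈ Xb) ≤ #Xb * Δ := by
        have : (univ.filter fun s => x s ∈ Xb) ⊆ Xb.biUnion fun y => univ.filter fun s => x s = y :=
          fun s hs => mem_biUnion.2 ⟨x s, (mem_filter.1 hs).2, by simp⟩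
        exact (card_le_card this).trans (card_biUnion_le_card_mul _ _ _ fun y _ => hmult y)
      have h3 : #Aᶜ ≤ #Xb * Δ +
          #(univ.filter fun s : {s // x s ∉ Xb} => ∀ q ∈ M, q.1 ≠ s) := by
        refine (card_le_card h1).trans ((card_union_le _ _).trans ?_)
        rw [card_map]
        exact Nat.add_le_add_right h2 _
      have h4 : (#Aᶜ : ℝ) ≤ #Xb * Δ +
          #(univ.filter fun s : {s // x s ∉ Xb} => ∀ q ∈ M, q.1 ≠ s) := by exact_mod_cast h3
      have h5 : (#Xb * Δ : ℝ) ≤ Δ * (4 * β ^ 2 * Fintype.card V / t ^ 2) := by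
        rw [mul_comm]
        exact mul_le_mul_of_nonneg_left hXb (Nat.cast_nonneg _)
      have h6 : (2 / N * Fintype.card {s // x s ∉ Xb} : ℝ) ≤ 2 / N * Fintype.card Γ :=
        mul_le_mul_of_nonneg_left (by exact_mod_cast Fintype.card_subtype_le _) (by positivity)
      linarith
  · intro s
    rw [← hRc s]
    refine card_bij (fun e _ => e.2) ?_ ?_ ?_
    · rintro ⟨s', v⟩ he
      simp only [mem_filter, hF] at he
      obtain ⟨h1, rfl⟩ := he
      exact h1
    · rintro ⟨s1, v1⟩ h1 ⟨s2, v2⟩ h2 hv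
      simp only [mem_filter] at h1 h2
      exact Prod.ext (h1.2.trans h2.2.symm) hv
    · intro v hv
      exact ⟨(s, v), by simp [hF, hv], rfl⟩
  · intro v
    by_cases hv : v ∈ Vb
    · rw [filter_false_of_mem]
      · simp
      · rintro e he rfl
        exact (hFr e he).2.1 hv
    · have h1 : #(F.filter fun e => e.2 = v) ≤
          #(univ.filter fun s => E (x s) v ∧ q (χ (x s) v)) := by
        refine card_le_card_of_injOn (fun e => (e.1 : Γ)) ?_ ?_
        · rintro e he
          obtain ⟨h2, rfl⟩ := mem_filter.1 he
          have := (hFr e h2).1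
          exact mem_filter.2 ⟨mem_univ _, this.1, this.2.2⟩
        · rintro e he e' he' hee
          exact Prod.ext (Subtype.ext hee)
            ((mem_filter.1 he).2.trans (mem_filter.1 he').2.symm)
      have h2 : ¬ (α * (Fintype.card Γ : ℝ) + t <
          ∑ y, μ y * if E y v ∧ q (χ y v) then 1 else 0) := fun h =>
        hv (mem_filter.2 ⟨mem_univ _, h⟩)
      rw [not_lt, ← sum_comp_mult x (fun y => if E y v ∧ q (χ y v) then (1 : ℝ) else 0),
        sum_boole] at h2
      have h3 : (#(F.filter fun e => e.2 = v) : ℝ) ≤ D :=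
        (Nat.cast_le.2 h1).trans (h2.trans hαD)
      exact_mod_cast h3
  · intro c
    by_cases hc : c ∈ Zb
    · rw [filter_false_of_mem]
      · simp
      · rintro e he rfl
        exact (hFr e he).2.2 hc
    · have h1 : #(F.filter fun e => χ (x e.1) e.2 = c) ≤
          #((univ : Finset (Γ × V)).filter fun e =>
            E (x e.1) e.2 ∧ p e.2 ∧ χ (x e.1) e.2 = c) := by
        refine card_le_card_of_injOn (fun e => ((e.1 : Γ), e.2)) ?_ ?_
        · rintro e he
          obtain ⟨h2, h3⟩ := mem_filter.1 he
          have := (hFr e h2).1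
          exact mem_filter.2 ⟨mem_univ _, this.1, this.2.1, h3⟩
        · rintro e he e' he' hee
          have h4 := Prod.ext_iff.1 hee
          exact Prod.ext (Subtype.ext h4.1) h4.2
      have h2 : ¬ (α * (k * (Fintype.card Γ : ℝ)) + t <
          ∑ y, μ y * ∑ v, if E y v ∧ p v ∧ χ y v = c then 1 else 0) := fun h =>
        hc (mem_filter.2 ⟨mem_univ _, h⟩)
      rw [not_lt, ← sum_comp_mult x
        (fun y => ∑ v, if E y v ∧ p v ∧ χ y v = c then (1 : ℝ) else 0),
        ← Fintype.sum_prod_type' (fun s v => if E (x s) v ∧ p v ∧ χ (x s) v = c then (1 : ℝ)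
          else 0), sum_boole] at h2
      have h3 : (#(F.filter fun e => χ (x e.1) e.2 = c) : ℝ) ≤ D :=
        (Nat.cast_le.2 h1).trans (h2.trans H1)
      exact_mod_cast h3
  · intro s c
    refine le_trans (le_trans ?_ (hk (x s) c)) (Nat.le_mul_of_pos_right _ hΔ)
    refine card_le_card_of_injOn (fun e => e.2) ?_ ?_
    · rintro e he
      obtain ⟨h2, rfl, h3⟩ := mem_filter.1 he
      have := (hFr e h2).1
      exact mem_filter.2 ⟨mem_univ _, hE _ _ this.1, h3⟩
    · rintro e he e' he' hee
      exact Prod.ext ((mem_filter.1 he).2.1.trans (mem_filter.1 he').2.1.symm) hee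
  · intro v c
    have h1 : #(F.filter fun e => e.2 = v ∧ χ (x e.1) e.2 = c) ≤
        #((univ.filter fun y => y ≠ v ∧ χ v y = c).biUnion
          fun y => univ.filter fun s => x s = y) := by
      refine card_le_card_of_injOn (fun e => (e.1 : Γ)) ?_ ?_
      · rintro e he
        obtain ⟨h2, rfl, h3⟩ := mem_filter.1 he
        have := (hFr e h2).1
        refine mem_biUnion.2 ⟨x e.1, mem_filter.2 ⟨mem_univ _, (hE _ _ this.1).symm, ?_⟩, by simp⟩
        rw [hsymm, h3]
      · rintro e he e' he' hee
        exact Prod.ext (Subtype.ext hee)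
          ((mem_filter.1 he).2.1.trans (mem_filter.1 he').2.1.symm)
    exact h1.trans ((card_biUnion_le_card_mul _ _ _ fun y _ => hmult y).trans
      (Nat.mul_le_mul_right _ (hk v c)))
  · push_cast
    exact H3

section

variable {α V Z : Type*} [DecidableEq α] [DecidableEq V] [DecidableEq Z]

/-- The non-root vertices of `D` whose parent is in `D`; they stand for the edges inside `D`. -/
def edgesIn (root : α) (par : α → α) (D : Finset α) : Finset α :=
  D.filter fun v => v ≠ root ∧ par v ∈ D

/-- The colour of the edge from `v` to its parent. -/
def edgeCol (χ : V → V → Z) (par : α → α) (f : α → V) (v : α) : Z := χ (f (par v)) (f v)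

/-- A rainbow embedding of the vertices in `D`, avoiding `B`, using at most `r` vertices and
colours from the reserves `V₀` and `Z₀`, all others coming from `U` and `U'`. -/
structure Partial (χ : V → V → Z) (root : α) (par : α → α) (V₀ B : Finset V) (Z₀ : Finset Z)
    (D : Finset α) (f : α → V) (U : Finset V) (U' : Finset Z) (r : ℕ) : Prop where
  inj : Set.InjOn f D
  rainbow : Set.InjOn (edgeCol χ par f) (edgesIn root par D)
  avoid : ∀ v ∈ D, f v ∉ B
  verts : ∀ v ∈ D, f v ∈ V₀ ∪ U
  cols : ∀ v ∈ edgesIn root par D, edgeCol χ par f v ∈ Z₀ ∪ U'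
  vcount : #(D.image f ∩ V₀) ≤ r
  ccount : #((edgesIn root par D).image (edgeCol χ par f) ∩ Z₀) ≤ r

variable {χ : V → V → Z} {root : α} {par : α → α} {V₀ B : Finset V} {Z₀ : Finset Z}
  {D : Finset α} {f : α → V} {U : Finset V} {U' : Finset Z} {r : ℕ}

omit [DecidableEq V] [DecidableEq Z] in
lemma mem_edgesIn {v : α} : v ∈ edgesIn root par D ↔ v ∈ D ∧ v ≠ root ∧ par v ∈ D := by
  simp [edgesIn]

lemma Partial.mono (h : Partial χ root par V₀ B Z₀ D f U U' r) {U₁ : Finset V} {U₁' : Finset Z}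
    {r₁ : ℕ} (hU : U ⊆ U₁) (hU' : U' ⊆ U₁') (hr : r ≤ r₁) :
    Partial χ root par V₀ B Z₀ D f U₁ U₁' r₁ where
  inj := h.inj
  rainbow := h.rainbow
  avoid := h.avoid
  verts v hv := union_subset_union_right hU (h.verts v hv)
  cols v hv := union_subset_union_right hU' (h.cols v hv)
  vcount := h.vcount.trans hr
  ccount := h.ccount.trans hr

lemma Partial.extend (h : Partial χ root par V₀ B Z₀ D f U U' r) (D' N : Finset α) (f' : α → V)
    (s : ℕ) (hf : ∀ v ∈ D, f' v = f v)
    (hN : edgesIn root par D' ⊆ edgesIn root par D ∪ N) (hinj : Set.InjOn f' (D' \ D : Finset α))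
    (hnew : ∀ v ∈ D' \ D, f' v ∉ D.image f ∧ f' v ∉ B ∧ f' v ∈ V₀ ∪ U)
    (hcinj : Set.InjOn (edgeCol χ par f') N)
    (hcnew : ∀ v ∈ N, edgeCol χ par f' v ∉ (edgesIn root par D).image (edgeCol χ par f) ∧
      edgeCol χ par f' v ∈ Z₀ ∪ U')
    (hs : #((D' \ D).filter fun v => f' v ∈ V₀) ≤ s)
    (hs' : #(N.filter fun v => edgeCol χ par f' v ∈ Z₀) ≤ s) :
    Partial χ root par V₀ B Z₀ D' f' U U' (r + s) := by
  have hcol : ∀ v ∈ edgesIn root par D, edgeCol χ par f' v = edgeCol χ par f v := by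
    intro v hv
    have := mem_edgesIn.1 hv
    rw [edgeCol, edgeCol, hf v this.1, hf _ this.2.2]
  refine ⟨?_, ?_, ?_, ?_, ?_, ?_, ?_⟩
  · intro u hu v hv huv
    have hu : u ∈ D' := hu
    have hv : v ∈ D' := hv
    by_cases h1 : u ∈ D <;> by_cases h2 : v ∈ D
    · rw [hf u h1, hf v h2] at huv
      exact h.inj h1 h2 huv
    · rw [hf u h1] at huv
      exact absurd (huv ▸ mem_image_of_mem f h1) (hnew v (mem_sdiff.2 ⟨hv, h2⟩)).1
    · rw [hf v h2] at huv
      exact absurd (huv ▸ mem_image_of_mem f h2) (hnew u (mem_sdiff.2 ⟨hu, h1⟩)).1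
    · exact hinj (mem_sdiff.2 ⟨hu, h1⟩) (mem_sdiff.2 ⟨hv, h2⟩) huv
  · intro u hu v hv huv
    by_cases h1 : u ∈ edgesIn root par D <;> by_cases h2 : v ∈ edgesIn root par D
    · rw [hcol u h1, hcol v h2] at huv
      exact h.rainbow h1 h2 huv
    · rw [hcol u h1] at huv
      have h3 := (mem_union.1 (hN hv)).resolve_left h2
      exact absurd (huv ▸ mem_image_of_mem _ h1) (hcnew v h3).1
    · rw [hcol v h2] at huv
      have h3 := (mem_union.1 (hN hu)).resolve_left h1
      exact absurd (huv ▸ mem_image_of_mem _ h2) (hcnew u h3).1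
    · exact hcinj ((mem_union.1 (hN hu)).resolve_left h1) ((mem_union.1 (hN hv)).resolve_left h2)
        huv
  · intro v hv
    by_cases h1 : v ∈ D
    · rw [hf v h1]; exact h.avoid v h1
    · exact (hnew v (mem_sdiff.2 ⟨hv, h1⟩)).2.1
  · intro v hv
    by_cases h1 : v ∈ D
    · rw [hf v h1]; exact h.verts v h1
    · exact (hnew v (mem_sdiff.2 ⟨hv, h1⟩)).2.2
  · intro v hv
    by_cases h1 : v ∈ edgesIn root par D
    · rw [hcol v h1]; exact h.cols v h1
    · exact (hcnew v ((mem_union.1 (hN hv)).resolve_left h1)).2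
  · have h1 : D'.image f' ∩ V₀ ⊆
        (D.image f ∩ V₀) ∪ ((D' \ D).filter fun v => f' v ∈ V₀).image f' := by
      intro x hx
      obtain ⟨h2, h3⟩ := mem_inter.1 hx
      obtain ⟨v, hv, rfl⟩ := mem_image.1 h2
      by_cases h4 : v ∈ D
      · refine mem_union_left _ (mem_inter.2 ⟨?_, h3⟩)
        rw [hf v h4]
        exact mem_image_of_mem f h4
      · exact mem_union_right _ (mem_image_of_mem _ (mem_filter.2 ⟨mem_sdiff.2 ⟨hv, h4⟩, h3⟩))
    exact (card_le_card h1).trans ((card_union_le _ _).trans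
      (Nat.add_le_add h.vcount (card_image_le.trans hs)))
  · have h1 : (edgesIn root par D').image (edgeCol χ par f') ∩ Z₀ ⊆
        ((edgesIn root par D).image (edgeCol χ par f) ∩ Z₀) ∪
          (N.filter fun v => edgeCol χ par f' v ∈ Z₀).image (edgeCol χ par f') := by
      intro x hx
      obtain ⟨h2, h3⟩ := mem_inter.1 hx
      obtain ⟨v, hv, rfl⟩ := mem_image.1 h2
      by_cases h4 : v ∈ edgesIn root par D
      · refine mem_union_left _ (mem_inter.2 ⟨?_, h3⟩)
        rw [hcol v h4]
        exact mem_image_of_mem _ h4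
      · exact mem_union_right _ (mem_image_of_mem _
          (mem_filter.2 ⟨(mem_union.1 (hN hv)).resolve_left h4, h3⟩))
    exact (card_le_card h1).trans ((card_union_le _ _).trans
      (Nat.add_le_add h.ccount (card_image_le.trans hs')))

/-- The vertices in `A` can be attached below `D`. -/
def Attachable (root : α) (par : α → α) (D A : Finset α) : Prop :=
  ∀ v ∈ A, v ∉ D ∧ v ≠ root ∧ par v ∈ D ∧ ∀ c, c ≠ root → par c = v → c ∉ D

omit [DecidableEq V] [DecidableEq Z] in
lemma Attachable.edgesIn_subset {A : Finset α} (h : Attachable root par D A) :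
    edgesIn root par (D ∪ A) ⊆ edgesIn root par D ∪ A := by
  intro v hv
  obtain ⟨h1, h2, h3⟩ := mem_edgesIn.1 hv
  rw [mem_union]
  by_cases hA : v ∈ A
  · exact Or.inr hA
  left
  have hvD := (mem_union.1 h1).resolve_right hA
  rcases mem_union.1 h3 with h4 | h4
  · exact mem_edgesIn.2 ⟨hvD, h2, h4⟩
  · exact absurd hvD ((h _ h4).2.2.2 v h2 rfl)

omit [DecidableEq α] [DecidableEq V] [DecidableEq Z] in
lemma Attachable.subset {A A' : Finset α} (h : Attachable root par D A) (hA : A' ⊆ A) :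
    Attachable root par D A' := fun v hv => h v (hA hv)

omit [DecidableEq V] [DecidableEq Z] in
lemma Attachable.step {A A' A'' : Finset α} (h : Attachable root par D A) (hA' : A' ⊆ A)
    (hA'' : A'' ⊆ A) (hd : Disjoint A' A'') : Attachable root par (D ∪ A') A'' := by
  intro v hv
  obtain ⟨h1, h2, h3, h4⟩ := h v (hA'' hv)
  refine ⟨fun h5 => ?_, h2, mem_union_left _ h3, fun c hc hcv h5 => ?_⟩
  · rcases mem_union.1 h5 with h5 | h5
    · exact h1 h5
    · exact disjoint_left.1 hd h5 hv
  · rcases mem_union.1 h5 with h5 | h5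
    · exact h4 c hc hcv h5
    · have := (h c (hA' h5)).2.2.1
      rw [hcv] at this
      exact h1 this

/-- Attach vertices along a rainbow matching that uses fresh vertices and colours. -/
lemma Partial.attach (h : Partial χ root par V₀ B Z₀ D f U U' r) {A : Finset α}
    (hA : Attachable root par D A) (φ : α → V) (U₁ : Finset V) (U₁' : Finset Z)
    (hU : U ⊆ U₁) (hU' : U' ⊆ U₁') (hφ : Set.InjOn φ A)
    (hv : ∀ v ∈ A, φ v ∉ B ∧ φ v ∈ U₁ ∧ φ v ∉ U ∧ φ v ∉ V₀)
    (hφc : Set.InjOn (fun v => χ (f (par v)) (φ v)) A)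
    (hc : ∀ v ∈ A, χ (f (par v)) (φ v) ∈ U₁' ∧ χ (f (par v)) (φ v) ∉ U' ∧
      χ (f (par v)) (φ v) ∉ Z₀) :
    ∃ f', (∀ v ∈ D, f' v = f v) ∧ Partial χ root par V₀ B Z₀ (D ∪ A) f' U₁ U₁' r := by
  have hAD : ∀ v ∈ A, v ∉ D := fun v hv => (hA v hv).1
  have hf1 : ∀ v ∈ D, (if v ∈ A then φ v else f v) = f v := fun v hv =>
    if_neg fun h' => hAD v h' hv
  have hf2 : ∀ v ∈ A, (if v ∈ A then φ v else f v) = φ v := fun v hv => if_pos hv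
  have hcol : ∀ v ∈ A, edgeCol χ par (fun v => if v ∈ A then φ v else f v) v =
      χ (f (par v)) (φ v) := by
    intro v hv
    simp only [edgeCol]
    rw [hf1 _ (hA v hv).2.2.1, hf2 v hv]
  have hsd : (D ∪ A) \ D = A := by
    rw [union_sdiff_left]
    exact Finset.sdiff_eq_self_of_disjoint (disjoint_left.2 hAD)
  refine ⟨fun v => if v ∈ A then φ v else f v, hf1, ?_⟩
  have hex := (h.mono hU hU' le_rfl).extend (D ∪ A) A (fun v => if v ∈ A then φ v else f v) 0
    hf1 hA.edgesIn_subset ?_ ?_ ?_ ?_ ?_ ?_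
  · exact hex
  · rw [hsd]
    intro u hu v hv huv
    change (if u ∈ A then φ u else f u) = (if v ∈ A then φ v else f v) at huv
    rw [hf2 u hu, hf2 v hv] at huv
    exact hφ hu hv huv
  · rw [hsd]
    intro v hvA
    rw [hf2 v hvA]
    obtain ⟨h1, h2, h3, h4⟩ := hv v hvA
    refine ⟨fun h5 => ?_, h1, mem_union_right _ h2⟩
    obtain ⟨u, hu, huv⟩ := mem_image.1 h5
    have := h.verts u hu
    rw [huv] at this
    rcases mem_union.1 this with h6 | h6
    · exact h4 h6
    · exact h3 h6
  · intro u hu v hv huv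
    rw [hcol u hu, hcol v hv] at huv
    exact hφc hu hv huv
  · intro v hvA
    rw [hcol v hvA]
    obtain ⟨h2, h3, h4⟩ := hc v hvA
    refine ⟨fun h5 => ?_, mem_union_right _ h2⟩
    obtain ⟨u, hu, huv⟩ := mem_image.1 h5
    have := h.cols u hu
    rw [huv] at this
    rcases mem_union.1 this with h6 | h6
    · exact h4 h6
    · exact h3 h6
  · rw [hsd, filter_false_of_mem]
    · simp
    · intro v hvA
      rw [hf2 v hvA]
      exact (hv v hvA).2.2.2
  · rw [filter_false_of_mem]
    · simp
    · intro v hvA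
      rw [hcol v hvA]
      exact (hc v hvA).2.2

/-- Every vertex outside `B` has a usable reserve neighbour after `R` uses of the reserve. -/
def ReserveEdge (χ : V → V → Z) (V₀ B : Finset V) (Z₀ : Finset Z) (R : ℕ) : Prop :=
  ∀ x, x ∉ B → ∀ (X : Finset V) (Y : Finset Z), #X ≤ R → #Y ≤ R →
    ∃ v ∈ V₀, v ∉ B ∧ v ∉ X ∧ χ x v ∈ Z₀ ∧ χ x v ∉ Y

/-- Any two vertices outside `B` are joined by a rainbow path of length three through the reserve
after `R` uses of the reserve. -/
def ReservePath (χ : V → V → Z) (V₀ B : Finset V) (Z₀ : Finset Z) (R : ℕ) : Prop :=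
  ∀ x y, x ∉ B → y ∉ B → ∀ (X : Finset V) (Y : Finset Z), #X ≤ R → #Y ≤ R →
    ∃ v ∈ V₀, ∃ w ∈ V₀, v ≠ w ∧ (v ∉ B ∧ v ∉ X) ∧ (w ∉ B ∧ w ∉ X) ∧
      (χ x v ∈ Z₀ ∧ χ x v ∉ Y) ∧ (χ v w ∈ Z₀ ∧ χ v w ∉ Y) ∧ (χ w y ∈ Z₀ ∧ χ w y ∉ Y) ∧
      χ x v ≠ χ v w ∧ χ x v ≠ χ w y ∧ χ v w ≠ χ w y

/-- Attach a single vertex through the reserve. -/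
lemma Partial.attach_reserve_one (h : Partial χ root par V₀ B Z₀ D f U U' r) {R : ℕ}
    (hR : ReserveEdge χ V₀ B Z₀ R) (hr : r ≤ R) (u : α) (hA : Attachable root par D {u}) :
    ∃ f', (∀ v ∈ D, f' v = f v) ∧ Partial χ root par V₀ B Z₀ (D ∪ {u}) f' U U' (r + 1) := by
  obtain ⟨huD, -, hpD, -⟩ := hA u (mem_singleton_self u)
  obtain ⟨y, hy0, hyB, hyX, hcZ, hcY⟩ := hR (f (par u)) (h.avoid _ hpD) _ _
    (h.vcount.trans hr) (h.ccount.trans hr)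
  have hf1 : ∀ v ∈ D, Function.update f u y v = f v := fun v hv =>
    Function.update_of_ne (fun h' : v = u => huD (h' ▸ hv)) _ _
  have hcol : edgeCol χ par (Function.update f u y) u = χ (f (par u)) y := by
    rw [edgeCol, hf1 _ hpD, Function.update_self]
  have hsd : (D ∪ {u}) \ D = {u} := by
    rw [union_sdiff_left]
    exact Finset.sdiff_eq_self_of_disjoint (disjoint_left.2 (by simpa using huD))
  refine ⟨Function.update f u y, hf1, h.extend (D ∪ {u}) {u} _ 1 hf1
    hA.edgesIn_subset ?_ ?_ ?_ ?_ ?_ ?_⟩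
  · rw [hsd]; simp
  · rw [hsd]
    intro v hv
    rw [mem_singleton.1 hv, Function.update_self]
    refine ⟨fun h1 => hyX (mem_inter.2 ⟨h1, hy0⟩), hyB, mem_union_left _ hy0⟩
  · simp
  · intro v hv
    rw [mem_singleton.1 hv, hcol]
    exact ⟨fun h1 => hcY (mem_inter.2 ⟨h1, hcZ⟩), mem_union_left _ hcZ⟩
  · rw [hsd]
    exact (card_filter_le _ _).trans (by simp)
  · exact (card_filter_le _ _).trans (by simp)

/-- Attach a set of vertices through the reserve. -/
lemma Partial.attach_reserve {R : ℕ} (hR : ReserveEdge χ V₀ B Z₀ R) (A : Finset α) :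
    ∀ {D : Finset α} {f : α → V} {r : ℕ}, Partial χ root par V₀ B Z₀ D f U U' r →
      r + #A ≤ R → Attachable root par D A →
      ∃ f', (∀ v ∈ D, f' v = f v) ∧ Partial χ root par V₀ B Z₀ (D ∪ A) f' U U' (r + #A) := by
  induction A using Finset.induction_on with
  | empty => intro D f r h _ _; exact ⟨f, fun _ _ => rfl, by simpa using h⟩
  | insert u A hu ih =>
    intro D f r h hr hA
    rw [card_insert_of_notMem hu] at hr ⊢
    obtain ⟨f₁, hf₁, h₁⟩ := h.attach_reserve_one hR (by omega) u (hA.subset (by simp))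
    obtain ⟨f₂, hf₂, h₂⟩ := ih h₁ (by omega)
      (hA.step (by simp) (subset_insert _ _) (by simpa using hu))
    refine ⟨f₂, fun v hv => ?_, ?_⟩
    · rw [hf₂ v (mem_union_left _ hv), hf₁ v hv]
    · rw [union_assoc, show ({u} : Finset α) ∪ A = insert u A from rfl] at h₂
      rwa [show r + (#A + 1) = r + 1 + #A by omega]

end

section

variable {α V Z : Type*} [DecidableEq α] [DecidableEq V] [DecidableEq Z]
variable {χ : V → V → Z} {root : α} {par : α → α} {V₀ B : Finset V} {Z₀ : Finset Z}
  {D : Finset α} {f : α → V} {U : Finset V} {U' : Finset Z} {r : ℕ}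

/-- Join `par (par b)` to `c` by a path of length three through the reserve. -/
lemma Partial.attach_pair (h : Partial χ root par V₀ B Z₀ D f U U' r) {R : ℕ}
    (hR : ReservePath χ V₀ B Z₀ R) (hr : r ≤ R) (b c : α) (hb : b ∉ D) (ha : par b ∉ D)
    (hab : par b ≠ b) (hpa : par (par b) ∈ D) (hc : c ∈ D) (hpc : par c = b)
    (htop : ∀ v, v ≠ root → par v = par b → v ≠ b → v ∉ D)
    (hbot : ∀ v, v ≠ root → par v = b → v ≠ c → v ∉ D) :
    ∃ f', (∀ v ∈ D, f' v = f v) ∧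
      Partial χ root par V₀ B Z₀ (D ∪ {b, par b}) f' U U' (r + 3) := by
  obtain ⟨y, hy0, w, hw0, hyw, ⟨hyB, hyX⟩, ⟨hwB, hwX⟩, ⟨hc1, hc1'⟩, ⟨hc2, hc2'⟩, ⟨hc3, hc3'⟩,
    hne1, hne2, hne3⟩ := hR (f (par (par b))) (f c) (h.avoid _ hpa) (h.avoid _ hc) _ _
    (h.vcount.trans hr) (h.ccount.trans hr)
  set g := Function.update (Function.update f (par b) y) b w with hg
  have hgb : g b = w := Function.update_self _ _ _
  have hga : g (par b) = y := by rw [hg, Function.update_of_ne hab, Function.update_self]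
  have hf1 : ∀ v ∈ D, g v = f v := fun v hv => by
    rw [hg, Function.update_of_ne (fun h' : v = b => hb (h' ▸ hv)),
      Function.update_of_ne (fun h' : v = par b => ha (h' ▸ hv))]
  have hcb : edgeCol χ par g b = χ y w := by rw [edgeCol, hga, hgb]
  have hca : edgeCol χ par g (par b) = χ (f (par (par b))) y := by rw [edgeCol, hf1 _ hpa, hga]
  have hcc : edgeCol χ par g c = χ w (f c) := by rw [edgeCol, hpc, hgb, hf1 c hc]
  have hsd : (D ∪ {b, par b}) \ D = {b, par b} := by
    rw [union_sdiff_left]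
    apply Finset.sdiff_eq_self_of_disjoint
    rw [disjoint_left]
    intro v hv
    rcases mem_insert.1 hv with rfl | hv
    · exact hb
    · rw [mem_singleton.1 hv]; exact ha
  have hNmem : ∀ v ∈ ({b, par b, c} : Finset α), v = b ∨ v = par b ∨ v = c := fun v hv => by
    simpa using hv
  refine ⟨g, hf1, h.extend (D ∪ {b, par b}) {b, par b, c} _ 3 hf1 ?_ ?_ ?_ ?_ ?_ ?_ ?_⟩
  · intro v hv
    obtain ⟨h1, h2, h3⟩ := mem_edgesIn.1 hv
    by_cases hvb : v = b
    · simp [hvb]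
    by_cases hva : v = par b
    · simp [hva]
    by_cases hvc : v = c
    · simp [hvc]
    have hvD : v ∈ D := by simpa [hvb, hva] using h1
    refine mem_union_left _ (mem_edgesIn.2 ⟨hvD, h2, ?_⟩)
    have h4 : par v ≠ b := fun h' => hbot v h2 h' hvc hvD
    have h5 : par v ≠ par b := fun h' => htop v h2 h' hvb hvD
    simpa [h4, h5] using h3
  · rw [hsd]
    intro u hu v hv huv
    have hu : u = b ∨ u = par b := by simpa using hu
    have hv : v = b ∨ v = par b := by simpa using hv
    rcases hu with rfl | rfl <;> rcases hv with rfl | rfl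
    · rfl
    · rw [hgb, hga] at huv; exact absurd huv.symm hyw
    · rw [hgb, hga] at huv; exact absurd huv hyw
    · rfl
  · rw [hsd]
    intro v hv
    rcases mem_insert.1 hv with rfl | hv
    · rw [hgb]
      exact ⟨fun h1 => hwX (mem_inter.2 ⟨h1, hw0⟩), hwB, mem_union_left _ hw0⟩
    · rw [mem_singleton.1 hv, hga]
      exact ⟨fun h1 => hyX (mem_inter.2 ⟨h1, hy0⟩), hyB, mem_union_left _ hy0⟩
  · intro u hu v hv huv
    rcases hNmem u hu with rfl | rfl | rfl <;> rcases hNmem v hv with rfl | rfl | rfl <;>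
      simp only [hcb, hca, hcc] at huv <;>
      first
        | rfl
        | exact absurd huv hne1
        | exact absurd huv hne2
        | exact absurd huv hne3
        | exact absurd huv.symm hne1
        | exact absurd huv.symm hne2
        | exact absurd huv.symm hne3
  · intro v hv
    rcases hNmem v hv with rfl | rfl | rfl
    · rw [hcb]
      exact ⟨fun h1 => hc2' (mem_inter.2 ⟨h1, hc2⟩), mem_union_left _ hc2⟩
    · rw [hca]
      exact ⟨fun h1 => hc1' (mem_inter.2 ⟨h1, hc1⟩), mem_union_left _ hc1⟩
    · rw [hcc]
      exact ⟨fun h1 => hc3' (mem_inter.2 ⟨h1, hc3⟩), mem_union_left _ hc3⟩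
  · rw [hsd]
    exact (card_filter_le _ _).trans (card_le_two.trans (by omega))
  · exact (card_filter_le _ _).trans card_le_three

/-- The rounds of the embedding: round `i` matches at most `cap` vertices into fresh vertices and
colours, with at most `η` exceptions. -/
def Rounds (α : Type*) [DecidableEq α] (χ : V → V → Z) (V₀ B : Finset V) (Z₀ : Finset Z)
    (Us : ℕ → Finset V) (Us' : ℕ → Finset Z) (g cap Δ η : ℕ) : Prop :=
  ∀ i < g, ∀ (A : Finset α) (x : α → V), #A ≤ cap → (∀ v ∈ A, x v ∉ B) →
    (∀ y, #(A.filter fun v => x v = y) ≤ Δ) →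
    ∃ A₁ ⊆ A, ∃ φ : α → V, Set.InjOn φ A₁ ∧
      (∀ v ∈ A₁, φ v ∉ B ∧ φ v ∈ Us (i + 1) ∧ φ v ∉ Us i ∧ φ v ∉ V₀) ∧
      Set.InjOn (fun v => χ (x v) (φ v)) A₁ ∧
      (∀ v ∈ A₁, χ (x v) (φ v) ∈ Us' (i + 1) ∧ χ (x v) (φ v) ∉ Us' i ∧ χ (x v) (φ v) ∉ Z₀) ∧
      #(A \ A₁) ≤ η

/-- Attach a matching and put the exceptions into the reserve. -/
lemma Partial.attach_almost (h : Partial χ root par V₀ B Z₀ D f U U' r) {R : ℕ}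
    (hR : ReserveEdge χ V₀ B Z₀ R) {A A₁ : Finset α} (hA : Attachable root par D A)
    (hA₁ : A₁ ⊆ A) (φ : α → V) (U₁ : Finset V) (U₁' : Finset Z)
    (hU : U ⊆ U₁) (hU' : U' ⊆ U₁') (hφ : Set.InjOn φ A₁)
    (hv : ∀ v ∈ A₁, φ v ∉ B ∧ φ v ∈ U₁ ∧ φ v ∉ U ∧ φ v ∉ V₀)
    (hφc : Set.InjOn (fun v => χ (f (par v)) (φ v)) A₁)
    (hc : ∀ v ∈ A₁, χ (f (par v)) (φ v) ∈ U₁' ∧ χ (f (par v)) (φ v) ∉ U' ∧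
      χ (f (par v)) (φ v) ∉ Z₀) {η : ℕ} (hη : #(A \ A₁) ≤ η) (hr : r + η ≤ R) :
    ∃ f', (∀ v ∈ D, f' v = f v) ∧ Partial χ root par V₀ B Z₀ (D ∪ A) f' U₁ U₁' (r + η) := by
  obtain ⟨f₁, hf₁, h₁⟩ := h.attach (hA.subset hA₁) φ U₁ U₁' hU hU' hφ hv hφc hc
  obtain ⟨f₂, hf₂, h₂⟩ := Partial.attach_reserve hR (A \ A₁) h₁ (by omega)
    (hA.step hA₁ sdiff_subset disjoint_sdiff)
  refine ⟨f₂, fun v hv => by rw [hf₂ v (mem_union_left _ hv), hf₁ v hv], ?_⟩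
  rw [union_assoc, union_sdiff_of_subset hA₁] at h₂
  exact h₂.mono subset_rfl subset_rfl (by omega)

/-- Attach a set of vertices by successive rounds. -/
lemma Partial.attach_rounds {Us : ℕ → Finset V} {Us' : ℕ → Finset Z} {g cap Δ η R : ℕ}
    (hrounds : Rounds α χ V₀ B Z₀ Us Us' g cap Δ η) (hcap : 0 < cap)
    (hUs : ∀ i, Us i ⊆ Us (i + 1)) (hUs' : ∀ i, Us' i ⊆ Us' (i + 1))
    (hR : ReserveEdge χ V₀ B Z₀ R) (r₀ : ℕ) (hr₀ : r₀ + η * g ≤ R) (n : ℕ) :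
    ∀ {D : Finset α} {f : α → V} {i : ℕ} (A : Finset α), #A ≤ n →
      Partial χ root par V₀ B Z₀ D f (Us i) (Us' i) (r₀ + η * i) →
      Attachable root par D A → (∀ y, #(A.filter fun v => f (par v) = y) ≤ Δ) →
      cap * i + #A + cap ≤ cap * g →
      ∃ f' i', (∀ v ∈ D, f' v = f v) ∧ cap * i' ≤ cap * i + #A + cap ∧
        Partial χ root par V₀ B Z₀ (D ∪ A) f' (Us i') (Us' i') (r₀ + η * i') := by
  have hone : ∀ {D : Finset α} {f : α → V} {i : ℕ} (A : Finset α), #A ≤ cap → A.Nonempty →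
      Partial χ root par V₀ B Z₀ D f (Us i) (Us' i) (r₀ + η * i) →
      Attachable root par D A → (∀ y, #(A.filter fun v => f (par v) = y) ≤ Δ) →
      cap * i + #A + cap ≤ cap * g →
      ∃ f', (∀ v ∈ D, f' v = f v) ∧
        Partial χ root par V₀ B Z₀ (D ∪ A) f' (Us (i + 1)) (Us' (i + 1)) (r₀ + η * (i + 1)) := by
    intro D f i A hAc hAn h hA hmult hg
    have hig : i < g := by
      by_contra hcon
      have := Nat.mul_le_mul_left cap (not_lt.1 hcon)
      omega
    obtain ⟨A₁, hA₁, φ, hφ, hv, hφc, hc, hη⟩ := hrounds i hig A (fun v => f (par v)) hAc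
      (fun v hv => h.avoid _ (hA v hv).2.2.1) hmult
    have h1 : r₀ + η * i + η ≤ r₀ + η * g := by
      have := Nat.mul_le_mul_left η hig
      rw [Nat.succ_eq_add_one, mul_add, mul_one] at this
      omega
    have := h.attach_almost hR hA hA₁ φ _ _ (hUs i) (hUs' i) hφ hv hφc hc hη (h1.trans hr₀)
    rwa [show r₀ + η * i + η = r₀ + η * (i + 1) by ring] at this
  induction n with
  | zero =>
    intro D f i A hA h _ _ _
    have : A = ∅ := by simpa using hA
    subst this
    exact ⟨f, i, fun _ _ => rfl, by omega, by simpa using h⟩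
  | succ n ih =>
    intro D f i A hAn h hA hmult hg
    rcases A.eq_empty_or_nonempty with rfl | hne
    · exact ⟨f, i, fun _ _ => rfl, by omega, by simpa using h⟩
    by_cases hAc : #A ≤ cap
    · obtain ⟨f', hf', h'⟩ := hone A hAc hne h hA hmult hg
      exact ⟨f', i + 1, hf', by rw [mul_add]; omega, h'⟩
    · obtain ⟨A', hA', hA'c⟩ := exists_subset_card_eq (not_le.1 hAc).le
      have hsd : #(A \ A') = #A - cap := by rw [card_sdiff_of_subset hA', hA'c]
      obtain ⟨f₁, hf₁, h₁⟩ := hone A' hA'c.le (card_pos.1 (by omega)) h (hA.subset hA')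
        (fun y => (card_le_card (filter_subset_filter _ hA')).trans (hmult y)) (by omega)
      obtain ⟨f₂, i₂, hf₂, hi₂, h₂⟩ := ih (A \ A') (by omega) h₁
        (hA.step hA' sdiff_subset disjoint_sdiff) (fun y => by
          have : (A \ A').filter (fun v => f₁ (par v) = y) ⊆ A.filter fun v => f (par v) = y := by
            intro v hv
            obtain ⟨h3, h4⟩ := mem_filter.1 hv
            have hvA := (mem_sdiff.1 h3).1
            rw [hf₁ _ (hA v hvA).2.2.1] at h4
            exact mem_filter.2 ⟨hvA, h4⟩
          exact (card_le_card this).trans (hmult y)) (by rw [mul_add]; omega)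
      refine ⟨f₂, i₂, fun v hv => by rw [hf₂ v (mem_union_left _ hv), hf₁ v hv], ?_, ?_⟩
      · rw [mul_add] at hi₂
        omega
      · rwa [union_assoc, union_sdiff_of_subset hA'] at h₂

end

section

variable {α V Z : Type*} [Fintype α] [DecidableEq α] [DecidableEq V] [DecidableEq Z]
variable {χ : V → V → Z} {root : α} {par : α → α} {V₀ B : Finset V} {Z₀ : Finset Z}
  {f : α → V} {U : Finset V} {U' : Finset Z} {r : ℕ}
  {L : ℕ} {K Bs : Finset α} {ch : α → α} {st : α → ℕ}

/-- The vertices of stage at most `j`, together with `Star`. -/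
def upto (st : α → ℕ) (Star : Finset α) (j : ℕ) : Finset α :=
  univ.filter fun v => st v ≤ j ∨ v ∈ Star

lemma mem_upto {Star : Finset α} {j : ℕ} {v : α} : v ∈ upto st Star j ↔ st v ≤ j ∨ v ∈ Star := by
  simp [upto]

/-- Attach all connecting pairs. -/
lemma Partial.attach_pairs (S : Staging root par L K Bs ch st) {Big Star : Finset α}
    (hBig : Big ⊆ K) (hStar : ∀ v ∈ Star, st v ≠ L + 1 ∧ par v ∈ Big)
    (h : Partial χ root par V₀ B Z₀ (upto st Star L) f U U' r) {R : ℕ}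
    (hR : ReservePath χ V₀ B Z₀ R) (B' : Finset α) (hB' : B' ⊆ Bs) (hr : r + 3 * #B' ≤ R) :
    ∃ f', (∀ v ∈ upto st Star L, f' v = f v) ∧
      Partial χ root par V₀ B Z₀ (upto st Star L ∪ (B' ∪ B'.image par)) f' U U' (r + 3 * #B') := by
  induction B' using Finset.induction_on with
  | empty => exact ⟨f, fun _ _ => rfl, by simpa using h⟩
  | insert b B' hb ih =>
    rw [card_insert_of_notMem hb] at hr ⊢
    obtain ⟨f₁, hf₁, h₁⟩ := ih ((subset_insert _ _).trans hB') (by omega)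
    have hbB : b ∈ Bs := hB' (mem_insert_self _ _)
    have hB'' : ∀ v ∈ B', v ∈ Bs := fun v hv => hB' (mem_insert_of_mem hv)
    obtain ⟨l1, l2, l3, l4, l5⟩ := S.link b hbB
    have hstb : st b = L + 1 := (S.stage_link b).2 (Or.inl hbB)
    have hsta : st (par b) = L + 1 := (S.stage_link _).2 (Or.inr ⟨b, hbB, rfl⟩)
    set D := upto st Star L ∪ (B' ∪ B'.image par) with hD
    have hmemD : ∀ v, v ∈ D ↔ (st v ≤ L ∨ v ∈ Star) ∨ v ∈ B' ∨ ∃ b' ∈ B', par b' = v := by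
      intro v
      rw [hD, mem_union, mem_union, mem_upto, mem_image]
    have hDst : ∀ v ∈ D, v ∉ Star → st v ≤ L + 1 := by
      intro v hv hvS
      rcases (hmemD v).1 hv with (h1 | h1) | h1 | ⟨b', h1, h2⟩
      · omega
      · exact absurd h1 hvS
      · exact ((S.stage_link v).2 (Or.inl (hB'' v h1))).le
      · exact ((S.stage_link v).2 (Or.inr ⟨b', hB'' b' h1, h2⟩)).le
    have hnS : ∀ v, st (par v) = L + 1 → v ∉ Star := by
      intro v hv h1
      have := (S.stage_zero _).2 (hBig (hStar v h1).2)
      omega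
    have hex := h₁.attach_pair hR (by omega) b (ch b) ?_ ?_ ?_ ?_ ?_ l4 ?_ ?_
    · obtain ⟨f₂, hf₂, h₂⟩ := hex
      refine ⟨f₂, fun v hv => by rw [hf₂ v (mem_union_left _ hv), hf₁ v hv], ?_⟩
      have heq : upto st Star L ∪ (insert b B' ∪ (insert b B').image par) = D ∪ {b, par b} := by
        rw [hD]
        ext v
        simp only [mem_union, mem_insert, mem_image, mem_singleton]
        constructor
        · rintro (h3 | (h3 | h3) | ⟨a, h3 | h3, h4⟩)
          · tauto
          · tauto
          · tauto
          · subst h3; tauto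
          · exact Or.inl (Or.inr (Or.inr ⟨a, h3, h4⟩))
        · rintro ((h3 | h3 | ⟨a, h3, h4⟩) | h3 | h3)
          · tauto
          · tauto
          · exact Or.inr (Or.inr ⟨a, Or.inr h3, h4⟩)
          · tauto
          · exact Or.inr (Or.inr ⟨b, Or.inl rfl, h3.symm⟩)
      rw [heq, show r + 3 * (#B' + 1) = r + 3 * #B' + 3 by ring]
      exact h₂
    · rw [hmemD]
      rintro ((h3 | h3) | h3 | ⟨a, h3, h4⟩)
      · omega
      · exact (hStar b h3).1 hstb
      · exact hb h3
      · exact (S.link a (hB'' a h3)).1 (h4 ▸ hbB)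
    · rw [hmemD]
      rintro ((h3 | h3) | h3 | ⟨a, h3, h4⟩)
      · omega
      · exact (hStar _ h3).1 hsta
      · exact l1 (hB'' _ h3)
      · exact hb (S.link_inj (hB'' a h3) hbB h4 ▸ h3)
    · intro h3
      exact l1 (h3.symm ▸ hbB)
    · exact (hmemD _).2 (Or.inl (Or.inl l5))
    · exact (hmemD _).2 (Or.inl (Or.inl (by rw [(S.stage_zero _).2 l2]; omega)))
    · intro v hv hvp hne hvD
      have := S.link_top b hbB v hv hvp hne
      have h3 := hDst v hvD (hnS v (by rw [hvp, hsta]))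
      omega
    · intro v hv hvp hne hvD
      have := S.link_bot b hbB v hv hvp hne
      have h3 := hDst v hvD (hnS v (by rw [hvp, hstb]))
      omega

/-- The embedding is completed stage by stage, from a partial embedding of `K`, an almost complete
assignment of the children of `Big`, enough rounds and a robust reserve. -/
lemma exists_embedding (S : Staging root par L K Bs ch st) {Big : Finset α} (hBig : Big ⊆ K)
    {Δ : ℕ} (hΔ : ∀ u ∉ Big, #(univ.filter fun v => v ≠ root ∧ par v = u) ≤ Δ)
    {Us : ℕ → Finset V} {Us' : ℕ → Finset Z} (hUs : ∀ i, Us i ⊆ Us (i + 1))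
    (hUs' : ∀ i, Us' i ⊆ Us' (i + 1)) (hU : U ⊆ Us 0) (hU' : U' ⊆ Us' 0)
    (h : Partial χ root par V₀ B Z₀ K f U U' 0) {g cap η ηs R : ℕ}
    (hstar : ∃ A₁ ⊆ univ.filter fun v => (st v ≠ 0 ∧ st v ≠ L + 1) ∧ par v ∈ Big,
      ∃ φ : α → V, Set.InjOn φ A₁ ∧
      (∀ v ∈ A₁, φ v ∉ B ∧ φ v ∈ Us 0 ∧ φ v ∉ U ∧ φ v ∉ V₀) ∧
      Set.InjOn (fun v => χ (f (par v)) (φ v)) A₁ ∧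
      (∀ v ∈ A₁, χ (f (par v)) (φ v) ∈ Us' 0 ∧ χ (f (par v)) (φ v) ∉ U' ∧
        χ (f (par v)) (φ v) ∉ Z₀) ∧
      #((univ.filter fun v => (st v ≠ 0 ∧ st v ≠ L + 1) ∧ par v ∈ Big) \ A₁) ≤ ηs)
    (hrounds : Rounds α χ V₀ B Z₀ Us Us' g cap Δ η) (hcap : 0 < cap)
    (hg : Fintype.card α + 2 * L * cap ≤
      cap * g + #(univ.filter fun v => (st v ≠ 0 ∧ st v ≠ L + 1) ∧ par v ∈ Big))
    (hRe : ReserveEdge χ V₀ B Z₀ R) (hRp : ReservePath χ V₀ B Z₀ R)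
    (hR : ηs + 3 * #Bs + η * g ≤ R) :
    ∃ F : α → V, Function.Injective F ∧
      ∀ u v, u ≠ root → v ≠ root → edgeCol χ par F u = edgeCol χ par F v → u = v := by
  set Star := univ.filter fun v => (st v ≠ 0 ∧ st v ≠ L + 1) ∧ par v ∈ Big with hStar
  have hmS : ∀ v, v ∈ Star ↔ (st v ≠ 0 ∧ st v ≠ L + 1) ∧ par v ∈ Big := fun v => by
    simp [hStar]
  have hroot0 : st root = 0 := (S.stage_zero _).2 S.root_mem
  have hne : ∀ v, st v ≠ 0 → v ≠ root := fun v hv h' => hv (h' ▸ hroot0)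
  have hb0 : ∀ u ∈ Big, st u = 0 := fun u hu => (S.stage_zero u).2 (hBig hu)
  have hbase : ∃ f₁, Partial χ root par V₀ B Z₀ (upto st Star 0) f₁ (Us 0) (Us' 0) ηs := by
    obtain ⟨A₁, hA₁, φ, hφ, hv, hφc, hc, hη⟩ := hstar
    have hatt : Attachable root par K Star := by
      intro v hv
      obtain ⟨⟨h1, h2⟩, h3⟩ := (hmS v).1 hv
      refine ⟨fun h4 => h1 ((S.stage_zero v).2 h4), hne v h1, hBig h3, fun c hc hcv h4 => ?_⟩
      have := S.child v h1 h2 c hc hcv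
      rw [(S.stage_zero c).2 h4] at this
      omega
    obtain ⟨f₁, -, h₁⟩ := h.attach_almost hRe hatt hA₁ φ _ _ hU hU' hφ hv hφc hc hη (by omega)
    refine ⟨f₁, ?_⟩
    have : upto st Star 0 = K ∪ Star := by
      ext v
      rw [mem_upto, mem_union, Nat.le_zero, S.stage_zero]
    rw [this]
    simpa using h₁
  -- one ordinary stage
  have hstage : ∀ (r₀ j : ℕ), r₀ + η * g ≤ R → j + 1 ≠ L + 1 → j + 1 ≤ 2 * L →
      (∃ f₁ i, cap * i + #Star ≤ #(upto st Star j) + j * cap ∧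
        Partial χ root par V₀ B Z₀ (upto st Star j) f₁ (Us i) (Us' i) (r₀ + η * i)) →
      ∃ f₁ i, cap * i + #Star ≤ #(upto st Star (j + 1)) + (j + 1) * cap ∧
        Partial χ root par V₀ B Z₀ (upto st Star (j + 1)) f₁ (Us i) (Us' i) (r₀ + η * i) := by
    rintro r₀ j hr₀ hj hj2 ⟨f₁, i, hi, h₁⟩
    set A := univ.filter fun v => st v = j + 1 ∧ v ∉ Star with hA
    have hmA : ∀ v, v ∈ A ↔ st v = j + 1 ∧ v ∉ Star := fun v => by simp [hA]
    have hun : upto st Star (j + 1) = upto st Star j ∪ A := by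
      ext v
      rw [mem_union, mem_upto, mem_upto, hmA]
      by_cases hvS : v ∈ Star
      · simp [hvS]
      · simp only [hvS, or_false, not_false_eq_true, and_true]
        omega
    have hdisj : Disjoint (upto st Star j) A := by
      rw [disjoint_left]
      intro v hv hvA
      rw [mem_upto] at hv
      rw [hmA] at hvA
      rcases hv with hv | hv
      · omega
      · exact hvA.2 hv
    have hcard : #(upto st Star (j + 1)) = #(upto st Star j) + #A := by
      rw [hun, card_union_of_disjoint hdisj]
    have hatt : Attachable root par (upto st Star j) A := by
      intro v hv
      have hvA := (hmA v).1 hv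
      have h0 : st v ≠ 0 := by omega
      have h1 : st v ≠ L + 1 := by omega
      refine ⟨fun h2 => disjoint_left.1 hdisj h2 hv, hne v h0, ?_, fun c hc hcv h2 => ?_⟩
      · have := S.parent v h0 h1
        exact mem_upto.2 (Or.inl (by omega))
      · have h3 := S.child v h0 h1 c hc hcv
        rcases mem_upto.1 h2 with h4 | h4
        · omega
        · have h5 := hb0 _ ((hmS c).1 h4).2
          rw [hcv] at h5
          exact h0 h5
    have hmult : ∀ y, #(A.filter fun v => f₁ (par v) = y) ≤ Δ := by
      intro y
      rcases (A.filter fun v => f₁ (par v) = y).eq_empty_or_nonempty with he | ⟨v₀, hv₀⟩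
      · rw [he]; simp
      · obtain ⟨hv₀A, hv₀y⟩ := mem_filter.1 hv₀
        have hnb : par v₀ ∉ Big := by
          intro h2
          have h3 := (hmA v₀).1 hv₀A
          exact h3.2 ((hmS v₀).2 ⟨⟨by omega, by omega⟩, h2⟩)
        refine (card_le_card ?_).trans (hΔ _ hnb)
        intro v hv
        obtain ⟨hvA, hvy⟩ := mem_filter.1 hv
        refine mem_filter.2 ⟨mem_univ _, (hatt v hvA).2.1, ?_⟩
        exact h₁.inj (hatt v hvA).2.2.1 (hatt v₀ hv₀A).2.2.1 (hvy.trans hv₀y.symm)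
    have hle : #(upto st Star j) + #A ≤ Fintype.card α := by
      rw [← hcard]
      exact card_le_univ _
    have hjL : (j + 1) * cap ≤ 2 * L * cap := Nat.mul_le_mul_right _ hj2
    rw [add_mul, one_mul] at hjL
    obtain ⟨f₂, i₂, -, hi₂, h₂⟩ := Partial.attach_rounds hrounds hcap hUs hUs' hRe r₀ hr₀ #A A
      le_rfl h₁ hatt hmult (by omega)
    refine ⟨f₂, i₂, ?_, ?_⟩
    · rw [hcard, add_mul, one_mul]
      omega
    · rw [hun]
      exact h₂
  have hfirst : ∀ j, j ≤ L → ∃ f₁ i, cap * i + #Star ≤ #(upto st Star j) + j * cap ∧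
      Partial χ root par V₀ B Z₀ (upto st Star j) f₁ (Us i) (Us' i) (ηs + η * i) := by
    intro j
    induction j with
    | zero =>
      intro _
      obtain ⟨f₁, h₁⟩ := hbase
      refine ⟨f₁, 0, ?_, by simpa using h₁⟩
      have : #Star ≤ #(upto st Star 0) := card_le_card fun v hv => mem_upto.2 (Or.inr hv)
      omega
    | succ j ih =>
      intro hj
      exact hstage ηs j (by omega) (by omega) (by omega) (ih (by omega))
  have hlink : ∃ f₁ i, cap * i + #Star ≤ #(upto st Star (L + 1)) + (L + 1) * cap ∧
      Partial χ root par V₀ B Z₀ (upto st Star (L + 1)) f₁ (Us i) (Us' i)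
        (ηs + 3 * #Bs + η * i) := by
    obtain ⟨f₁, i, hi, h₁⟩ := hfirst L le_rfl
    have hig : i ≤ g := by
      have h2 : #(upto st Star L) ≤ Fintype.card α := card_le_univ _
      have h3 : L * cap ≤ 2 * L * cap := Nat.mul_le_mul_right _ (by omega)
      exact Nat.le_of_mul_le_mul_left (by omega : cap * i ≤ cap * g) hcap
    have h4 := Nat.mul_le_mul_left η hig
    obtain ⟨f₂, -, h₂⟩ := h₁.attach_pairs S hBig (fun v hv => ⟨((hmS v).1 hv).1.2,
      ((hmS v).1 hv).2⟩) hRp Bs subset_rfl (by omega)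
    have hun : upto st Star (L + 1) = upto st Star L ∪ (Bs ∪ Bs.image par) := by
      ext v
      rw [mem_union, mem_union, mem_upto, mem_upto, mem_image, ← S.stage_link v]
      by_cases hvS : v ∈ Star
      · simp [hvS]
      · simp only [hvS, or_false]
        omega
    refine ⟨f₂, i, ?_, ?_⟩
    · have h5 : #(upto st Star L) ≤ #(upto st Star (L + 1)) := by
        rw [hun]
        exact card_le_card subset_union_left
      rw [add_mul]
      omega
    · rw [hun]
      exact h₂.mono subset_rfl subset_rfl (by omega)
  have hlast : ∀ j, L + 1 + j ≤ 2 * L + 1 → ∃ f₁ i, 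
      cap * i + #Star ≤ #(upto st Star (L + 1 + j)) + (L + 1 + j) * cap ∧
      Partial χ root par V₀ B Z₀ (upto st Star (L + 1 + j)) f₁ (Us i) (Us' i)
        (ηs + 3 * #Bs + η * i) := by
    intro j
    induction j with
    | zero => intro _; exact hlink
    | succ j ih =>
      intro hj
      by_cases hjL : L + 1 + j + 1 ≤ 2 * L
      · exact hstage _ (L + 1 + j) hR (by omega) hjL (ih (by omega))
      · obtain ⟨f₁, i, hi, h₁⟩ := ih (by omega)
        have heq : upto st Star (L + 1 + (j + 1)) = upto st Star (L + 1 + j) := by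
          ext v
          have := S.stage_le v
          rw [mem_upto, mem_upto]
          have h1 : st v ≤ L + 1 + (j + 1) := by omega
          have h2 : st v ≤ L + 1 + j := by omega
          simp [h1, h2]
        rw [heq]
        refine ⟨f₁, i, hi.trans (Nat.add_le_add_left (Nat.mul_le_mul_right _ (by omega)) _), h₁⟩
  obtain ⟨F, i, -, hF⟩ := hlast L (by omega)
  have huniv : ∀ v, v ∈ upto st Star (L + 1 + L) := fun v =>
    mem_upto.2 (Or.inl ((S.stage_le v).trans (by omega)))
  refine ⟨F, fun u v huv => hF.inj (huniv u) (huniv v) huv, fun u v hu hv huv => ?_⟩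
  exact hF.rainbow (mem_edgesIn.2 ⟨huniv u, hu, huniv _⟩) (mem_edgesIn.2 ⟨huniv v, hv, huniv _⟩)
    huv

end

section

variable {V Z : Type*} [Fintype V] [DecidableEq V] [Fintype Z] [DecidableEq Z]

omit [Fintype Z] in
/-- Neighbours remaining after excluding few vertices and colours. -/
lemma card_le_card_available (χ : V → V → Z) (k : ℕ)
    (hk : ∀ x z, #(univ.filter fun v => v ≠ x ∧ χ x v = z) ≤ k) (V₀ : Finset V) (Z₀ : Finset Z)
    (x : V) (B X : Finset V) (Y : Finset Z) :
    #(univ.filter fun v => v ≠ x ∧ v ∈ V₀ ∧ χ x v ∈ Z₀) ≤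
      #(univ.filter fun v => (v ≠ x ∧ v ∈ V₀ ∧ χ x v ∈ Z₀) ∧ v ∉ B ∧ v ∉ X ∧ χ x v ∉ Y) +
        (#B + #X + #Y * k) := by
  have h1 : (univ.filter fun v => v ≠ x ∧ v ∈ V₀ ∧ χ x v ∈ Z₀) ⊆
      (univ.filter fun v => (v ≠ x ∧ v ∈ V₀ ∧ χ x v ∈ Z₀) ∧ v ∉ B ∧ v ∉ X ∧ χ x v ∉ Y) ∪
        (B ∪ X ∪ univ.filter fun v => v ≠ x ∧ χ x v ∈ Y) := by
    intro v hv
    simp only [mem_filter, mem_univ, true_and, mem_union] at hv ⊢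
    by_cases hB : v ∈ B
    · exact Or.inr (Or.inl (Or.inl hB))
    by_cases hX : v ∈ X
    · exact Or.inr (Or.inl (Or.inr hX))
    by_cases hY : χ x v ∈ Y
    · exact Or.inr (Or.inr ⟨hv.1, hY⟩)
    · exact Or.inl ⟨hv, hB, hX, hY⟩
  refine (card_le_card h1).trans ((card_union_le _ _).trans (Nat.add_le_add_left ?_ _))
  exact (card_union_le _ _).trans (Nat.add_le_add (card_union_le _ _) (card_colours_le χ k hk x Y))

omit [Fintype Z] in
lemma reserveEdge_of_card (χ : V → V → Z) (k R : ℕ)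
    (hk : ∀ x z, #(univ.filter fun v => v ≠ x ∧ χ x v = z) ≤ k) (V₀ B : Finset V) (Z₀ : Finset Z)
    (h : ∀ x, x ∉ B → #B + R + R * k < #(univ.filter fun v => v ≠ x ∧ v ∈ V₀ ∧ χ x v ∈ Z₀)) :
    ReserveEdge χ V₀ B Z₀ R := by
  intro x hx X Y hX hY
  have h1 := card_le_card_available χ k hk V₀ Z₀ x B X Y
  have h2 := h x hx
  have h3 := Nat.mul_le_mul_right k hY
  have h4 : 0 < #(univ.filter fun v => (v ≠ x ∧ v ∈ V₀ ∧ χ x v ∈ Z₀) ∧ v ∉ B ∧ v ∉ X ∧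
      χ x v ∉ Y) := by omega
  obtain ⟨v, hv⟩ := card_pos.1 h4
  simp only [mem_filter, mem_univ, true_and] at hv
  exact ⟨v, hv.1.2.1, hv.2.1, hv.2.2.1, hv.1.2.2, hv.2.2.2⟩

omit [Fintype Z] in
lemma reservePath_of_colour (χ : V → V → Z) (k R : ℕ) (hsymm : ∀ x v, χ x v = χ v x)
    (hk : ∀ x z, #(univ.filter fun v => v ≠ x ∧ χ x v = z) ≤ k) (V₀ B : Finset V) (Z₀ : Finset Z)
    (s γ β : ℝ) (hs : 0 ≤ s) (hγ : 0 ≤ γ) (hγ1 : γ ≤ 1) (hβ : 0 ≤ β)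
    (h : ∀ x, x ∉ B → s + (#B + R + R * k : ℕ) ≤
      #(univ.filter fun v => v ≠ x ∧ v ∈ V₀ ∧ χ x v ∈ Z₀))
    (hcol : ∀ a b : V → ℝ, |∑ x, ∑ v, a x * b v * ((if v ≠ x then (1 : ℝ) else 0) *
      ((if χ x v ∈ Z₀ then 1 else 0) - γ))| ≤ β * nrm a * nrm b)
    (hs2 : β * Fintype.card V + Fintype.card V * (R * k + 3 * k + 1 : ℝ) < γ * s ^ 2) :
    ReservePath χ V₀ B Z₀ R := by
  intro x y hx hy X Y hX hY
  have hav : ∀ x, x ∉ B → s ≤ #(univ.filter fun v =>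
      (v ≠ x ∧ v ∈ V₀ ∧ χ x v ∈ Z₀) ∧ v ∉ B ∧ v ∉ X ∧ χ x v ∉ Y) := by
    intro x hx
    have h1 := card_le_card_available χ k hk V₀ Z₀ x B X Y
    have h2 := h x hx
    have h3 : #B + #X + #Y * k ≤ #B + R + R * k :=
      Nat.add_le_add (Nat.add_le_add_left hX _) (Nat.mul_le_mul_right k hY)
    have h4 : (#(univ.filter fun v => v ≠ x ∧ v ∈ V₀ ∧ χ x v ∈ Z₀) : ℝ) ≤
        #(univ.filter fun v => (v ≠ x ∧ v ∈ V₀ ∧ χ x v ∈ Z₀) ∧ v ∉ B ∧ v ∉ X ∧ χ x v ∉ Y) +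
        (#B + R + R * k : ℕ) := by exact_mod_cast h1.trans (Nat.add_le_add_left h3 _)
    linarith
  set S := univ.filter fun v => (v ≠ x ∧ v ∈ V₀ ∧ χ x v ∈ Z₀) ∧ v ∉ B ∧ v ∉ X ∧ χ x v ∉ Y with hS
  set T := univ.filter fun v => (v ≠ y ∧ v ∈ V₀ ∧ χ y v ∈ Z₀) ∧ v ∉ B ∧ v ∉ X ∧ χ y v ∉ Y with hT
  have hSs : s ≤ #S := hav x hx
  have hTs : s ≤ #T := hav y hy
  have hSn : (#S : ℝ) ≤ Fintype.card V := Nat.cast_le.2 (card_le_univ S)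
  have hTn : (#T : ℝ) ≤ Fintype.card V := Nat.cast_le.2 (card_le_univ T)
  have hex : ∃ v ∈ S, ∃ w ∈ T, w ≠ v ∧ χ v w ∈ Z₀ ∧ χ v w ∉ Y ∧ χ v w ≠ χ x v ∧
      χ v w ≠ χ y w ∧ χ y w ≠ χ x v := by
    by_contra hno
    push Not at hno
    have h1 := (neg_le_abs _).trans (hcol (fun v => if v ∈ S then 1 else 0)
      (fun v => if v ∈ T then 1 else 0))
    rw [nrm_indicator, nrm_indicator] at h1
    have h2 : β * √(#S : ℝ) * √(#T : ℝ) ≤ β * Fintype.card V := by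
      rw [mul_assoc]
      refine mul_le_mul_of_nonneg_left ?_ hβ
      have hle1 := Real.sqrt_le_sqrt hSn
      have hle2 := Real.sqrt_le_sqrt hTn
      calc _ ≤ √(Fintype.card V : ℝ) * √(Fintype.card V : ℝ) :=
            mul_le_mul hle1 hle2 (Real.sqrt_nonneg _) (Real.sqrt_nonneg _)
        _ = _ := Real.mul_self_sqrt (Nat.cast_nonneg _)
    -- pairs excluded for each reason
    have h3 : ∑ v, ∑ w, (if v ∈ S then (1 : ℝ) else 0) * (if w ∈ T then 1 else 0) *
        ((if w ≠ v then (1 : ℝ) else 0) * (if χ v w ∈ Z₀ then 1 else 0)) ≤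
        Fintype.card V * (R * k + 3 * k : ℝ) := by
      have h4 : ∀ v w, (if v ∈ S then (1 : ℝ) else 0) * (if w ∈ T then 1 else 0) *
          ((if w ≠ v then (1 : ℝ) else 0) * (if χ v w ∈ Z₀ then 1 else 0)) ≤
          (if w ≠ v ∧ χ v w ∈ Y then 1 else 0) + (if w ≠ v ∧ χ v w = χ x v then 1 else 0) +
          (if v ≠ w ∧ χ w v = χ y w then 1 else 0) + (if w ≠ y ∧ χ y w = χ x v then 1 else 0) := by
        intro v w
        by_cases hv : v ∈ S
        swap
        · rw [if_neg hv, zero_mul, zero_mul]; positivity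
        by_cases hw : w ∈ T
        swap
        · rw [if_neg hw, mul_zero, zero_mul]; positivity
        by_cases hvw : w ≠ v
        swap
        · rw [if_neg hvw, zero_mul, mul_zero]; positivity
        by_cases hZ : χ v w ∈ Z₀
        swap
        · rw [if_neg hZ, mul_zero, mul_zero]; positivity
        have hwy : w ≠ y := by
          have := (mem_filter.1 hw).2
          exact this.1.1
        have := hno v hv w hw hvw hZ
        rw [if_pos hv, if_pos hw, if_pos hvw, if_pos hZ]
        have hsw := hsymm w v
        by_cases c1 : χ v w ∈ Y
        · rw [if_pos (⟨hvw, c1⟩ : w ≠ v ∧ χ v w ∈ Y)]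
          have : (0 : ℝ) ≤ (if w ≠ v ∧ χ v w = χ x v then 1 else 0) +
            (if v ≠ w ∧ χ w v = χ y w then 1 else 0) +
            (if w ≠ y ∧ χ y w = χ x v then 1 else 0) := by positivity
          linarith
        by_cases c2 : χ v w = χ x v
        · rw [if_pos (⟨hvw, c2⟩ : w ≠ v ∧ χ v w = χ x v)]
          have : (0 : ℝ) ≤ (if w ≠ v ∧ χ v w ∈ Y then 1 else 0) +
            (if v ≠ w ∧ χ w v = χ y w then 1 else 0) +
            (if w ≠ y ∧ χ y w = χ x v then 1 else 0) := by positivity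
          linarith
        by_cases c3 : χ v w = χ y w
        · rw [if_pos (⟨hvw.symm, hsw.trans c3⟩ : v ≠ w ∧ χ w v = χ y w)]
          have : (0 : ℝ) ≤ (if w ≠ v ∧ χ v w ∈ Y then 1 else 0) +
            (if w ≠ v ∧ χ v w = χ x v then 1 else 0) +
            (if w ≠ y ∧ χ y w = χ x v then 1 else 0) := by positivity
          linarith
        · rw [if_pos (⟨hwy, this c1 c2 c3⟩ : w ≠ y ∧ χ y w = χ x v)]
          have : (0 : ℝ) ≤ (if w ≠ v ∧ χ v w ∈ Y then 1 else 0) +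
            (if w ≠ v ∧ χ v w = χ x v then 1 else 0) +
            (if v ≠ w ∧ χ w v = χ y w then 1 else 0) := by positivity
          linarith
      have h5 : ∀ v z, ∑ w, (if w ≠ v ∧ χ v w = z then (1 : ℝ) else 0) ≤ k := by
        intro v z
        rw [sum_boole]
        exact Nat.cast_le.2 (hk v z)
      have h6 : ∀ v, ∑ w, (if w ≠ v ∧ χ v w ∈ Y then (1 : ℝ) else 0) ≤ R * k := by
        intro v
        rw [sum_boole]
        exact_mod_cast (card_colours_le χ k hk v Y).trans (Nat.mul_le_mul_right k hY)
      calc _ ≤ ∑ v, ∑ w, ((if w ≠ v ∧ χ v w ∈ Y then (1 : ℝ) else 0) +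
          (if w ≠ v ∧ χ v w = χ x v then 1 else 0) +
          (if v ≠ w ∧ χ w v = χ y w then 1 else 0) + (if w ≠ y ∧ χ y w = χ x v then 1 else 0)) :=
            sum_le_sum fun v _ => sum_le_sum fun w _ => h4 v w
        _ = ∑ v, ∑ w, (if w ≠ v ∧ χ v w ∈ Y then (1 : ℝ) else 0) +
          ∑ v, ∑ w, (if w ≠ v ∧ χ v w = χ x v then (1 : ℝ) else 0) +
          ∑ w, ∑ v, (if v ≠ w ∧ χ w v = χ y w then (1 : ℝ) else 0) +
          ∑ v, ∑ w, (if w ≠ y ∧ χ y w = χ x v then (1 : ℝ) else 0) := by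
            simp only [sum_add_distrib]
            congr 2
            exact sum_comm
        _ ≤ ∑ v : V, (R * k : ℝ) + ∑ v : V, (k : ℝ) + ∑ w : V, (k : ℝ) + ∑ v : V, (k : ℝ) :=
            add_le_add (add_le_add (add_le_add (sum_le_sum fun v _ => h6 v)
              (sum_le_sum fun v _ => h5 v _)) (sum_le_sum fun v _ => h5 v _))
              (sum_le_sum fun v _ => h5 y _)
        _ = _ := by
            simp only [sum_const, card_univ, nsmul_eq_mul]
            ring
    have h7 : γ * (#S * #T - Fintype.card V) ≤
        γ * ∑ v, ∑ w, (if v ∈ S then (1 : ℝ) else 0) * (if w ∈ T then 1 else 0) *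
          (if w ≠ v then (1 : ℝ) else 0) := by
      refine mul_le_mul_of_nonneg_left ?_ hγ
      have h8 : (#S * #T : ℝ) = ∑ v, ∑ w, (if v ∈ S then (1 : ℝ) else 0) *
          (if w ∈ T then 1 else 0) := by
        rw [← Fintype.sum_mul_sum]
        simp
      have h9 : (Fintype.card V : ℝ) = ∑ v : V, ∑ w, if w = v then (1 : ℝ) else 0 := by simp
      rw [h8, h9, ← sum_sub_distrib]
      refine sum_le_sum fun v _ => ?_
      rw [← sum_sub_distrib]
      refine sum_le_sum fun w _ => ?_
      split_ifs <;> norm_num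
    have h10 : -∑ v, ∑ w, (if v ∈ S then (1 : ℝ) else 0) * (if w ∈ T then 1 else 0) *
        ((if w ≠ v then (1 : ℝ) else 0) * ((if χ v w ∈ Z₀ then 1 else 0) - γ)) =
        γ * ∑ v, ∑ w, (if v ∈ S then (1 : ℝ) else 0) * (if w ∈ T then 1 else 0) *
          (if w ≠ v then (1 : ℝ) else 0) -
        ∑ v, ∑ w, (if v ∈ S then (1 : ℝ) else 0) * (if w ∈ T then 1 else 0) *
        ((if w ≠ v then (1 : ℝ) else 0) * (if χ v w ∈ Z₀ then 1 else 0)) := by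
      rw [mul_sum, ← sum_neg_distrib, ← sum_sub_distrib]
      refine sum_congr rfl fun v _ => ?_
      rw [mul_sum, ← sum_neg_distrib, ← sum_sub_distrib]
      refine sum_congr rfl fun w _ => ?_
      ring
    rw [h10] at h1
    have h11 : γ * s ^ 2 ≤ γ * (#S * #T) := by
      refine mul_le_mul_of_nonneg_left ?_ hγ
      rw [sq]
      exact mul_le_mul hSs hTs hs (Nat.cast_nonneg _)
    have h12 : γ * (Fintype.card V : ℝ) ≤ Fintype.card V := by
      have : (0 : ℝ) ≤ Fintype.card V := Nat.cast_nonneg _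
      nlinarith
    rw [mul_sub] at h7
    linarith [h1, h2, h3, h7, h11, h12, hs2]
  obtain ⟨v, hv, w, hw, hwv, hZ, hY, h1, h2, h3⟩ := hex
  simp only [hS, hT, mem_filter, mem_univ, true_and] at hv hw
  have hyw := hsymm y w
  rw [hyw] at hw h2 h3
  exact ⟨v, hv.1.2.1, w, hw.1.2.1, hwv.symm, ⟨hv.2.1, hv.2.2.1⟩, ⟨hw.2.1, hw.2.2.1⟩,
    ⟨hv.1.2.2, hv.2.2.2⟩, ⟨hZ, hY⟩, ⟨hw.1.2.2, hw.2.2.2⟩, h1.symm, h3.symm, h2⟩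

end

/-- A small random-like reserve of vertices and colours. -/
lemma exists_reserve (k g : ℕ) (hk0 : 1 ≤ k) (hg : 1 ≤ g) (γ : ℝ) (hγ : γ = 1 / 2 ^ g) :
    ∃ n₀ : ℕ, ∀ (V Z : Type) [Fintype V] [DecidableEq V] [Fintype Z] [DecidableEq Z]
      (χ : V → V → Z), (∀ x v, χ x v = χ v x) →
      (∀ x z, #(univ.filter fun v => v ≠ x ∧ χ x v = z) ≤ k) → n₀ ≤ Fintype.card V →
      ∃ (V₀ B : Finset V) (Z₀ : Finset Z), (#V₀ : ℝ) ≤ 2 * γ * Fintype.card V ∧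
        (#B : ℝ) ≤ γ ^ 2 / 8 * Fintype.card V ∧
        (∀ x, x ∉ B → (#(univ.filter fun v => v ≠ x ∧ χ x v ∈ Z₀) : ℝ) ≤
          2 * γ * Fintype.card V) ∧
        ∀ R : ℕ, ((k + 1) * R : ℝ) ≤ γ ^ 5 / 32 * Fintype.card V →
          ReserveEdge χ V₀ B Z₀ R ∧ ReservePath χ V₀ B Z₀ R := by
  have hγ0 : 0 < γ := by rw [hγ]; positivity
  have hγ1 : γ ≤ 1 := by
    rw [hγ, div_le_one (by positivity)]
    exact one_le_pow₀ (by norm_num)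
  obtain ⟨θ, hθ⟩ : ∃ θ : ℝ, θ = γ ^ 5 / 64 := ⟨_, rfl⟩
  have hθ0 : 0 < θ := by rw [hθ]; positivity
  have hg0 : (0 : ℝ) < g := by exact_mod_cast hg
  have hev : ∀ C : ℝ, ∀ᶠ n : ℕ in Filter.atTop, C ≤ (n : ℝ) := fun C =>
    tendsto_natCast_atTop_atTop.eventually_ge_atTop C
  obtain ⟨n₀, hn₀⟩ := Filter.eventually_atTop.1 ((hev (7 * (1 * k * (2 * k + k ^ 2)) / (θ / g) ^ 4)).and
    ((hev (7 / (θ / g) ^ 2)).and ((hev ((3 * k + 1) / (γ ^ 5 / 16))).and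
    ((hev (1 / (γ ^ 2 / 8))).and (hev 2)))))
  refine ⟨n₀, fun V Z _ _ _ _ χ hsymm hk hcard => ?_⟩
  obtain ⟨h1, h2, h3, h4, h5⟩ := hn₀ _ hcard
  set n : ℝ := (Fintype.card V : ℝ) with hn
  have hn0 : 0 < n := by linarith
  rw [div_le_iff₀ (by positivity)] at h1 h2 h3 h4
  have hne : Nonempty V := by
    rw [← Fintype.card_pos_iff]
    exact Nat.cast_pos.1 hn0
  set S : SlotSystem V Z (Fin (2 ^ g)) Bool Unit :=
    { dom := fun _ => ∅
      mt := fun _ v => χ v v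
      inj := fun _ => by simp
      lab := fun _ => ()
      grp := fun s => decide (s = 0) } with hS
  have hbal := S.exists_balanced χ k 1 hk0 le_rfl hsymm hk
    (fun x v => if v ≠ x then 1 else 0)
    (fun x v => by by_cases h : x = v <;> simp [h, eq_comm])
    (θ / g * n) _ (by positivity) ?_ ?_ le_rfl g (List.finRange (2 ^ g)) (by simp)
  rotate_left
  · rw [Fintype.card_bool]
    calc _ = 7 * (1 * k * (2 * k + k ^ 2)) * n ^ 3 := by push_cast; ring
      _ ≤ (n * (θ / g) ^ 4) * n ^ 3 := mul_le_mul_of_nonneg_right h1 (by positivity)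
      _ = _ := by ring
  · rw [Fintype.card_bool]
    calc _ = 7 * n := by push_cast; ring
      _ ≤ (n * (θ / g) ^ 2) * n := mul_le_mul_of_nonneg_right h2 (by positivity)
      _ = _ := by ring
  obtain ⟨τ, τ', hb⟩ := hbal
  have hβ : (g : ℝ) * (θ / g * n) = θ * n := by field_simp
  have hα : ((List.finRange (2 ^ g)).map fun s => if S.grp s = true then (1 : ℝ) else 0).sum
      / 2 ^ g = γ := by
    rw [← Fin.sum_univ_def, hγ]
    simp [hS]
  have hcol := hb.colour true
  have hdeg := hb.degree true
  simp only [hα, hβ] at hcol hdeg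
  set Z₀ : Finset Z := univ.filter fun z => S.grp (τ' z) = true with hZ₀
  set V₀ : Finset V := univ.filter fun v => S.grp (τ v) = true with hV₀
  have hmZ : ∀ z, S.grp (τ' z) = true ↔ z ∈ Z₀ := fun z => by simp [hZ₀]
  have hmV : ∀ v, S.grp (τ v) = true ↔ v ∈ V₀ := fun z => by simp [hV₀]
  simp only [hmZ] at hcol
  simp only [hmV] at hdeg
  have hrow : ∀ x : V, ∑ v, (if v ≠ x then (1 : ℝ) else 0) = n - 1 := by
    intro x
    rw [sum_boole, filter_ne', card_erase_of_mem (mem_univ _), card_univ,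
      Nat.cast_sub Fintype.card_pos]
    simp [hn]
  have hbad1 := card_bad_rows χ (fun x v => v ≠ x) (fun v => v ∈ V₀) (fun z => z ∈ Z₀) γ (θ * n)
    (γ ^ 2 / 8 * n) (by positivity) hγ0.le hγ1 (by positivity) hcol hdeg
  have hbad2 := card_bad_vertices χ (fun x v => v ≠ x) (fun z => z ∈ Z₀) γ (θ * n) (γ * n)
    (fun _ => 1) (by positivity) hγ0.le (fun _ => zero_le_one) hcol
  set B₁ := univ.filter fun y => (∑ v, if v ≠ y ∧ v ∈ V₀ ∧ χ y v ∈ Z₀ then (1 : ℝ) else 0) <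
      γ ^ 2 * (∑ v, if v ≠ y then 1 else 0) - γ ^ 2 / 8 * n with hB₁
  set B₂ := univ.filter fun v => γ * ∑ y : V, 1 + γ * n < ∑ y, 1 * if v ≠ y ∧ χ y v ∈ Z₀
    then (1 : ℝ) else 0 with hB₂
  have hB : (#(B₁ ∪ B₂) : ℝ) ≤ γ ^ 2 / 8 * n := by
    have c1 : (#(B₁ ∪ B₂) : ℝ) ≤ #B₁ + #B₂ := by exact_mod_cast card_union_le _ _
    have c2 : 4 * (θ * n) ^ 2 * n / (γ ^ 2 / 8 * n) ^ 2 = γ ^ 6 / 16 * n := by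
      rw [hθ]; field_simp; ring
    have c3 : (θ * n * nrm (fun _ : V => (1 : ℝ))) ^ 2 / (γ * n) ^ 2 = γ ^ 8 / 4096 * n := by
      rw [mul_pow, nrm_sq, hθ]
      simp only [one_pow, sum_const, card_univ, nsmul_eq_mul, mul_one, ← hn]
      field_simp
      ring
    rw [c2] at hbad1
    rw [c3] at hbad2
    have c4 : γ ^ 6 ≤ γ ^ 2 := pow_le_pow_of_le_one hγ0.le hγ1 (by norm_num)
    have c5 : γ ^ 8 ≤ γ ^ 2 := pow_le_pow_of_le_one hγ0.le hγ1 (by norm_num)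
    have c6 := mul_le_mul_of_nonneg_right c4 hn0.le
    have c7 := mul_le_mul_of_nonneg_right c5 hn0.le
    have c8 : 0 ≤ γ ^ 2 * n := by positivity
    linarith
  have hgood : ∀ x, x ∉ B₁ ∪ B₂ → γ ^ 2 * (n - 1) - γ ^ 2 / 8 * n ≤
      #(univ.filter fun v => v ≠ x ∧ v ∈ V₀ ∧ χ x v ∈ Z₀) := by
    intro x hx
    have c1 : x ∉ B₁ := fun h => hx (mem_union_left _ h)
    rw [hB₁] at c1
    simp only [mem_filter, mem_univ, true_and, not_lt] at c1
    rw [hrow, sum_boole] at c1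
    exact c1
  refine ⟨V₀, B₁ ∪ B₂, Z₀, ?_, hB, ?_, fun R hR => ?_⟩
  · have c1 := (le_abs_self _).trans (hdeg fun _ => 1)
    have c2 : ∑ x, ∑ v, (1 : ℝ) * ((if v ≠ x then (1 : ℝ) else 0) *
        ((if v ∈ V₀ then 1 else 0) - γ)) = (n - 1) * #V₀ - γ * (n * (n - 1)) := by
      have e1 : ∀ x v, (1 : ℝ) * ((if v ≠ x then (1 : ℝ) else 0) *
        ((if v ∈ V₀ then 1 else 0) - γ)) = (if v ∈ V₀ then 1 else 0) *
          (if v ≠ x then (1 : ℝ) else 0) - γ * (if v ≠ x then (1 : ℝ) else 0) := by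
        intro x v; ring
      simp only [e1, sum_sub_distrib, ← mul_sum, hrow]
      rw [sum_comm]
      have e2 : ∀ v : V, ∑ x, (if v ≠ x then (1 : ℝ) else 0) = n - 1 := by
        intro v
        rw [← hrow v]
        refine sum_congr rfl fun x _ => ?_
        simp only [ne_comm]
      simp only [← mul_sum, e2, ← sum_mul]
      simp only [sum_const, card_univ, nsmul_eq_mul, ← hn]
      simp
      ring
    have c3 : nrm (fun _ : V => (1 : ℝ)) = √n := by
      unfold nrm
      simp [hn]
    rw [c2, c3, mul_assoc, Real.mul_self_sqrt hn0.le] at c1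
    have c4 : θ ≤ γ / 4 := by
      rw [hθ]
      have : γ ^ 5 ≤ γ ^ 1 := pow_le_pow_of_le_one hγ0.le hγ1 (by norm_num)
      linarith
    have c5 : (n - 1) * (#V₀ : ℝ) ≤ (n - 1) * (2 * γ * n) := by
      have c6 := mul_le_mul_of_nonneg_right c4 (mul_nonneg hn0.le hn0.le)
      have c7 : 0 ≤ γ * n * (n - 2) := mul_nonneg (by positivity) (by linarith)
      nlinarith
    exact le_of_mul_le_mul_left c5 (by linarith)
  · intro x hx
    have c1 : x ∉ B₂ := fun h => hx (mem_union_right _ h)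
    rw [hB₂] at c1
    simp only [mem_filter, mem_univ, true_and, not_lt, one_mul] at c1
    rw [sum_boole] at c1
    have c2 : (univ.filter fun v => v ≠ x ∧ χ x v ∈ Z₀) =
        univ.filter fun y => x ≠ y ∧ χ y x ∈ Z₀ := by
      ext v
      simp only [mem_filter, mem_univ, true_and, hsymm x v, ne_comm]
    rw [c2]
    refine c1.trans ?_
    simp only [sum_const, card_univ, nsmul_eq_mul, ← hn]
    linarith
  · have hγ5 : γ ^ 5 ≤ γ ^ 2 := pow_le_pow_of_le_one hγ0.le hγ1 (by norm_num)
    have c0 := mul_le_mul_of_nonneg_right hγ5 hn0.le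
    have hs : ∀ x, x ∉ B₁ ∪ B₂ → γ ^ 2 / 2 * n + (#(B₁ ∪ B₂) + R + R * k : ℕ) ≤
        #(univ.filter fun v => v ≠ x ∧ v ∈ V₀ ∧ χ x v ∈ Z₀) := by
      intro x hx
      have c1 := hgood x hx
      push_cast
      have c3 : γ ^ 2 ≤ 1 := pow_le_one₀ hγ0.le hγ1
      linarith
    constructor
    · refine reserveEdge_of_card χ k R hk _ _ _ fun x hx => ?_
      have c1 := hs x hx
      have c2 : 0 < γ ^ 2 / 2 * n := by positivity
      have c3 : ((#(B₁ ∪ B₂) + R + R * k : ℕ) : ℝ) <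
        #(univ.filter fun v => v ≠ x ∧ v ∈ V₀ ∧ χ x v ∈ Z₀) := by linarith
      exact_mod_cast c3
    · refine reservePath_of_colour χ k R hsymm hk _ _ _ (γ ^ 2 / 2 * n) γ (θ * n) (by positivity)
        hγ0.le hγ1 (by positivity) hs hcol ?_
      have c1 : (R * k + 3 * k + 1 : ℝ) ≤ γ ^ 5 / 32 * n + n * (γ ^ 5 / 16) := by
        have : (0 : ℝ) ≤ R := Nat.cast_nonneg _
        linarith
      have c2 := mul_le_mul_of_nonneg_left c1 hn0.le
      have c3 : 0 < γ ^ 5 * n ^ 2 := by positivity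
      rw [← hn, hθ]
      nlinarith

section

variable {α V Z : Type*} [DecidableEq α] [DecidableEq V] [DecidableEq Z]

/-- Greedy rainbow embedding of a small set of vertices. -/
lemma exists_partial_greedy (χ : V → V → Z) (root : α) (par : α → α) (dep : α → ℕ)
    (hdep : ∀ v, v ≠ root → dep (par v) + 1 = dep v) (V₁ B V₀ : Finset V) (Z₁ Z₀ : Finset Z)
    (hV : Disjoint V₁ V₀) (hZ : Disjoint Z₁ Z₀) (R : ℕ) (hB : ∃ x, x ∉ B)
    (hR : ReserveEdge χ V₁ B Z₁ R) (K : Finset α) (hK : #K ≤ R) :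
    ∃ f : α → V, Partial χ root par V₀ B Z₀ K f (K.image f)
      ((edgesIn root par K).image (edgeCol χ par f)) 0 := by
  suffices h : ∃ f : α → V, Partial χ root par V₀ B Z₀ K f V₁ Z₁ 0 by
    obtain ⟨f, h⟩ := h
    exact ⟨f, h.inj, h.rainbow, h.avoid, fun v hv => mem_union_right _ (mem_image_of_mem f hv),
      fun v hv => mem_union_right _ (mem_image_of_mem _ hv), h.vcount, h.ccount⟩
  induction K using Finset.induction_on_max_value dep with
  | empty =>
    obtain ⟨x, -⟩ := hB
    refine ⟨fun _ => x, ?_⟩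
    constructor <;> simp [edgesIn]
  | insert u K hu hmax ih =>
    rw [card_insert_of_notMem hu] at hK
    obtain ⟨f, h⟩ := ih (by omega)
    have hx : ∃ x, x ∉ B ∧ (par u ∈ K → f (par u) = x) := by
      by_cases hp : par u ∈ K
      · exact ⟨f (par u), h.avoid _ hp, fun _ => rfl⟩
      · obtain ⟨x, hx⟩ := hB
        exact ⟨x, hx, fun h' => absurd h' hp⟩
    obtain ⟨x, hxB, hxp⟩ := hx
    have hc1 : #(K.image f) ≤ R := card_image_le.trans (by omega)
    have hc2 : #((edgesIn root par K).image (edgeCol χ par f)) ≤ R :=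
      card_image_le.trans ((card_filter_le _ _).trans (by omega))
    obtain ⟨y, hyV, hyB, hyX, hyZ, hyY⟩ := hR x hxB _ _ hc1 hc2
    have hf1 : ∀ v ∈ K, Function.update f u y v = f v := fun v hv =>
      Function.update_of_ne (fun h' : v = u => hu (h' ▸ hv)) _ _
    have hsd : insert u K \ K = {u} := by
      rw [insert_sdiff_of_notMem _ hu, sdiff_self]
      rfl
    have hcol : ∀ v ∈ (if u ≠ root ∧ par u ∈ K then ({u} : Finset α) else ∅), v = u ∧
        edgeCol χ par (Function.update f u y) v = χ x y := by
      intro v hv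
      split_ifs at hv with hp
      · rw [mem_singleton] at hv
        subst hv
        rw [edgeCol, hf1 _ hp.2, Function.update_self, hxp hp.2]
        exact ⟨rfl, rfl⟩
      · simp at hv
    have hex := h.extend (insert u K) (if u ≠ root ∧ par u ∈ K then {u} else ∅)
      (Function.update f u y) 0 hf1 ?_ ?_ ?_ ?_ ?_ ?_ ?_
    · exact ⟨_, hex⟩
    · intro v hv
      obtain ⟨h1, h2, h3⟩ := mem_edgesIn.1 hv
      have hd := hdep v h2
      rcases mem_insert.1 h1 with rfl | h1
      · have h4 : par v ∈ K := by
          rcases mem_insert.1 h3 with h4 | h4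
          · rw [h4] at hd
            omega
          · exact h4
        rw [if_pos ⟨h2, h4⟩]
        exact mem_union_right _ (mem_singleton_self _)
      · rcases mem_insert.1 h3 with h4 | h4
        · have := hmax v h1
          rw [h4] at hd
          omega
        · exact mem_union_left _ (mem_edgesIn.2 ⟨h1, h2, h4⟩)
    · rw [hsd]; simp
    · rw [hsd]
      intro v hv
      rw [mem_singleton.1 hv, Function.update_self]
      exact ⟨hyX, hyB, mem_union_right _ hyV⟩
    · intro v hv w hw _
      exact (hcol v hv).1.trans (hcol w hw).1.symm
    · intro v hv
      rw [(hcol v hv).2]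
      exact ⟨hyY, mem_union_right _ hyZ⟩
    · rw [hsd, Nat.le_zero, card_eq_zero, filter_eq_empty_iff]
      intro v hv
      rw [mem_singleton.1 hv, Function.update_self]
      exact disjoint_left.1 hV hyV
    · rw [Nat.le_zero, card_eq_zero, filter_eq_empty_iff]
      intro v hv
      rw [(hcol v hv).2]
      exact disjoint_left.1 hZ hyZ

end

lemma exists_list_of_mult {S : Type*} [Fintype S] (mult : S → ℕ) :
    ∃ L : List S, L.length = ∑ s, mult s ∧
      ∀ f : S → ℝ, (L.map f).sum = ∑ s, mult s * f s := by
  refine ⟨(univ : Finset S).toList.flatMap fun s => List.replicate (mult s) s, ?_, fun f => ?_⟩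
  · rw [List.length_flatMap]
    simp
  · rw [List.map_flatMap, List.flatMap, List.sum_flatten, List.map_map, ← Finset.sum_map_toList]
    congr 1
    refine List.map_congr_left fun s _ => ?_
    simp

lemma exists_index {V Z : Type*} [Fintype V] [DecidableEq V] [DecidableEq Z] (χ : V → V → Z)
    (k : ℕ) (hk : ∀ x z, #(univ.filter fun v => v ≠ x ∧ χ x v = z) ≤ k) :
    ∃ idx : V → V → ℕ, (∀ x v, v ≠ x → idx x v < k) ∧
      ∀ x v w, v ≠ x → w ≠ x → χ x v = χ x w → idx x v = idx x w → v = w := by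
  set S : V → Z → Finset V := fun x z => univ.filter fun v => v ≠ x ∧ χ x v = z with hS
  have hm : ∀ x v, v ≠ x → v ∈ S x (χ x v) := fun x v h => by simp [hS, h]
  refine ⟨fun x v => if h : v ∈ S x (χ x v) then ((S x (χ x v)).equivFin ⟨v, h⟩).val else 0,
    fun x v h => ?_, fun x v w hv hw hc h => ?_⟩
  · simp only [dif_pos (hm x v h)]
    exact lt_of_lt_of_le (Fin.is_lt _) (hk x _)
  · have hv' := hm x v hv
    have hw' := hm x w hw
    simp only [dif_pos hv', dif_pos hw'] at h
    revert h hw'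
    rw [← hc]
    intro hw' h
    have h2 := (S x (χ x v)).equivFin.injective (Fin.ext h)
    exact congrArg Subtype.val h2

lemma sum_lt_ite (M g A : ℕ) (hg : g ≤ M) :
    ∑ m : Fin M, (if m.val < g then A else 0) = g * A := by
  rw [Fin.sum_univ_eq_sum_range (fun m => if m < g then A else 0) M, ← sum_filter]
  have : (range M).filter (fun m => m < g) = range g := by
    ext m
    simp only [mem_filter, mem_range]
    omega
  rw [this]
  simp

/-- Polynomials grow faster than powers of the logarithm. -/
lemma eventually_clog_pow_le (C : ℝ) (p : ℕ) :
    ∀ᶠ n : ℕ in Filter.atTop, C * (Nat.clog 2 n : ℝ) ^ p ≤ n := by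
  have h1 : ∀ᶠ h : ℕ in Filter.atTop, 2 * C * (h : ℝ) ^ p ≤ 2 ^ h := by
    have h2 := tendsto_pow_const_div_const_pow_of_one_lt p (by norm_num : (1 : ℝ) < 2)
    have h3 := (h2.const_mul (2 * C)).eventually_le_const
      (show (2 * C) * 0 < (1 : ℝ) by simp)
    filter_upwards [h3] with h hh
    rw [mul_div_assoc'] at hh
    rwa [div_le_one (by positivity)] at hh
  have hclog : Filter.Tendsto (fun n => Nat.clog 2 n) Filter.atTop Filter.atTop := by
    refine Filter.tendsto_atTop.2 fun b => ?_
    filter_upwards [Filter.eventually_gt_atTop (2 ^ b)] with n hn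
    exact ((Nat.lt_clog_iff_pow_lt (by norm_num)).2 hn).le
  filter_upwards [hclog.eventually h1, Filter.eventually_ge_atTop 2] with n hn hn2
  have h4 : 2 ^ (Nat.clog 2 n).pred < n := Nat.pow_pred_clog_lt_self (by norm_num) (by omega)
  have h5 : 0 < Nat.clog 2 n := Nat.clog_pos (by norm_num) hn2
  have h6 : (2 : ℝ) ^ Nat.clog 2 n ≤ 2 * n := by
    have h7 : 2 ^ Nat.clog 2 n ≤ 2 * n := by
      calc 2 ^ Nat.clog 2 n = 2 * 2 ^ (Nat.clog 2 n).pred := by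
            rw [← pow_succ', show (Nat.clog 2 n).pred + 1 = Nat.clog 2 n from
              Nat.succ_pred_eq_of_pos h5]
        _ ≤ _ := by omega
    exact_mod_cast h7
  linarith

lemma eventually_le_clog (C : ℝ) : ∀ᶠ n : ℕ in Filter.atTop, C ≤ (Nat.clog 2 n : ℝ) := by
  obtain ⟨b, hb⟩ := exists_nat_ge C
  filter_upwards [Filter.eventually_gt_atTop (2 ^ b)] with n hn
  exact hb.trans (Nat.cast_le.2 ((Nat.lt_clog_iff_pow_lt (by norm_num)).2 hn).le)

/-- The vertices and colours can be divided between stars and `M` parts of equal density in a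
random-like way; the stars find nearly all their leaves. -/
lemma exists_split (k a M : ℕ) (hM : M = 2 ^ a) (hk0 : 1 ≤ k) (θ : ℝ) (hθ : 0 < θ) :
    ∃ n₀ : ℕ, ∀ (V Z I : Type) [Fintype V] [DecidableEq V] [Fintype Z] [DecidableEq Z]
      [Fintype I] [DecidableEq I] (χ : V → V → Z) (E : V → V → Prop) [∀ x v, Decidable (E x v)]
      (ctr : I → V) (d : I → ℕ) (ρ : ℝ) (g : ℕ), (∀ x v, χ x v = χ v x) →
      (∀ x z, #(univ.filter fun v => v ≠ x ∧ χ x v = z) ≤ k) → (∀ x v, E x v → v ≠ x) →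
      n₀ ≤ Fintype.card V → 0 < ρ →
      (∀ i, ρ * Fintype.card V ≤ ∑ v, if E (ctr i) v then (1 : ℝ) else 0) →
      Fintype.card I * (Nat.clog 2 (Fintype.card V)) ^ 6 ≤ Fintype.card V → g ≤ M →
      (k * ((∑ i, d i : ℕ) / (ρ * Fintype.card V) + Fintype.card I / Fintype.card V) + g / M
        : ℝ) ≤ 1 →
      ∃ (cls : V → ℕ) (cls' : Z → ℕ) (lab : V → Option I),
        (∀ v i, lab v = some i → E (ctr i) v ∧ cls v = M ∧ cls' (χ (ctr i) v) = M) ∧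
        (∀ v w i j, lab v = some i → lab w = some j → χ (ctr i) v = χ (ctr j) w → v = w) ∧
        (∑ i, max ((d i : ℝ) - #(univ.filter fun v => lab v = some i)) 0 ≤
          θ * Fintype.card V) ∧
        ∀ i < g,
          (∀ a b : V → ℝ, |∑ x, ∑ v, a x * b v * ((if E x v then (1 : ℝ) else 0) *
            ((if cls' (χ x v) = i then 1 else 0) - 1 / M))| ≤
            θ * Fintype.card V / (Nat.clog 2 (Fintype.card V)) ^ 4 * nrm a * nrm b) ∧
          (∀ (a : V → ℝ) (b : Z → ℝ), |∑ x, ∑ v, a x * b (χ x v) *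
            ((if E x v then (1 : ℝ) else 0) * ((if cls v = i then 1 else 0) - 1 / M))| ≤
            θ * Fintype.card V / (Nat.clog 2 (Fintype.card V)) ^ 4 * nrm a * nrm b) ∧
          (∀ a : V → ℝ, |∑ x, ∑ v, a x * ((if E x v then (1 : ℝ) else 0) *
            ((if cls v = i then 1 else 0) - 1 / M))| ≤
            θ * Fintype.card V / (Nat.clog 2 (Fintype.card V)) ^ 4 *
              √(Fintype.card V : ℝ) * nrm a) := by
  classical
  obtain ⟨c, hc⟩ : ∃ c : ℝ, c = 3 * (M + 1) + 1 := ⟨_, rfl⟩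
  have hc1 : 1 ≤ c := by
    have : (0 : ℝ) ≤ M := Nat.cast_nonneg _
    rw [hc]; linarith
  obtain ⟨n₀, hn₀⟩ := Filter.eventually_atTop.1
    ((eventually_clog_pow_le (c * (k * (2 * k + k ^ 2)) / θ ^ 4) 22).and
    ((eventually_clog_pow_le (c / θ ^ 2) 12).and ((eventually_clog_pow_le 1 6).and
    ((eventually_le_clog ((2 * c + 12) / θ)).and ((eventually_le_clog (a + 1)).and
    (Filter.eventually_ge_atTop 1))))))
  refine ⟨n₀, fun V Z I _ _ _ _ _ _ χ E _ ctr d ρ g hsymm hk hE hcard hρ hdeg hI hg hsum => ?_⟩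
  obtain ⟨h1, h2, h3, h4, h5, h6⟩ := hn₀ _ hcard
  have hne : Nonempty V := Fintype.card_pos_iff.1 h6
  set h := Nat.clog 2 (Fintype.card V) with hh
  have hnN : Fintype.card V ≤ 2 ^ h := Nat.le_pow_clog (by norm_num) _
  have hah : a ≤ h := by
    have : (a : ℝ) ≤ h := by linarith
    exact_mod_cast this
  have hIr : (Fintype.card I : ℝ) * h ^ 6 ≤ Fintype.card V := by exact_mod_cast hI
  have hnN' : (Fintype.card V : ℝ) ≤ 2 ^ h := by exact_mod_cast hnN
  set n : ℝ := (Fintype.card V : ℝ) with hn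
  have hn0 : 0 < n := by rw [hn]; exact_mod_cast h6
  have hh1 : (1 : ℝ) ≤ h := by
    have : (0 : ℝ) ≤ a := Nat.cast_nonneg _
    linarith
  have hh0 : (0 : ℝ) < h := by linarith
  -- multiplicities
  set N : ℝ := 2 ^ h with hN
  have hN0 : 0 < N := by positivity
  set mu : I → ℕ := fun i => ⌈N * d i / (ρ * n)⌉₊ with hmu
  set A : ℕ := 2 ^ (h - a) with hA
  have hMA : M * A = 2 ^ h := by rw [hM, hA, ← pow_add]; congr 1; omega
  have hM0 : 0 < M := by rw [hM]; positivity
  have hMr : (0 : ℝ) < M := by exact_mod_cast hM0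
  have hMAr : (M : ℝ) * A = N := by rw [hN]; exact_mod_cast hMA
  have htot : k * ∑ i, mu i + g * A ≤ 2 ^ h := by
    have e1 : ((∑ i, mu i : ℕ) : ℝ) ≤ N * (∑ i, d i : ℕ) / (ρ * n) + Fintype.card I := by
      rw [Nat.cast_sum]
      calc (∑ i, (mu i : ℝ)) ≤ ∑ i, (N * d i / (ρ * n) + 1) :=
            sum_le_sum fun i _ => (Nat.ceil_lt_add_one (by positivity)).le
        _ = _ := by
            rw [sum_add_distrib, ← sum_div, ← mul_sum]
            simp
    have e2 : (Fintype.card I : ℝ) ≤ N * (Fintype.card I / n) := by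
      rw [mul_div_assoc', le_div_iff₀ hn0, mul_comm]
      exact mul_le_mul_of_nonneg_right hnN' (Nat.cast_nonneg _)
    have e3 : (g * A : ℝ) = N * (g / M) := by
      rw [← hMAr]; field_simp
    have e4 : (k * (∑ i, mu i : ℕ) + g * A : ℝ) ≤ N := by
      calc (k * (∑ i, mu i : ℕ) + g * A : ℝ) ≤
            k * (N * (∑ i, d i : ℕ) / (ρ * n) + N * (Fintype.card I / n)) + N * (g / M) := by
              rw [e3]
              gcongr
              linarith
        _ = N * (k * ((∑ i, d i : ℕ) / (ρ * n) + Fintype.card I / n) + g / M) := by ring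
        _ ≤ N * 1 := mul_le_mul_of_nonneg_left hsum hN0.le
        _ = N := mul_one _
    rw [hN] at e4
    exact_mod_cast e4
  obtain ⟨idx, hidx, hidx2⟩ := exists_index χ k hk
  set S : SlotSystem V Z ((I × Fin k) ⊕ Fin (M + 1)) (Fin (M + 1)) (Option I) :=
    { dom := fun s => s.elim
        (fun p => univ.filter fun v => E (ctr p.1) v ∧ idx (ctr p.1) v = p.2) (fun _ => ∅)
      mt := fun s => s.elim (fun p v => χ (ctr p.1) v) (fun _ v => χ v v)
      inj := by
        rintro (p | m)
        · intro v hv w hw hvw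
          simp only [Sum.elim_inl, coe_filter, mem_univ, true_and, Set.mem_ofPred_eq] at hv hw hvw
          exact hidx2 _ _ _ (hE _ _ hv.1) (hE _ _ hw.1) hvw (hv.2.trans hw.2.symm)
        · simp
      lab := fun s => s.elim (fun p => some p.1) (fun _ => none)
      grp := fun s => s.elim (fun _ => Fin.last M) id } with hS
  obtain ⟨mult, hmult⟩ : ∃ mult : (I × Fin k) ⊕ Fin (M + 1) → ℕ,
      mult = Sum.elim (fun p => mu p.1) (fun m : Fin (M + 1) => if m.val < g then A else
        if m.val = M then 2 ^ h - (k * ∑ i, mu i + g * A) else 0) := ⟨_, rfl⟩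
  obtain ⟨L, hL, hLf⟩ := exists_list_of_mult mult
  rw [hmult] at hL hLf
  have hLlen : L.length = 2 ^ h := by
    rw [hL, Fintype.sum_sum_type]
    simp only [Sum.elim_inl, Sum.elim_inr]
    rw [Fintype.sum_prod_type, Fin.sum_univ_castSucc]
    have e1 : ∀ m : Fin M, (if (Fin.castSucc m).val < g then A else
        if (Fin.castSucc m).val = M then 2 ^ h - (k * ∑ i, mu i + g * A) else 0) =
        if m.val < g then A else 0 := by
      intro m
      have := m.2
      rw [Fin.val_castSucc, if_neg (show ¬ m.val = M by omega)]
    simp only [e1, Fin.val_last, if_neg (show ¬ M < g by omega), if_true]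
    rw [sum_lt_ite M g A hg]
    simp only [sum_const, card_univ, Fintype.card_fin, smul_eq_mul, ← mul_sum]
    omega
  have hβ0 : 0 ≤ θ * n / h ^ 5 := by positivity
  have hbal := S.exists_balanced χ k (h ^ 2) hk0 (Nat.one_le_pow _ _ (by exact_mod_cast hh0))
    hsymm hk (fun x v => if E x v then 1 else 0) (fun x v => ?_) (θ * n / h ^ 5) (θ * n / h)
    hβ0 ?_ ?_ ?_ h L hLlen
  rotate_left
  · by_cases hxv : x = v
    · have : ¬ E x v := fun h' => hE _ _ h' hxv.symm
      simp [hxv ▸ this, hxv]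
    · rw [if_neg hxv]
      split_ifs <;> norm_num
  · rw [div_mul_eq_mul_div, div_le_iff₀ (by positivity)] at h1
    simp only [Fintype.card_fin, ← hn]
    rw [div_pow, le_div_iff₀ (by positivity)]
    push_cast
    calc _ = c * (k * (2 * k + k ^ 2)) * h ^ 22 * n ^ 3 := by rw [hc]; ring
      _ ≤ (n * θ ^ 4) * n ^ 3 := mul_le_mul_of_nonneg_right h1 (by positivity)
      _ = _ := by ring
  · rw [div_mul_eq_mul_div, div_le_iff₀ (by positivity)] at h2
    simp only [Fintype.card_fin, ← hn]
    rw [div_pow, le_div_iff₀ (by positivity)]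
    push_cast
    calc _ = c * h ^ 12 * n := by rw [hc]; ring
      _ ≤ (n * θ ^ 2) * n := mul_le_mul_of_nonneg_right h2 (by positivity)
      _ = _ := by ring
  · simp only [Fintype.card_fin, Fintype.card_option, ← hn]
    push_cast
    rw [← hc]
    have e1 : √((Fintype.card I + 1 : ℝ) * (c * ((h : ℝ) ^ 2 * n))) ≤ 2 * c * n / h ^ 2 := by
      apply Real.sqrt_le_iff.2
      refine ⟨by positivity, ?_⟩
      rw [div_pow, le_div_iff₀ (by positivity)]
      calc _ = c * n * ((Fintype.card I * h ^ 6) + h ^ 6) := by ring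
        _ ≤ c * n * (n + n) := by
            refine mul_le_mul_of_nonneg_left ?_ (by positivity)
            linarith
        _ = (2 * c) * 1 * n ^ 2 := by ring
        _ ≤ (2 * c) * (2 * c) * n ^ 2 := by gcongr; linarith
        _ = _ := by ring
    rw [div_le_iff₀ hθ] at h4
    calc _ ≤ 2 * c * n / h ^ 2 + 12 * n / h ^ 2 := by linarith
      _ = (2 * c + 12) * (n / h ^ 2) := by ring
      _ ≤ (h * θ) * (n / h ^ 2) := mul_le_mul_of_nonneg_right h4 (by positivity)
      _ = _ := by field_simp
  obtain ⟨τ, τ', hb⟩ := hbal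
  have hβ : (h : ℝ) * (θ * n / h ^ 5) = θ * n / h ^ 4 := by field_simp
  have hδ : (h : ℝ) * (θ * n / h) = θ * n := by field_simp
  rw [hβ, hδ] at hb
  have hinl : ∀ v i, S.lab (τ v) = some i → ∃ j, τ v = Sum.inl (i, j) := by
    intro v i hv
    rcases hτ : τ v with ⟨i', j⟩ | m
    · rw [hτ] at hv
      simp only [hS, Sum.elim_inl, Option.some.injEq] at hv
      subst hv
      exact ⟨j, rfl⟩
    · rw [hτ] at hv
      simp [hS] at hv
  have hlab : ∀ v i, (if S.Good τ τ' v then S.lab (τ v) else none) = some i ↔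
      S.Good τ τ' v ∧ S.lab (τ v) = some i := by
    intro v i
    split_ifs with hv <;> simp [hv]
  refine ⟨fun v => (S.grp (τ v)).val, fun z => (S.grp (τ' z)).val,
    fun v => if S.Good τ τ' v then S.lab (τ v) else none, ?_, ?_, ?_, ?_⟩
  · intro v i hv
    obtain ⟨⟨hg1, hg2⟩, hl⟩ := (hlab v i).1 hv
    obtain ⟨j, hj⟩ := hinl v i hl
    rw [hj] at hg1 hg2
    have hg3 : E (ctr i) v ∧ idx (ctr i) v = j := by simpa [hS] using hg1
    have hg4 : τ' (χ (ctr i) v) = Sum.inl (i, j) := hg2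
    refine ⟨hg3.1, ?_, ?_⟩
    · simp only [hj]
      rfl
    · simp only [hg4]
      rfl
  · intro v w i j hv hw hc
    obtain ⟨⟨hg1, hg2⟩, hl⟩ := (hlab v i).1 hv
    obtain ⟨⟨hg1', hg2'⟩, hl'⟩ := (hlab w j).1 hw
    obtain ⟨i', hi'⟩ := hinl v i hl
    obtain ⟨j', hj'⟩ := hinl w j hl'
    have e1 : S.mt (τ v) v = χ (ctr i) v := by rw [hi']; rfl
    have e2 : S.mt (τ w) w = χ (ctr j) w := by rw [hj']; rfl
    have e3 : τ v = τ w := by rw [← hg2, ← hg2', e1, e2, hc]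
    refine S.inj (τ v) hg1 (e3 ▸ hg1') ?_
    rw [e1, e3, e2, hc]
  · refine le_trans ?_ hb.deficit
    rw [Fintype.sum_option]
    refine le_trans ?_ (le_add_of_nonneg_left (le_max_right _ _))
    refine sum_le_sum fun i _ => max_le_max ?_ le_rfl
    have e0 : #(univ.filter fun v => (if S.Good τ τ' v then S.lab (τ v) else none) = some i) =
        S.cnt τ τ' (some i) := by
      rw [SlotSystem.cnt]
      congr 1
      ext v
      simp only [mem_filter, mem_univ, true_and]
      exact hlab v i
    rw [e0]
    refine sub_le_sub_right ?_ _
    rw [hLf, le_div_iff₀ (by positivity), Fintype.sum_sum_type]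
    have e1 : ∀ p : I × Fin k, (if S.lab (Sum.inl p) = some i then (#(S.dom (Sum.inl p)) : ℝ)
        else 0) = if p.1 = i then (#(univ.filter fun v => E (ctr i) v ∧ idx (ctr i) v = p.2) : ℝ)
          else 0 := by
      intro p
      by_cases hp : p.1 = i
      · simp [hS, hp]
      · simp [hS, hp]
    have e2 : ∀ m : Fin (M + 1), (if S.lab (Sum.inr m) = some i then
        (#(S.dom (Sum.inr m)) : ℝ) else 0) = 0 := fun m => by simp [hS]
    simp only [e1, e2, mul_zero, sum_const_zero, add_zero, Sum.elim_inl]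
    rw [Fintype.sum_prod_type]
    have e3 : ∀ i' : I, ∑ j : Fin k, (mu i' : ℝ) * (if i' = i then
        (#(univ.filter fun v => E (ctr i) v ∧ idx (ctr i) v = j) : ℝ) else 0) =
        if i' = i then (mu i : ℝ) * ∑ j : Fin k,
          (#(univ.filter fun v => E (ctr i) v ∧ idx (ctr i) v = j) : ℝ) else 0 := by
      intro i'
      by_cases hi' : i' = i
      · simp [hi', mul_sum]
      · simp [hi']
    simp only [e3, sum_ite_eq', mem_univ, if_true]
    have e4 : (∑ j : Fin k, (#(univ.filter fun v => E (ctr i) v ∧ idx (ctr i) v = j) : ℝ)) =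
        ∑ v, if E (ctr i) v then (1 : ℝ) else 0 := by
      rw [sum_boole]
      have e5 := card_eq_sum_card_fiberwise (s := univ.filter fun v => E (ctr i) v)
        (t := range k) (f := fun v => idx (ctr i) v) (fun v hv => by
          have hv' : E (ctr i) v := by simpa using hv
          have := hidx _ _ (hE _ _ hv')
          simpa using this)
      rw [e5, Fin.sum_univ_eq_sum_range
        (fun j => (#(univ.filter fun v => E (ctr i) v ∧ idx (ctr i) v = j) : ℝ)) k]
      push_cast
      refine sum_congr rfl fun j _ => ?_
      rw [filter_filter]
    rw [e4]
    have e6 : N * d i / (ρ * n) ≤ mu i := Nat.le_ceil _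
    rw [div_le_iff₀ (by positivity)] at e6
    calc (d i : ℝ) * 2 ^ h = N * d i := by rw [hN]; ring
      _ ≤ mu i * (ρ * n) := e6
      _ ≤ _ := mul_le_mul_of_nonneg_left (hdeg i) (Nat.cast_nonneg _)
  · intro i hi
    have hiM : i < M + 1 := by omega
    have e1 : ∀ s : Fin (M + 1), (if s = ⟨i, hiM⟩ then (1 : ℝ) else 0) =
        if s.val = i then 1 else 0 := fun s => by simp only [Fin.ext_iff]
    have hα : (L.map fun s => if S.grp s = ⟨i, hiM⟩ then (1 : ℝ) else 0).sum / 2 ^ h = 1 / M := by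
      rw [hLf, Fintype.sum_sum_type]
      have e2 : ∀ p : I × Fin k, (if S.grp (Sum.inl p) = ⟨i, hiM⟩ then (1 : ℝ) else 0) = 0 := by
        intro p
        rw [e1, if_neg]
        change ¬ M = i
        omega
      have e3 : ∀ m : Fin (M + 1), (if S.grp (Sum.inr m) = ⟨i, hiM⟩ then (1 : ℝ) else 0) =
          if m = ⟨i, hiM⟩ then 1 else 0 := fun m => rfl
      simp only [e2, e3, mul_zero, sum_const_zero, zero_add, Sum.elim_inr, mul_ite, mul_one,
        sum_ite_eq', mem_univ, if_true, if_pos hi]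
      rw [← hN, ← hMAr]
      have : (0 : ℝ) < A := by rw [hA]; positivity
      field_simp
    have hcol := hb.colour ⟨i, hiM⟩
    have hver := hb.vertex ⟨i, hiM⟩
    have hdg := hb.degree ⟨i, hiM⟩
    simp only [e1] at hα
    simp only [e1, hα] at hcol hver hdg
    exact ⟨hcol, hver, hdg⟩

lemma exists_matching_of_card {α V : Type*} [DecidableEq α] [DecidableEq V] [Nonempty V]
    (S : Finset α) (T : Finset V) :
    ∃ S' ⊆ S, ∃ φ : α → V, Set.InjOn φ S' ∧ (∀ v ∈ S', φ v ∈ T) ∧ #(S \ S') = #S - #T := by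
  obtain ⟨S', hS', hc⟩ := exists_subset_card_eq (Nat.min_le_left #S #T)
  obtain ⟨φ, hφ⟩ : ∃ φ : α → V, Set.InjOn φ S' ∧ ∀ v ∈ S', φ v ∈ T := by
    have hle : #S' ≤ #T := hc ▸ Nat.min_le_right _ _
    obtain ⟨φ, h1, h2⟩ := (Set.toFinite (S' : Set α)).exists_injOn_of_encard_le
      (t := (T : Set V)) (by simpa using hle)
    exact ⟨φ, h2, fun v hv => by simpa using h1 hv⟩
  refine ⟨S', hS', φ, hφ.1, hφ.2, ?_⟩
  rw [card_sdiff_of_subset hS', hc]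
  omega

/-- Match as many children of the centres as there are labelled leaves. -/
lemma exists_star_matching {α V : Type*} [DecidableEq α] [Fintype V] [DecidableEq V]
    [Nonempty V] (par : α → α) (Star Big : Finset α) (hS : ∀ v ∈ Star, par v ∈ Big)
    (lab : V → Option Big) (y : ℝ)
    (h : ∑ i : Big, max ((#(Star.filter fun v => par v = i) : ℝ) -
      #(univ.filter fun v => lab v = some i)) 0 ≤ y) :
    ∃ A₁ ⊆ Star, ∃ φ : α → V, Set.InjOn φ A₁ ∧
      (∀ v ∈ A₁, ∃ hv : par v ∈ Big, lab (φ v) = some ⟨par v, hv⟩) ∧ (#(Star \ A₁) : ℝ) ≤ y := by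
  choose S' hS' φ hφ hφT hcard using fun i : Big => exists_matching_of_card
    (Star.filter fun v => par v = i) (univ.filter fun v => lab v = some i)
  refine ⟨Star.filter fun v => ∃ hv : par v ∈ Big, v ∈ S' ⟨par v, hv⟩, filter_subset _ _,
    fun v => if hv : par v ∈ Big then φ ⟨par v, hv⟩ v else Classical.arbitrary V, ?_, ?_, ?_⟩
  · have key : ∀ v, (hv : par v ∈ Big) → v ∈ S' ⟨par v, hv⟩ →
        lab (φ ⟨par v, hv⟩ v) = some ⟨par v, hv⟩ := fun v hv hs => by
      simpa using hφT _ v hs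
    intro v hv w hw hvw
    obtain ⟨-, hv, hvs⟩ := mem_filter.1 hv
    obtain ⟨-, hw, hws⟩ := mem_filter.1 hw
    simp only [dif_pos hv, dif_pos hw] at hvw
    have e := key w hw hws
    rw [← hvw, key v hv hvs, Option.some.injEq] at e
    rw [← e] at hws hvw
    exact hφ _ hvs hws hvw
  · intro v hv
    obtain ⟨-, hv, hvs⟩ := mem_filter.1 hv
    refine ⟨hv, ?_⟩
    simp only [dif_pos hv]
    simpa using hφT _ v hvs
  · refine le_trans ?_ h
    have e1 : #(Star \ Star.filter fun v => ∃ hv : par v ∈ Big, v ∈ S' ⟨par v, hv⟩) ≤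
        ∑ i : Big, #((Star.filter fun v => par v = i) \ S' i) := by
      refine (card_le_card fun v hv => ?_).trans card_biUnion_le
      rw [mem_sdiff] at hv
      refine mem_biUnion.2 ⟨⟨par v, hS v hv.1⟩, mem_univ _, ?_⟩
      rw [mem_sdiff, mem_filter]
      exact ⟨⟨hv.1, rfl⟩, fun h' => hv.2 (mem_filter.2 ⟨hv.1, hS v hv.1, h'⟩)⟩
    calc (#(Star \ Star.filter fun v => ∃ hv : par v ∈ Big, v ∈ S' ⟨par v, hv⟩) : ℝ) ≤
          ((∑ i : Big, #((Star.filter fun v => par v = i) \ S' i) : ℕ) : ℝ) := by exact_mod_cast e1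
      _ ≤ _ := by
        push_cast
        refine sum_le_sum fun i _ => ?_
        rw [hcard]
        rcases le_total (#(univ.filter fun v => lab v = some i))
          (#(Star.filter fun v => par v = i)) with h1 | h1
        · rw [Nat.cast_sub h1]
          exact le_max_left _ _
        · rw [Nat.sub_eq_zero_of_le h1, Nat.cast_zero]
          exact le_max_right _ _

/-- The rounds exist if every part of the division is random-like. -/
lemma exists_rounds (N : ℕ) (hN : 1 ≤ N) : ∃ δ : ℝ, 0 < δ ∧
    ∀ (α V Z : Type) [DecidableEq α] [Fintype V] [DecidableEq V] [Fintype Z]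
      [DecidableEq Z] (χ : V → V → Z) (W V₀ B C : Finset V) (Q Z₀ C' : Finset Z)
      (cls : V → ℕ) (cls' : Z → ℕ) (M g cap Δ η D k : ℕ) (β t r : ℝ),
      1 ≤ k → 1 ≤ Δ → 0 < D → 0 < t → 0 ≤ β → 1 ≤ M → g ≤ M →
      (∀ y v, χ y v = χ v y) →
      (∀ y z, #(univ.filter fun v => v ≠ y ∧ χ y v = z) ≤ k) →
      (∀ v ∈ W, v ∉ V₀ ∧ v ∉ B ∧ v ∉ C) → (∀ z ∈ Q, z ∉ Z₀ ∧ z ∉ C') →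
      (∀ i < g,
        (∀ a b : V → ℝ, |∑ x, ∑ v, a x * b v *
          ((if v ≠ x ∧ v ∈ W ∧ χ x v ∈ Q then (1 : ℝ) else 0) *
            ((if cls' (χ x v) = i then 1 else 0) - 1 / M))| ≤ β * nrm a * nrm b) ∧
        (∀ (a : V → ℝ) (b : Z → ℝ), |∑ x, ∑ v, a x * b (χ x v) *
          ((if v ≠ x ∧ v ∈ W ∧ χ x v ∈ Q then (1 : ℝ) else 0) *
            ((if cls v = i then 1 else 0) - 1 / M))| ≤ β * nrm a * nrm b) ∧
        (∀ a : V → ℝ, |∑ x, ∑ v, a x * ((if v ≠ x ∧ v ∈ W ∧ χ x v ∈ Q then (1 : ℝ) else 0) *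
          ((if cls v = i then 1 else 0) - 1 / M))| ≤ β * √(Fintype.card V : ℝ) * nrm a)) →
      cap ≤ Fintype.card V →
      (∀ x, x ∉ B → r ≤ ∑ v, if v ≠ x ∧ v ∈ W ∧ χ x v ∈ Q then (1 : ℝ) else 0) →
      (1 / M : ℝ) * (k * cap) + t ≤ D →
      D ≤ (1 / M : ℝ) ^ 2 * r - t - (1 + k) * (β ^ 2 * (Δ * Fintype.card V) / t ^ 2) →
      (k * Δ : ℝ) ≤ δ * D →
      2 / N * cap + Δ * (4 * β ^ 2 * Fintype.card V / t ^ 2) ≤ (η : ℝ) →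
      Rounds α χ V₀ B Z₀ (fun i => C ∪ W.filter fun v => cls v = M ∨ cls v < i)
        (fun i => C' ∪ Q.filter fun z => cls' z = M ∨ cls' z < i) g cap Δ η := by
  obtain ⟨δ, hδ, h⟩ := exists_round N hN
  refine ⟨δ, hδ, ?_⟩
  intro α V Z _ _ _ _ _ χ W V₀ B C Q Z₀ C' cls cls' M g cap Δ η D k β t r hk1 hΔ hD ht hβ hM hgM
    hsymm hk hW hQ hineq hcap hrow H1 H2 H3 H4 i hi A x hA hxB hmult
  have hM0 : (1 : ℝ) ≤ M := by exact_mod_cast hM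
  obtain ⟨hcol, hver, hdeg⟩ := hineq i hi
  have hAr : (#A : ℝ) ≤ cap := by exact_mod_cast hA
  have hex := h A V Z χ (fun x v => v ≠ x ∧ v ∈ W ∧ χ x v ∈ Q) (fun v => cls v = i)
    (fun z => cls' z = i) (1 / M) β t r (fun s => x s) k Δ D hk1 hΔ hD ht (by positivity)
    (by rw [div_le_one (by linarith)]; exact hM0) hβ hsymm (fun y v hv => hv.1) hk hcol hver hdeg
    ?_ ?_ (fun s => hrow _ (hxB _ s.2)) ?_ H2 H3
  rotate_left
  · intro y
    refine le_trans (le_of_eq ?_) (hmult y)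
    rw [← card_map (Function.Embedding.subtype (· ∈ A))]
    congr 1
    ext v
    simp only [mem_map, mem_filter, mem_univ, true_and, Function.Embedding.coe_subtype,
      Subtype.exists, exists_and_left, exists_prop, exists_eq_right_right]
    exact and_comm
  · rw [Fintype.card_coe]
    exact hA.trans hcap
  · rw [Fintype.card_coe]
    refine le_trans ?_ H1
    gcongr
  obtain ⟨A', f, hf, hfv, hfc, hcard⟩ := hex
  have hne : A = ∅ ∨ Nonempty V := by
    rcases A.eq_empty_or_nonempty with h | ⟨v, -⟩
    · exact Or.inl h
    · exact Or.inr ⟨x v⟩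
  rcases hne with rfl | hne
  · refine ⟨∅, subset_rfl, x, ?_⟩
    simp
  obtain ⟨F, hF⟩ : ∃ F : α → V, ∀ s : A, F s = f s :=
    ⟨fun v => if hv : v ∈ A then f ⟨v, hv⟩ else Classical.arbitrary V, fun s => by simp⟩
  refine ⟨A'.map (Function.Embedding.subtype _), fun v hv => ?_,
    F, ?_, ?_, ?_, ?_, ?_⟩
  · obtain ⟨s, -, rfl⟩ := mem_map.1 hv
    exact s.2
  · intro v hv w hw hvw
    obtain ⟨s, hs, rfl⟩ := mem_map.1 hv
    obtain ⟨s', hs', rfl⟩ := mem_map.1 hw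
    have e : f s = f s' := (hF s).symm.trans (hvw.trans (hF s'))
    rw [hf hs hs' e]
  · intro v hv
    obtain ⟨s, hs, rfl⟩ := mem_map.1 hv
    obtain ⟨⟨-, h1, -⟩, h2, -⟩ := hfv s hs
    have h3 := hW _ h1
    simp only [Function.Embedding.coe_subtype, hF s]
    simp only [mem_union, mem_filter, not_or, not_and]
    refine ⟨h3.2.1, Or.inr ⟨h1, Or.inr (by omega)⟩, ⟨h3.2.2, fun _ => by omega⟩, h3.1⟩
  · intro v hv w hw hvw
    obtain ⟨s, hs, rfl⟩ := mem_map.1 hv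
    obtain ⟨s', hs', rfl⟩ := mem_map.1 hw
    have e : χ (x s) (f s) = χ (x s') (f s') := by
      rw [← hF s, ← hF s']
      exact hvw
    rw [hfc hs hs' e]
  · intro v hv
    obtain ⟨s, hs, rfl⟩ := mem_map.1 hv
    obtain ⟨⟨-, -, h1⟩, -, h2⟩ := hfv s hs
    have h3 := hQ _ h1
    simp only [Function.Embedding.coe_subtype, hF s]
    simp only [mem_union, mem_filter, not_or, not_and]
    refine ⟨Or.inr ⟨h1, Or.inr (by omega)⟩, ⟨h3.2, fun _ => by omega⟩, h3.1⟩
  · have e1 : #(A \ A'.map (Function.Embedding.subtype _)) ≤ #A'ᶜ := by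
      rw [← card_map (Function.Embedding.subtype (· ∈ A)) (s := A'ᶜ)]
      refine card_le_card fun v hv => ?_
      rw [mem_sdiff] at hv
      refine mem_map.2 ⟨⟨v, hv.1⟩, mem_compl.2 fun h' => hv.2 (mem_map.2 ⟨_, h', rfl⟩), rfl⟩
    have e2 : (#A'ᶜ : ℝ) ≤ η := by
      refine hcard.trans (le_trans ?_ H4)
      rw [Fintype.card_coe]
      gcongr
    exact e1.trans (by exact_mod_cast e2)

/-- There are few vertices with many children. -/
lemma card_big_mul_le {α : Type*} [Fintype α] [DecidableEq α] (root : α) (par : α → α) (Δ : ℕ) :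
    #(univ.filter fun u => Δ < #(univ.filter fun v => v ≠ root ∧ par v = u)) * Δ ≤
      Fintype.card α := by
  calc #(univ.filter fun u => Δ < #(univ.filter fun v => v ≠ root ∧ par v = u)) * Δ ≤
        ∑ u ∈ univ.filter fun u => Δ < #(univ.filter fun v => v ≠ root ∧ par v = u),
          #(univ.filter fun v => v ≠ root ∧ par v = u) := by
        rw [← smul_eq_mul]
        exact card_nsmul_le_sum _ _ _ fun u hu => (mem_filter.1 hu).2.le
    _ ≤ ∑ u, #(univ.filter fun v => v ≠ root ∧ par v = u) :=
        sum_le_sum_of_subset (subset_univ _)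
    _ ≤ ∑ u, #(univ.filter fun v => par v = u) :=
        sum_le_sum fun u _ => card_le_card fun v hv => by
          simp only [mem_filter, mem_univ, true_and] at hv ⊢
          exact hv.2
    _ = #(univ : Finset α) := (card_eq_sum_card_fiberwise fun v _ => mem_coe.2 (mem_univ _)).symm
    _ = Fintype.card α := card_univ

lemma card_le_card_row {V Z : Type*} [Fintype V] [DecidableEq V] [Fintype Z] [DecidableEq Z]
    (χ : V → V → Z) (k : ℕ) (hk : ∀ x z, #(univ.filter fun v => v ≠ x ∧ χ x v = z) ≤ k)
    (V₁ : Finset V) (Z₀ C' : Finset Z) (x : V) :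
    Fintype.card V ≤ #(univ.filter fun v => v ≠ x ∧ v ∈ V₁ᶜ ∧ χ x v ∈ (Z₀ ∪ C')ᶜ) + (1 + #V₁ +
      #(univ.filter fun v => v ≠ x ∧ χ x v ∈ Z₀) + #C' * k) := by
  have h1 := card_colours_le χ k hk x C'
  have h2 : (univ : Finset V) ⊆ (univ.filter fun v => v ≠ x ∧ v ∈ V₁ᶜ ∧ χ x v ∈ (Z₀ ∪ C')ᶜ) ∪
      ((({x} ∪ V₁) ∪ univ.filter fun v => v ≠ x ∧ χ x v ∈ Z₀) ∪
        univ.filter fun v => v ≠ x ∧ χ x v ∈ C') := by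
    intro v _
    simp only [mem_union, mem_filter, mem_univ, true_and, mem_compl, mem_singleton]
    tauto
  calc Fintype.card V = #(univ : Finset V) := card_univ.symm
    _ ≤ _ := card_le_card h2
    _ ≤ _ := by
      refine (card_union_le _ _).trans (Nat.add_le_add_left ?_ _)
      refine (card_union_le _ _).trans (Nat.add_le_add ?_ h1)
      refine (card_union_le _ _).trans (Nat.add_le_add_right ?_ _)
      refine (card_union_le _ _).trans ?_
      rw [card_singleton]

/-- The stars and the rounds fit into the available space. -/
lemma density_le_one (ε n m S k M L b cap g : ℝ) (hε : 0 < ε) (hε1 : ε < 1) (hn : 0 < n)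
    (hk : 0 < k) (hM : 0 < M) (hS0 : 0 ≤ S) (hSm : S ≤ m) (hm : k * m ≤ (1 - ε) * n)
    (hL : 16 * (2 * L + 1) ≤ ε * M) (hb : 16 * (k * b) ≤ ε * n) (hcap : 0 < cap)
    (hcap' : (1 - 3 / 8 * ε) * n ≤ k * M * cap) (hg : g ≤ (m - S) / cap + (2 * L + 1)) :
    k * (S / ((1 - ε / 8) * n) + b / n) + g / M ≤ 1 := by
  have hρ : 0 < 1 - 3 / 8 * ε := by linarith
  have h1 : S / ((1 - ε / 8) * n) ≤ S / ((1 - 3 / 8 * ε) * n) := by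
    refine div_le_div_of_nonneg_left hS0 (by positivity) ?_
    exact mul_le_mul_of_nonneg_right (by linarith) hn.le
  have h2 : (m - S) / cap ≤ (m - S) * (k * M) / ((1 - 3 / 8 * ε) * n) := by
    rw [div_le_div_iff₀ hcap (by positivity)]
    calc (m - S) * ((1 - 3 / 8 * ε) * n) ≤ (m - S) * (k * M * cap) :=
          mul_le_mul_of_nonneg_left hcap' (by linarith)
      _ = _ := by ring
  have h3 : g / M ≤ k * ((m - S) / ((1 - 3 / 8 * ε) * n)) + ε / 16 := by
    rw [div_le_iff₀ hM]
    calc g ≤ (m - S) * (k * M) / ((1 - 3 / 8 * ε) * n) + ε * M / 16 := by linarith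
      _ = _ := by ring
  have h4 : k * (b / n) ≤ ε / 16 := by
    rw [mul_div_assoc', div_le_iff₀ hn]
    linarith
  have h5 : k * m / ((1 - 3 / 8 * ε) * n) ≤ 1 - ε / 2 := by
    rw [div_le_iff₀ (by positivity)]
    calc k * m ≤ (1 - ε) * n := hm
      _ ≤ ((1 - ε / 2) * (1 - 3 / 8 * ε)) * n := by
        refine mul_le_mul_of_nonneg_right ?_ hn.le
        nlinarith
      _ = _ := by ring
  have h6 := mul_le_mul_of_nonneg_left h1 hk.le
  have h7 : k * (S / ((1 - 3 / 8 * ε) * n)) + k * ((m - S) / ((1 - 3 / 8 * ε) * n)) =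
      k * m / ((1 - 3 / 8 * ε) * n) := by ring
  rw [mul_add]
  linarith

/-- The sizes of the rounds, of the nibble degree, and of the number of exceptions. -/
lemma exists_round_parameters (ε c τ θ δ : ℝ) (n k M N h : ℕ) (hε : 0 < ε) (hε1 : ε < 1)
    (hc : 0 < c) (hc1 : c ≤ 1) (hδ : 0 < δ) (hk : 1 ≤ k) (hM : 1 ≤ M)
    (hτ : τ = ε / (32 * M ^ 2)) (hθ : θ = c * τ ^ 3 / (128 * M * (1 + k))) (hN : 64 * M / c ≤ N)
    (hn0 : 1 ≤ n) (hn1 : 8 * k * M / ε ≤ n) (hn2 : 1 / τ ≤ n) (hn3 : 32 * M / c ≤ n)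
    (hh : 1 ≤ h) (hn4 : k / (δ * τ) * (h : ℝ) ^ 6 ≤ n) :
    ∃ cap D η : ℕ, 0 < cap ∧ 0 < D ∧ cap ≤ n ∧ (1 - 3 / 8 * ε) * n ≤ k * M * cap ∧
      (1 / M : ℝ) * (k * cap) + τ * n ≤ D ∧
      D ≤ (1 / M : ℝ) ^ 2 * ((1 - ε / 8) * n) - τ * n -
        (1 + k) * ((θ * n / h ^ 4) ^ 2 * ((h ^ 6 : ℕ) * n) / (τ * n) ^ 2) ∧
      (k * (h ^ 6 : ℕ) : ℝ) ≤ δ * D ∧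
      2 / N * cap + (h ^ 6 : ℕ) * (4 * (θ * n / h ^ 4) ^ 2 * n / (τ * n) ^ 2) ≤ (η : ℝ) ∧
      (η * M : ℝ) ≤ c / 8 * n := by
  have hkr : (1 : ℝ) ≤ k := by exact_mod_cast hk
  have hMr : (1 : ℝ) ≤ M := by exact_mod_cast hM
  have hnr : (1 : ℝ) ≤ n := by exact_mod_cast hn0
  have hhr : (1 : ℝ) ≤ h := by exact_mod_cast hh
  have hn : (0 : ℝ) < n := by linarith
  have hM0 : (0 : ℝ) < M := by linarith
  have hk0 : (0 : ℝ) < k := by linarith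
  have hh0 : (0 : ℝ) < h := by linarith
  have hτ0 : 0 < τ := by rw [hτ]; positivity
  have hτ1 : τ ≤ 1 := by
    rw [hτ, div_le_one (by positivity)]
    nlinarith
  have hθ0 : 0 < θ := by rw [hθ]; positivity
  have hN0 : (0 : ℝ) < N := lt_of_lt_of_le (by positivity) hN
  rw [div_le_iff₀ hε] at hn1
  rw [div_le_iff₀ hτ0] at hn2
  rw [div_le_iff₀ hc] at hn3
  rw [div_le_iff₀ hc] at hN
  rw [div_mul_eq_mul_div, div_le_iff₀ (by positivity)] at hn4
  have hθ1 : θ ≤ 1 := by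
    rw [hθ, div_le_one (by positivity)]
    calc c * τ ^ 3 ≤ 1 * 1 := mul_le_mul hc1 (pow_le_one₀ hτ0.le hτ1) (by positivity) (by norm_num)
      _ ≤ 128 * M * (1 + k) := by nlinarith
  have hθs : θ ^ 2 ≤ θ := by nlinarith
  -- the error term
  have hw : (θ * n / h ^ 4) ^ 2 * ((h ^ 6 : ℕ) * n) / (τ * n) ^ 2 ≤ θ / τ ^ 2 * n := by
    have e : (θ * n / h ^ 4) ^ 2 * ((h ^ 6 : ℕ) * n) / (τ * n) ^ 2 =
        θ ^ 2 / τ ^ 2 * n / h ^ 2 := by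
      push_cast
      field_simp
    rw [e]
    calc θ ^ 2 / τ ^ 2 * n / h ^ 2 ≤ θ ^ 2 / τ ^ 2 * n :=
          div_le_self (by positivity) (one_le_pow₀ hhr)
      _ ≤ _ := by gcongr
  have hθk : (1 + k) * (θ / τ ^ 2) ≤ τ := by
    rw [hθ]
    have e : (1 + k) * (c * τ ^ 3 / (128 * M * (1 + k)) / τ ^ 2) = c * τ / (128 * M) := by
      field_simp
    rw [e, div_le_iff₀ (by positivity)]
    nlinarith [mul_le_mul_of_nonneg_right hc1 hτ0.le]
  have hθM : 4 * (θ / τ ^ 2) * M ≤ c / 32 := by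
    rw [hθ]
    have e : 4 * (c * τ ^ 3 / (128 * M * (1 + k)) / τ ^ 2) * M = c / 32 * (τ / (1 + k)) := by
      field_simp
      norm_num
    rw [e]
    refine mul_le_of_le_one_right (by positivity) ?_
    rw [div_le_one (by positivity)]
    linarith
  obtain ⟨cap, hcapd⟩ : ∃ cap : ℕ, cap = ⌊(1 - ε / 4) * n / (k * M)⌋₊ := ⟨_, rfl⟩
  have hcap1 : (cap : ℝ) ≤ (1 - ε / 4) * n / (k * M) := by
    rw [hcapd]
    refine Nat.floor_le ?_
    have : 0 < 1 - ε / 4 := by linarith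
    positivity
  have hcap2 : (1 - ε / 4) * n / (k * M) < cap + 1 := by
    rw [hcapd]
    exact Nat.lt_floor_add_one _
  rw [le_div_iff₀ (by positivity)] at hcap1
  rw [div_lt_iff₀ (by positivity)] at hcap2
  have hcap3 : (1 - 3 / 8 * ε) * n ≤ k * M * cap := by linarith
  have hcap0 : (0 : ℝ) < cap := by
    have : 0 < (1 - 3 / 8 * ε) * n := mul_pos (by linarith) hn
    have h2 : 0 < (k * M : ℝ) * cap := by linarith
    exact (pos_iff_pos_of_mul_pos h2).1 (by positivity)
  have hcapn : (cap : ℝ) ≤ n := by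
    have h1 : (1 : ℝ) ≤ k * M := one_le_mul_of_one_le_of_one_le hkr hMr
    have h2 : (cap : ℝ) ≤ cap * (k * M) := le_mul_of_one_le_right hcap0.le h1
    nlinarith
  obtain ⟨D, hDd⟩ : ∃ D : ℕ, D = ⌈(1 / M : ℝ) * (k * cap) + τ * n⌉₊ := ⟨_, rfl⟩
  have hD1 : (1 / M : ℝ) * (k * cap) + τ * n ≤ D := by
    rw [hDd]
    exact Nat.le_ceil _
  have hD2 : (D : ℝ) ≤ (1 / M : ℝ) * (k * cap) + τ * n + 1 := by
    rw [hDd]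
    exact (Nat.ceil_lt_add_one (by positivity)).le
  have hD3 : τ * n ≤ D := le_trans (le_add_of_nonneg_left (by positivity)) hD1
  obtain ⟨η, hηd⟩ : ∃ η : ℕ, η = ⌈2 / N * (n : ℝ) + 4 * (θ / τ ^ 2 * n)⌉₊ := ⟨_, rfl⟩
  refine ⟨cap, D, η, by exact_mod_cast hcap0, ?_, by exact_mod_cast hcapn, hcap3, hD1, ?_, ?_,
    ?_, ?_⟩
  · have : (0 : ℝ) < D := lt_of_lt_of_le (by positivity) hD3
    exact_mod_cast this
  · have h1 : (1 / M : ℝ) * (k * cap) ≤ (1 / M : ℝ) ^ 2 * ((1 - ε / 4) * n) := by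
      calc (1 / M : ℝ) * (k * cap) = (1 / M : ℝ) ^ 2 * (cap * (k * M)) := by field_simp
        _ ≤ _ := mul_le_mul_of_nonneg_left hcap1 (by positivity)
    have h2 : (1 / M : ℝ) ^ 2 * ((1 - ε / 8) * n) =
        (1 / M : ℝ) ^ 2 * ((1 - ε / 4) * n) + 4 * (τ * n) := by
      rw [hτ]
      field_simp
      ring
    have h3 : (1 + k) * ((θ * n / h ^ 4) ^ 2 * ((h ^ 6 : ℕ) * n) / (τ * n) ^ 2) ≤ τ * n := by
      calc _ ≤ (1 + k) * (θ / τ ^ 2 * n) := mul_le_mul_of_nonneg_left hw (by positivity)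
        _ = ((1 + k) * (θ / τ ^ 2)) * n := by ring
        _ ≤ _ := mul_le_mul_of_nonneg_right hθk hn.le
    linarith
  · calc (k * (h ^ 6 : ℕ) : ℝ) = k * (h : ℝ) ^ 6 := by push_cast; ring
      _ ≤ n * (δ * τ) := hn4
      _ = δ * (τ * n) := by ring
      _ ≤ _ := mul_le_mul_of_nonneg_left hD3 hδ.le
  · rw [hηd]
    refine le_trans (add_le_add ?_ ?_) (Nat.le_ceil _)
    · exact mul_le_mul_of_nonneg_left hcapn (by positivity)
    · calc _ = 4 * ((θ * n / h ^ 4) ^ 2 * ((h ^ 6 : ℕ) * n) / (τ * n) ^ 2) := by ring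
        _ ≤ _ := by linarith
  · have h1 : (η : ℝ) ≤ 2 / N * (n : ℝ) + 4 * (θ / τ ^ 2 * n) + 1 := by
      rw [hηd]
      exact (Nat.ceil_lt_add_one (by positivity)).le
    have h2 : 2 / N * M ≤ c / 32 := by
      rw [div_mul_eq_mul_div, div_le_iff₀ hN0]
      linarith
    calc (η * M : ℝ) ≤ (2 / N * (n : ℝ) + 4 * (θ / τ ^ 2 * n) + 1) * M :=
          mul_le_mul_of_nonneg_right h1 hM0.le
      _ = (2 / N * M) * n + (4 * (θ / τ ^ 2) * M) * n + M := by ring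
      _ ≤ c / 32 * n + c / 32 * n + c / 32 * n := by
        refine add_le_add (add_le_add ?_ ?_) (by linarith)
        · exact mul_le_mul_of_nonneg_right h2 hn.le
        · exact mul_le_mul_of_nonneg_right hθM hn.le
      _ ≤ _ := by linarith [mul_pos hc hn]

set_option maxHeartbeats 1600000 in
/-- Rainbow embedding of a rooted tree, given by its parent function. -/
lemma exists_rainbow_embedding (ε : ℝ) (hε : 0 < ε) (hε1 : ε < 1) (k : ℕ) (hk1 : 1 ≤ k) :
    ∃ n₀ : ℕ, ∀ (α V Z : Type) [Fintype α] [DecidableEq α] [Fintype V] [DecidableEq V]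
      [Fintype Z] [DecidableEq Z] (χ : V → V → Z) (root : α) (par : α → α) (dep : α → ℕ),
      (∀ x v, χ x v = χ v x) → (∀ x z, #(univ.filter fun v => v ≠ x ∧ χ x v = z) ≤ k) →
      par root = root → dep root = 0 → (∀ v, v ≠ root → dep (par v) + 1 = dep v) →
      n₀ ≤ Fintype.card V → (k * Fintype.card α : ℝ) ≤ (1 - ε) * Fintype.card V →
      ∃ F : α → V, Function.Injective F ∧
        ∀ u v, u ≠ root → v ≠ root → edgeCol χ par F u = edgeCol χ par F v → u = v := by
  have hkr : (1 : ℝ) ≤ k := by exact_mod_cast hk1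
  -- constants
  obtain ⟨g₀, hg₀1, hg₀⟩ : ∃ g₀ : ℕ, 1 ≤ g₀ ∧ (1 / 2 : ℝ) ^ g₀ ≤ ε / 64 := by
    obtain ⟨g₀, hg₀⟩ := exists_pow_lt_of_lt_one (show 0 < ε / 64 by positivity)
      (show (1 / 2 : ℝ) < 1 by norm_num)
    refine ⟨g₀, ?_, hg₀.le⟩
    rcases Nat.eq_zero_or_pos g₀ with h | h
    · rw [h, pow_zero] at hg₀
      linarith
    · exact h
  obtain ⟨γ, hγ⟩ : ∃ γ : ℝ, γ = 1 / 2 ^ g₀ := ⟨_, rfl⟩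
  have hγ0 : 0 < γ := by rw [hγ]; positivity
  have hγε : γ ≤ ε / 64 := by rw [hγ, ← one_div_pow]; exact hg₀
  obtain ⟨c, hc⟩ : ∃ c : ℝ, c = γ ^ 5 / (32 * (k + 1)) := ⟨_, rfl⟩
  have hc0 : 0 < c := by rw [hc]; positivity
  have hcγ : (k + 1) * c = γ ^ 5 / 32 := by rw [hc]; field_simp
  have hγ5 : γ ^ 5 / 32 ≤ γ := by
    have : γ ^ 4 ≤ 1 := pow_le_one₀ hγ0.le (by linarith)
    have h2 : γ ^ 5 ≤ γ := by
      calc γ ^ 5 = γ ^ 4 * γ := by ring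
        _ ≤ 1 * γ := mul_le_mul_of_nonneg_right this hγ0.le
        _ = γ := one_mul _
    linarith
  have hc1 : c ≤ 1 := by nlinarith
  obtain ⟨L, hL⟩ := exists_nat_ge (48 / c)
  have hL0 : (0 : ℝ) < L := lt_of_lt_of_le (by positivity) hL
  have hL1 : 1 ≤ L := by exact_mod_cast hL0
  rw [div_le_iff₀ hc0] at hL
  obtain ⟨a, ha⟩ := pow_unbounded_of_one_lt (16 * (2 * L + 1) / ε) (show (1 : ℝ) < 2 by norm_num)
  obtain ⟨M, hM⟩ : ∃ M : ℕ, M = 2 ^ a := ⟨_, rfl⟩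
  have hM1 : 1 ≤ M := by rw [hM]; exact Nat.one_le_two_pow
  have hMr : (1 : ℝ) ≤ M := by exact_mod_cast hM1
  have hLM : 16 * (2 * L + 1) ≤ ε * M := by
    rw [div_lt_iff₀ hε] at ha
    rw [hM]
    push_cast
    linarith
  obtain ⟨τ, hτ⟩ : ∃ τ : ℝ, τ = ε / (32 * M ^ 2) := ⟨_, rfl⟩
  have hτ0 : 0 < τ := by rw [hτ]; positivity
  have hτ1 : τ ≤ 1 := by
    rw [hτ, div_le_one (by positivity)]
    nlinarith
  obtain ⟨N, hN⟩ := exists_nat_ge (64 * M / c)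
  have hN1 : 1 ≤ N := by
    have : (0 : ℝ) < N := lt_of_lt_of_le (by positivity) hN
    exact_mod_cast this
  obtain ⟨δ, hδ, hround⟩ := exists_rounds N hN1
  obtain ⟨θ, hθ⟩ : ∃ θ : ℝ, θ = c * τ ^ 3 / (128 * M * (1 + k)) := ⟨_, rfl⟩
  have hθ0 : 0 < θ := by rw [hθ]; positivity
  have hθc : θ ≤ c / 8 := by
    rw [hθ, div_le_iff₀ (by positivity)]
    have h1 : τ ^ 3 ≤ 1 := pow_le_one₀ hτ0.le hτ1
    have h2 : 1 ≤ 1 / 8 * (128 * M * (1 + k) : ℝ) := by nlinarith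
    calc c * τ ^ 3 ≤ c * 1 := mul_le_mul_of_nonneg_left h1 hc0.le
      _ ≤ c * (1 / 8 * (128 * M * (1 + k) : ℝ)) := mul_le_mul_of_nonneg_left h2 hc0.le
      _ = _ := by ring
  obtain ⟨n₁, hn₁⟩ := exists_reserve k g₀ hk1 hg₀1 γ hγ
  obtain ⟨n₂, hn₂⟩ := exists_split k a M hM hk1 θ hθ0
  have hev : ∀ C : ℝ, ∀ᶠ n : ℕ in Filter.atTop, C ≤ (n : ℝ) := fun C =>
    tendsto_natCast_atTop_atTop.eventually_ge_atTop C
  obtain ⟨n₀, hn₀⟩ := Filter.eventually_atTop.1 ((Filter.eventually_ge_atTop (n₁ + n₂ + 1)).and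
    ((hev (1 / γ)).and ((hev (256 / c)).and ((hev (8 * k * M / ε)).and ((hev (1 / τ)).and
    ((hev (32 * M / c)).and ((eventually_clog_pow_le (k / (δ * τ)) 6).and
    ((eventually_le_clog (64 / c)).and (eventually_le_clog (16 * k / ε))))))))))
  refine ⟨n₀, ?_⟩
  intro α V Z _ _ _ _ _ _ χ root par dep hsymm hk hroot hdep0 hdep hcard hm
  obtain ⟨h1, h2, h3, h4, h5, h6, h7, h8, h9⟩ := hn₀ _ hcard
  set h := Nat.clog 2 (Fintype.card V) with hh
  set n : ℝ := (Fintype.card V : ℝ) with hn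
  have hn1 : 1 ≤ Fintype.card V := by omega
  have hnr : (1 : ℝ) ≤ n := by rw [hn]; exact_mod_cast hn1
  have hn0 : 0 < n := by linarith
  have hhr : (0 : ℝ) < h := lt_of_lt_of_le (by positivity) h8
  have hh1 : 1 ≤ h := by exact_mod_cast hhr
  have hhr1 : (1 : ℝ) ≤ h := by exact_mod_cast hh1
  have hh6 : (h : ℝ) ≤ (h : ℝ) ^ 6 := le_self_pow₀ hhr1 (by norm_num)
  obtain ⟨cap, D, η, hcap0, hD, hcapn, hcap, H1, H2, H3, H4, hη⟩ :=
    exists_round_parameters ε c τ θ δ (Fintype.card V) k M N h hε hε1 hc0 hc1 hδ hk1 hM1 hτ hθ hN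
      hn1 h4 h5 h6 hh1 h7
  rw [← hn] at hcap H1 H2 H4 hη
  rw [div_le_iff₀ hγ0] at h2
  rw [div_le_iff₀ hc0] at h3 h8
  rw [div_le_iff₀ hε] at h9
  -- the vertices with many children
  have hmn : (Fintype.card α : ℝ) ≤ n := by
    calc (Fintype.card α : ℝ) ≤ k * Fintype.card α := le_mul_of_one_le_left (Nat.cast_nonneg _) hkr
      _ ≤ (1 - ε) * n := hm
      _ ≤ n := mul_le_of_le_one_left hn0.le (by linarith)
  have hbig := card_big_mul_le root par (h ^ 6)
  obtain ⟨Big, hBig⟩ : ∃ Big : Finset α,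
    Big = univ.filter fun u => h ^ 6 < #(univ.filter fun v => v ≠ root ∧ par v = u) := ⟨_, rfl⟩
  rw [← hBig] at hbig
  have hbig' : #Big * h ^ 6 ≤ Fintype.card V :=
    hbig.trans (by have := hmn; rw [hn] at this; exact_mod_cast this)
  have hbigr : (#Big : ℝ) * h ≤ n := by
    have e : (#Big : ℝ) * (h : ℝ) ^ 6 ≤ n := by rw [hn]; exact_mod_cast hbig'
    exact (mul_le_mul_of_nonneg_left hh6 (Nat.cast_nonneg _)).trans e
  have hbigc : 64 * (#Big : ℝ) ≤ c * n := by
    calc 64 * (#Big : ℝ) ≤ (h * c) * #Big := mul_le_mul_of_nonneg_right h8 (Nat.cast_nonneg _)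
      _ = c * (#Big * h) := by ring
      _ ≤ _ := mul_le_mul_of_nonneg_left hbigr hc0.le
  have hbigk : 16 * (k * (#Big : ℝ)) ≤ ε * n := by
    calc 16 * (k * (#Big : ℝ)) = 16 * k * #Big := by ring
      _ ≤ (h * ε) * #Big := mul_le_mul_of_nonneg_right h9 (Nat.cast_nonneg _)
      _ = ε * (#Big * h) := by ring
      _ ≤ _ := mul_le_mul_of_nonneg_left hbigr hε.le
  obtain ⟨K, Bs, ch, st, S, hBK, hKc, hBsc⟩ :=
    exists_staging root par dep hroot hdep0 hdep L hL1 Big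
  have hsmall : ∀ X : ℕ, L * X ≤ 4 * (Fintype.card α + L * #Big + L) →
      (X : ℝ) ≤ c / 6 * n := by
    intro X hX
    have e : (L : ℝ) * X ≤ 4 * (Fintype.card α + L * #Big + L) := by exact_mod_cast hX
    have e2 : 48 * n ≤ L * c * n := mul_le_mul_of_nonneg_right hL hn0.le
    have e3 : (L : ℝ) * (64 * #Big) ≤ L * (c * n) := mul_le_mul_of_nonneg_left hbigc hL0.le
    have e4 : (L : ℝ) * 256 ≤ L * (n * c) := mul_le_mul_of_nonneg_left h3 hL0.le
    have e5 : 0 < (L : ℝ) * (c * n) := by positivity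
    refine le_of_mul_le_mul_left (?_ : (L : ℝ) * X ≤ L * (c / 6 * n)) hL0
    linarith
  have hK := hsmall _ hKc
  have hBs := hsmall _ hBsc
  -- the reserve
  obtain ⟨V₀, B, Z₀, hV₀, hB, hZ₀, hres⟩ := hn₁ V Z χ hsymm hk (by omega)
  rw [← hn] at hV₀ hB hZ₀ hres
  obtain ⟨R, hRd⟩ : ∃ R : ℕ, R = ⌊c * n⌋₊ := ⟨_, rfl⟩
  have hR1 : (R : ℝ) ≤ c * n := by rw [hRd]; exact Nat.floor_le (by positivity)
  have hR2 : c * n < R + 1 := by rw [hRd]; exact Nat.lt_floor_add_one _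
  have hkR : ((k + 1) * R : ℝ) ≤ γ ^ 5 / 32 * n := by
    calc ((k + 1) * R : ℝ) ≤ (k + 1) * (c * n) := mul_le_mul_of_nonneg_left hR1 (by positivity)
      _ = ((k + 1) * c) * n := by ring
      _ = _ := by rw [hcγ]
  have hkR' : ((k + 1) * R : ℝ) ≤ γ * n := hkR.trans (mul_le_mul_of_nonneg_right hγ5 hn0.le)
  obtain ⟨hRe, hRp⟩ := hres R hkR
  have hKR : #K ≤ R := by
    have : (#K : ℝ) ≤ R := by linarith
    exact_mod_cast this
  have hBγ : (#B : ℝ) ≤ γ * n := by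
    refine hB.trans (mul_le_mul_of_nonneg_right ?_ hn0.le)
    have : γ * γ ≤ 1 * γ := mul_le_mul_of_nonneg_right (by linarith) hγ0.le
    rw [sq]
    linarith
  have hγn : γ * n ≤ ε / 64 * n := mul_le_mul_of_nonneg_right hγε hn0.le
  have hεn : ε * n < n := mul_lt_of_lt_one_left hn0 hε1
  have hB' : ∃ x, x ∉ B := by
    by_contra! hcon
    have e : Fintype.card V ≤ #B := by
      rw [← card_univ]
      exact card_le_card fun x _ => hcon x
    have e' : n ≤ #B := by rw [hn]; exact_mod_cast e
    linarith
  have hgreedy : ReserveEdge χ V₀ᶜ B Z₀ᶜ R := by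
    refine reserveEdge_of_card χ k R hk _ _ _ fun x hx => ?_
    have e := card_le_card_row χ k hk V₀ Z₀ ∅ x
    rw [union_empty, card_empty, zero_mul, add_zero] at e
    have e1 : n ≤ #(univ.filter fun v => v ≠ x ∧ v ∈ V₀ᶜ ∧ χ x v ∈ Z₀ᶜ) + (1 + #V₀ +
        #(univ.filter fun v => v ≠ x ∧ χ x v ∈ Z₀)) := by
      rw [hn]
      exact_mod_cast e
    have e2 := hZ₀ x hx
    have e3 : (#B + R + R * k : ℝ) <
        #(univ.filter fun v => v ≠ x ∧ v ∈ V₀ᶜ ∧ χ x v ∈ Z₀ᶜ) := by linarith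
    exact_mod_cast e3
  obtain ⟨f, hf⟩ := exists_partial_greedy χ root par dep hdep V₀ᶜ B V₀ Z₀ᶜ Z₀
    disjoint_compl_left disjoint_compl_left R hB' hgreedy K hKR
  -- rows
  set C := K.image f with hC
  set C' := (edgesIn root par K).image (edgeCol χ par f) with hC'
  have hCK : #C ≤ R := card_image_le.trans hKR
  have hCK' : #C' ≤ R := card_image_le.trans ((card_filter_le _ _).trans hKR)
  have hrow : ∀ x, x ∉ B → (1 - ε / 8) * n ≤
      ∑ v, if v ≠ x ∧ v ∈ ((V₀ ∪ B) ∪ C)ᶜ ∧ χ x v ∈ (Z₀ ∪ C')ᶜ then (1 : ℝ) else 0 := by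
    intro x hx
    rw [sum_boole]
    have e := card_le_card_row χ k hk ((V₀ ∪ B) ∪ C) Z₀ C' x
    have e0 : #((V₀ ∪ B) ∪ C) ≤ #V₀ + #B + R :=
      (card_union_le _ _).trans (Nat.add_le_add (card_union_le _ _) hCK)
    have e1 : #C' * k ≤ R * k := Nat.mul_le_mul_right _ hCK'
    have e2 : n ≤ #(univ.filter fun v => v ≠ x ∧ v ∈ ((V₀ ∪ B) ∪ C)ᶜ ∧ χ x v ∈ (Z₀ ∪ C')ᶜ) +
        (1 + (#V₀ + #B + R) + #(univ.filter fun v => v ≠ x ∧ χ x v ∈ Z₀) + R * k) := by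
      rw [hn]
      exact_mod_cast e.trans (Nat.add_le_add_left
        (Nat.add_le_add (Nat.add_le_add_right (Nat.add_le_add_left e0 _) _) e1) _)
    have e3 := hZ₀ x hx
    linarith
  -- the stars
  set Star := univ.filter fun v => (st v ≠ 0 ∧ st v ≠ L + 1) ∧ par v ∈ Big with hStar
  have hStarc : ∑ i : Big, #(Star.filter fun v => par v = i) = #Star := by
    rw [sum_coe_sort Big fun i => #(Star.filter fun v => par v = i)]
    exact (card_eq_sum_card_fiberwise fun v hv => (mem_filter.1 hv).2.2).symm
  have hStarm : #Star ≤ Fintype.card α := card_le_univ _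
  obtain ⟨g, hgd⟩ : ∃ g : ℕ, g = (Fintype.card α - #Star) / cap + 1 + 2 * L := ⟨_, rfl⟩
  have hgcap : Fintype.card α + 2 * L * cap ≤ cap * g + #Star := by
    have e := Nat.div_add_mod (Fintype.card α - #Star) cap
    have e2 := Nat.mod_lt (Fintype.card α - #Star) hcap0
    have e3 : cap * g = cap * ((Fintype.card α - #Star) / cap) + cap + 2 * L * cap := by
      rw [hgd]; ring
    omega
  have hgr : (g : ℝ) ≤ ((Fintype.card α : ℝ) - #Star) / cap + (2 * L + 1) := by
    rw [hgd]
    have e : (((Fintype.card α - #Star) / cap : ℕ) : ℝ) ≤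
        ((Fintype.card α - #Star : ℕ) : ℝ) / cap := Nat.cast_div_le
    rw [Nat.cast_sub hStarm] at e
    push_cast
    linarith
  have hdens := density_le_one ε n (Fintype.card α) #Star k M L #Big cap g hε hε1 hn0
    (by linarith) (by linarith) (Nat.cast_nonneg _) (by exact_mod_cast hStarm) hm hLM hbigk
    (by exact_mod_cast hcap0) hcap hgr
  have hgM : g ≤ M := by
    have e : (g : ℝ) / M ≤ 1 := by
      have : (0 : ℝ) ≤ k * (#Star / ((1 - ε / 8) * n) + #Big / n) := by
        have : 0 < 1 - ε / 8 := by linarith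
        positivity
      linarith
    rw [div_le_one (by linarith)] at e
    exact_mod_cast e
  obtain ⟨cls, cls', lab, hlab, hlabc, hdef, hineq⟩ := hn₂ V Z Big χ
    (fun x v => v ≠ x ∧ v ∈ ((V₀ ∪ B) ∪ C)ᶜ ∧ χ x v ∈ (Z₀ ∪ C')ᶜ) (fun i => f i)
    (fun i => #(Star.filter fun v => par v = i)) (1 - ε / 8) g hsymm hk (fun x v hv => hv.1)
    (by omega) (by linarith) (fun i => hrow _ (hf.avoid _ (hBK i.2)))
    (by rw [Fintype.card_coe]; exact hbig') hgM
    (by rw [Fintype.card_coe, hStarc]; exact hdens)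
  have hWd : ∀ v ∈ ((V₀ ∪ B) ∪ C)ᶜ, v ∉ V₀ ∧ v ∉ B ∧ v ∉ C := fun v hv => by
    simp only [mem_compl, mem_union, not_or] at hv
    exact ⟨hv.1.1, hv.1.2, hv.2⟩
  have hQd : ∀ z ∈ (Z₀ ∪ C')ᶜ, z ∉ Z₀ ∧ z ∉ C' := fun z hz => by
    simpa only [mem_compl, mem_union, not_or] using hz
  have hrounds := hround α V Z χ ((V₀ ∪ B) ∪ C)ᶜ V₀ B C (Z₀ ∪ C')ᶜ Z₀ C' cls cls' M g cap
    (h ^ 6) η D k (θ * n / h ^ 4) (τ * n) ((1 - ε / 8) * n) hk1 (Nat.one_le_pow _ _ hh1) hD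
    (by positivity) (by positivity) hM1 hgM hsymm hk hWd hQd hineq hcapn hrow H1 H2 H3 H4
  have hne : Nonempty V := Fintype.card_pos_iff.1 hn1
  obtain ⟨A₁, hA₁, φ, hφ, hφl, hA₁c⟩ := exists_star_matching par Star Big
    (fun v hv => (mem_filter.1 hv).2.2) lab (θ * n) hdef
  refine exists_embedding (η := η) (ηs := #(Star \ A₁)) (R := R) S hBK (fun u hu => ?_)
    (fun i => ?_) (fun i => ?_) subset_union_left subset_union_left hf
    ⟨A₁, hA₁, φ, hφ, ?_, ?_, ?_, le_rfl⟩ hrounds hcap0 hgcap hRe hRp ?_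
  · rw [hBig] at hu
    simpa using hu
  · refine union_subset_union_right fun v hv => ?_
    simp only [mem_filter] at hv ⊢
    exact ⟨hv.1, hv.2.imp_right (by omega)⟩
  · refine union_subset_union_right fun v hv => ?_
    simp only [mem_filter] at hv ⊢
    exact ⟨hv.1, hv.2.imp_right (by omega)⟩
  · intro v hv
    obtain ⟨hvB, hvl⟩ := hφl v hv
    obtain ⟨⟨-, e1, -⟩, e2, -⟩ := hlab _ _ hvl
    obtain ⟨e3, e4, e5⟩ := hWd _ e1
    exact ⟨e4, mem_union_right _ (mem_filter.2 ⟨e1, Or.inl e2⟩), e5, e3⟩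
  · intro v hv w hw hvw
    obtain ⟨hvB, hvl⟩ := hφl v hv
    obtain ⟨hwB, hwl⟩ := hφl w hw
    exact hφ hv hw (hlabc _ _ _ _ hvl hwl hvw)
  · intro v hv
    obtain ⟨hvB, hvl⟩ := hφl v hv
    obtain ⟨⟨-, -, e1⟩, -, e2⟩ := hlab _ _ hvl
    obtain ⟨e3, e4⟩ := hQd _ e1
    exact ⟨mem_union_right _ (mem_filter.2 ⟨e1, Or.inl e2⟩), e4, e3⟩
  · have e1 : (η * g : ℝ) ≤ c / 8 * n := by
      refine le_trans (mul_le_mul_of_nonneg_left ?_ (Nat.cast_nonneg _)) hη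
      exact_mod_cast hgM
    have e2 : θ * n ≤ c / 8 * n := mul_le_mul_of_nonneg_right hθc hn0.le
    have e3 : (#(Star \ A₁) + 3 * #Bs + η * g : ℝ) ≤ R := by linarith
    exact_mod_cast e3

end RainbowTrees

/-- Montgomery–Pokrovskiy–Sudakov: For every `ε > 0`, every positive integer
`k`, and all sufficiently large `n`, every locally `k`-bounded edge-coloring of `K_n`
contains a rainbow copy of every tree with at most `(1 - ε) n / k` vertices. A coloring of
the edges of `K_n` is locally `k`-bounded if every vertex is incident to at most `k` edges
of each color. -/
theorem rainbow_trees_locally_bounded (ε : ℝ) (hε : 0 < ε) (k : ℕ) (hk : 0 < k) :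
    ∃ n₀ : ℕ, ∀ n : ℕ, n₀ ≤ n →
      ∀ c : Sym2 (Fin n) → ℕ,
        (∀ (v : Fin n) (col : ℕ), ({u : Fin n | u ≠ v ∧ c s(u, v) = col}).ncard ≤ k) →
        ∀ m : ℕ, (m : ℝ) ≤ (1 - ε) * (n : ℝ) / (k : ℝ) →
          ∀ T : SimpleGraph (Fin m), T.IsTree →
            ∃ f : Fin m → Fin n, Function.Injective f ∧
              Set.InjOn (fun e : Sym2 (Fin m) => c (e.map f)) T.edgeSet := by
  classical
  have hk0 : (0 : ℝ) < k := by exact_mod_cast hk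
  rcases le_or_gt 1 ε with h1 | h1
  · refine ⟨0, fun n _ c _ m hm T hT => ?_⟩
    have hneg : (1 - ε) * (n : ℝ) / (k : ℝ) ≤ 0 :=
      div_nonpos_of_nonpos_of_nonneg
        (mul_nonpos_of_nonpos_of_nonneg (by linarith) (Nat.cast_nonneg n)) hk0.le
    have hm0 : m = 0 := by
      have : (m : ℝ) ≤ 0 := hm.trans hneg
      exact_mod_cast le_antisymm this (Nat.cast_nonneg m)
    subst hm0
    obtain ⟨x⟩ := hT.connected.nonempty
    exact x.elim0
  · obtain ⟨n₀, hn₀⟩ := RainbowTrees.exists_rainbow_embedding ε hε h1 k hk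
    refine ⟨n₀, fun n hn c hc m hm T hT => ?_⟩
    obtain ⟨root, par, dep, hroot, hdep, hpar, hadj⟩ := RainbowTrees.exists_rooted T hT
    let χ : Fin n → Fin n → {z : ℕ // z ∈ Finset.univ.image c} := fun x v =>
      ⟨c s(x, v), Finset.mem_image_of_mem c (Finset.mem_univ _)⟩
    obtain ⟨F, hF, hinj⟩ := hn₀ (Fin m) (Fin n) _ χ root par dep
      (fun x v => Subtype.ext (congrArg c Sym2.eq_swap))
      (fun x z => by
        refine le_trans (le_of_eq ?_) (hc x z.1)
        rw [← Set.ncard_coe_finset]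
        congr 1
        ext u
        simp [χ, Subtype.ext_iff, Sym2.eq_swap (a := x) (b := u)])
      hroot hdep hpar (by simpa using hn)
      (by
        rw [le_div_iff₀ hk0] at hm
        simpa [mul_comm] using hm)
    have hedge : ∀ e ∈ T.edgeSet, ∃ w, w ≠ root ∧ e = s(par w, w) := by
      intro e
      induction e with
      | _ u v =>
        intro h
        rcases hadj u v h with ⟨hu, rfl⟩ | ⟨hv, rfl⟩
        · exact ⟨u, hu, Sym2.eq_swap⟩
        · exact ⟨v, hv, rfl⟩
    refine ⟨F, hF, fun e he e' he' hee => ?_⟩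
    obtain ⟨w, hw, rfl⟩ := hedge e he
    obtain ⟨w', hw', rfl⟩ := hedge e' he'
    rw [hinj w w' hw hw' (Subtype.ext hee)]
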